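/- arXiv:2210.15423 — 2 statements merged into one kernel-verified Lean document; each statement's English description precedes it below -/
import Mathlib

section
/- Let m = 2^s with s ≥ 1 an integer, let d ≥ 1, and suppose n ≥ d + 3·2^{s−1} + 1. If F is a family of nonempty subsets of [n+1] with χ(KG^4(F)) ≤ m, then for any continuous map f : Δ_n → ℝ^d there exist two Radon pairs (σ_1⁺, σ_1⁻) and (σ_2⁺, σ_2⁻) for f such that none of the four intersections σ_1⁺ ∩ σ_2⁺, σ_1⁺ ∩ σ_2⁻, σ_1⁻ ∩ σ_2⁺, σ_1⁻ ∩ σ_2⁻ contains a set from F. -/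
/-- The face `Δ_σ` of the standard simplex spanned by the vertices in `σ`. -/
def simplexFace {n : ℕ} (σ : Finset (Fin n)) : Set (Fin n → ℝ) :=
  {x | x ∈ stdSimplex ℝ (Fin n) ∧ ∀ i, i ∉ σ → x i = 0}

/-- `(σp, σm)` is a Radon pair for `f`: the faces are disjoint and their images intersect. -/
def IsRadonPair {n d : ℕ} (f : (Fin n → ℝ) → EuclideanSpace ℝ (Fin d))
    (σp σm : Finset (Fin n)) : Prop :=
  Disjoint σp σm ∧ (f '' simplexFace σp ∩ f '' simplexFace σm).Nonempty

/-- `χ(KG^r(F)) ≤ m`: `F` can be colored with `m` colors so that no color class contains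
`r` pairwise disjoint members. -/
def KneserChromaticLe {n : ℕ} (F : Finset (Finset (Fin n))) (r m : ℕ) : Prop :=
  ∃ c : Finset (Fin n) → Fin m, ∀ G ⊆ F,
    (∀ A ∈ G, ∀ B ∈ G, A ≠ B → Disjoint A B) →
    (∀ A ∈ G, ∀ B ∈ G, c A = c B) → G.card < r

namespace TRP
open Finsupp

abbrev Ch (V : Type*) := List V →₀ ZMod 2

section chains
variable {V W : Type*}

noncomputable def consL (a : V) : Ch V →ₗ[ZMod 2] Ch V := Finsupp.lmapDomain _ _ (List.cons a)

noncomputable def mapL (f : V → W) : Ch V →ₗ[ZMod 2] Ch W := Finsupp.lmapDomain _ _ (List.map f)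

noncomputable def bdList : List V → Ch V
  | [] => 0
  | a :: l => single l 1 + consL a (bdList l)

noncomputable def bd : Ch V →ₗ[ZMod 2] Ch V := Finsupp.linearCombination (ZMod 2) bdList

@[simp] lemma consL_single (a : V) (l : List V) (c : ZMod 2) :
    consL a (single l c) = single (a :: l) c := by simp [consL, Finsupp.mapDomain_single]

@[simp] lemma mapL_single (f : V → W) (l : List V) (c : ZMod 2) :
    mapL f (single l c) = single (l.map f) c := by simp [mapL, Finsupp.mapDomain_single]

lemma ch_ind {M : Type*} [AddCommMonoid M] [Module (ZMod 2) M] {f g : Ch V →ₗ[ZMod 2] M}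
    (h : ∀ l, f (single l 1) = g (single l 1)) : f = g := by
  apply Finsupp.lhom_ext'
  intro l
  apply LinearMap.ext_ring
  simpa using h l

@[simp] lemma bd_single (l : List V) : bd (single l (1 : ZMod 2)) = bdList l := by
  simp [bd]

lemma bd_consL (a : V) (x : Ch V) : bd (consL a x) = x + consL a (bd x) := by
  have : (bd ∘ₗ consL a : Ch V →ₗ[ZMod 2] Ch V) = LinearMap.id + consL a ∘ₗ bd := by
    apply ch_ind
    intro l
    simp [bdList]
  simpa using congrArg (fun f => f x) this

lemma ch_add_self (x : Ch V) : x + x = 0 := by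
  ext l; simp [CharTwo.add_self_eq_zero]

lemma bd_bd (x : Ch V) : bd (bd x) = 0 := by
  have : (bd ∘ₗ bd : Ch V →ₗ[ZMod 2] Ch V) = 0 := by
    apply ch_ind
    intro l
    induction l with
    | nil => simp [bdList]
    | cons a l ih =>
      simp only [LinearMap.comp_apply, bd_single, LinearMap.zero_apply] at ih ⊢
      simp [bdList, bd_consL, ih, ch_add_self]
  simpa using congrArg (fun f => f x) this

lemma mapL_consL (f : V → W) (a : V) (x : Ch V) :
    mapL f (consL a x) = consL (f a) (mapL f x) := by
  have : (mapL f ∘ₗ consL a : Ch V →ₗ[ZMod 2] Ch W) = consL (f a) ∘ₗ mapL f := by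
    apply ch_ind
    intro l
    simp
  simpa using congrArg (fun f => f x) this

lemma bd_mapL (f : V → W) (x : Ch V) : bd (mapL f x) = mapL f (bd x) := by
  have : (bd ∘ₗ mapL f : Ch V →ₗ[ZMod 2] Ch W) = mapL f ∘ₗ bd := by
    apply ch_ind
    intro l
    induction l with
    | nil => simp [bdList]
    | cons a l ih =>
      simp only [LinearMap.comp_apply, bd_single, mapL_single] at ih ⊢
      simp [bdList, mapL_consL, ih]
  simpa using congrArg (fun f => f x) this

/-- chains supported on lists with property `P`. -/
def Sup (P : List V → Prop) : Submodule (ZMod 2) (Ch V) :=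
  Finsupp.supported (ZMod 2) (ZMod 2) {l | P l}

lemma single_mem_Sup {P : List V → Prop} {l : List V} (c : ZMod 2) (h : P l) :
    single l c ∈ Sup P := Finsupp.single_mem_supported _ _ h

lemma Sup_le {P : List V → Prop} (K : Submodule (ZMod 2) (Ch V))
    (h : ∀ l, P l → single l 1 ∈ K) : Sup P ≤ K := by
  unfold Sup
  rw [Finsupp.supported_eq_span_single]
  apply Submodule.span_le.2
  rintro _ ⟨l, hl, rfl⟩
  exact h l hl

lemma Sup_map {P : List V → Prop} {Q : List W → Prop} (f : Ch V →ₗ[ZMod 2] Ch W)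
    (h : ∀ l, P l → f (single l 1) ∈ Sup Q) {x : Ch V} (hx : x ∈ Sup P) : f x ∈ Sup Q := by
  have : Sup P ≤ (Sup Q).comap f := Sup_le _ (fun l hl => h l hl)
  exact this hx

lemma Sup_eq {M : Type*} [AddCommMonoid M] [Module (ZMod 2) M] {P : List V → Prop}
    (f g : Ch V →ₗ[ZMod 2] M)
    (h : ∀ l, P l → f (single l 1) = g (single l 1)) {x : Ch V} (hx : x ∈ Sup P) :
    f x = g x := by
  have : Sup P ≤ LinearMap.eqLocus f g := Sup_le _ (fun l hl => h l hl)
  exact this hx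

lemma Sup_mono {P Q : List V → Prop} (h : ∀ l, P l → Q l) {x : Ch V} (hx : x ∈ Sup P) :
    x ∈ Sup Q := Sup_map LinearMap.id (fun l hl => single_mem_Sup _ (h l hl)) hx

lemma bdList_mem {P : List V → Prop} (l : List V) (h : ∀ l', l'.Sublist l → l'.length + 1 = l.length → P l') :
    bdList l ∈ Sup P := by
  induction l generalizing P with
  | nil => exact Submodule.zero_mem _
  | cons a l ih =>
    refine Submodule.add_mem _ (single_mem_Sup _ (h _ (List.sublist_cons_self a l) (by simp))) ?_
    have := ih (P := fun l' => P (a :: l')) (fun l' hl' hlen => h _ (hl'.cons_cons a) (by simp [hlen]))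
    exact Sup_map _ (fun l' hl' => by simpa using single_mem_Sup _ hl') this

end chains

section fan
variable {R : Type*} [CommRing R]

/-- Fan alternating polynomials: labels `< n`, length `p`, leading sign `ε`. -/
def fan (x : ℕ → Bool → R) : ℕ → ℕ → Bool → R
  | _, 0, _ => 1
  | 0, _ + 1, _ => 0
  | n + 1, p + 1, ε => fan x n (p + 1) ε + x n ε * fan x n p (!ε)

lemma fan_zero (x : ℕ → Bool → R) (n : ℕ) (ε) : fan x n 0 ε = 1 := by
  cases n <;> simp [fan]

lemma fan_gt (x : ℕ → Bool → R) (n p : ℕ) (ε) (h : n < p) : fan x n p ε = 0 := by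
  induction n generalizing p ε with
  | zero => obtain ⟨p, rfl⟩ := Nat.exists_eq_succ_of_ne_zero (by omega : p ≠ 0); simp [fan]
  | succ n ih =>
    obtain ⟨p, rfl⟩ := Nat.exists_eq_succ_of_ne_zero (by omega : p ≠ 0)
    simp [fan, ih (p+1) ε (by omega), ih p (!ε) (by omega)]

lemma fan_map {R' : Type*} [CommRing R'] (φ : R →+* R') (x : ℕ → Bool → R) (n p : ℕ) (ε) :
    φ (fan x n p ε) = fan (fun j ε => φ (x j ε)) n p ε := by
  induction n generalizing p ε with
  | zero => cases p <;> simp [fan]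
  | succ n ih => cases p <;> simp [fan, ih]

lemma fan_not (x : ℕ → Bool → R) (n p : ℕ) (ε) :
    fan (fun j ε => x j (!ε)) n p ε = fan x n p (!ε) := by
  induction n generalizing p ε with
  | zero => cases p <;> simp [fan]
  | succ n ih => cases p <;> simp [fan, ih]

lemma fan_mul (h2 : (2 : R) = 0) (x : ℕ → Bool → R) (hx : ∀ j ε, x j ε * x j ε = 0)
    (hx' : ∀ j ε, x j ε * x j (!ε) = 0) (n p : ℕ) (ε) :
    (∑ j ∈ Finset.range n, (x j true + x j false)) * fan x n p ε
      = fan x n (p + 1) ε + fan x n (p + 1) (!ε) := by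
  induction n generalizing p ε with
  | zero => simp [fan]
  | succ n ih =>
    have hs : x n true + x n false = x n ε + x n (!ε) := by cases ε <;> simp [add_comm]
    rw [Finset.sum_range_succ, hs]
    cases p with
    | zero =>
      have := ih 0 ε
      simp only [fan, fan_zero, Bool.not_not] at this ⊢
      linear_combination this
    | succ p =>
      have h1 := ih (p+1) ε
      have h3 := ih p (!ε)
      simp only [fan, Bool.not_not] at h1 h3 ⊢
      linear_combination h1 + x n ε * h3 + fan x n p (!ε) * hx n ε + fan x n p (!ε) * hx' n ε
        + x n ε * fan x n (p+1) ε * h2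

end fan
end TRP

namespace TRP
open Finsupp MvPolynomial

section labels
variable {K : Type*} {m : ℕ}

abbrev Lab (K : Type*) (m : ℕ) := K × Fin m × Bool

def Lab.neg (a : Lab K m) : Lab K m := (a.1, a.2.1, !a.2.2)

lemma Lab.neg_neg (a : Lab K m) : a.neg.neg = a := by simp [Lab.neg]

lemma Lab.neg_ne (a : Lab K m) : a.neg ≠ a := by
  intro h
  have := congrArg (fun z => z.2.2) h
  simp [Lab.neg] at this

abbrev Rg (K : Type*) (m : ℕ) := MvPolynomial (Lab K m) (ZMod 2)

noncomputable def cc {Λ : Type*} : MvPolynomial Λ (ZMod 2) →ₗ[ZMod 2] ZMod 2 :=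
  MvPolynomial.lcoeff (ZMod 2) 0

lemma cc_apply {Λ : Type*} (P : MvPolynomial Λ (ZMod 2)) : cc P = constantCoeff P := rfl

lemma cc_mul {Λ : Type*} (P Q : MvPolynomial Λ (ZMod 2)) : cc (P * Q) = cc P * cc Q := by
  simp [cc_apply]

@[simp] lemma cc_X {Λ : Type*} (a : Λ) : cc (X a : MvPolynomial Λ (ZMod 2)) = 0 := by
  simp [cc_apply]

noncomputable def DD {Λ : Type*} (a : Λ) : MvPolynomial Λ (ZMod 2) →ₗ[ZMod 2] MvPolynomial Λ (ZMod 2) :=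
  (pderiv a).toLinearMap

lemma DD_mul {Λ : Type*} (a : Λ) (P Q : MvPolynomial Λ (ZMod 2)) :
    DD a (P * Q) = P * DD a Q + Q * DD a P := by
  simp [DD]

lemma DD_X_self {Λ : Type*} (a : Λ) : DD a (X a : MvPolynomial Λ (ZMod 2)) = 1 := by
  simp [DD]

lemma DD_X_ne {Λ : Type*} {a b : Λ} (h : b ≠ a) : DD a (X b : MvPolynomial Λ (ZMod 2)) = 0 := by
  simp [DD, pderiv_X_of_ne h]

lemma mv_two {Λ : Type*} : (2 : MvPolynomial Λ (ZMod 2)) = 0 := CharTwo.two_eq_zero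

lemma mv_add_self {Λ : Type*} (P : MvPolynomial Λ (ZMod 2)) : P + P = 0 := CharTwo.add_self_eq_zero P

noncomputable def xx (k : K) (j : ℕ) (ε : Bool) : Rg K m :=
  if h : j < m then X (k, ⟨j, h⟩, ε) else 0

noncomputable def ek (m : ℕ) (k : K) : Rg K m := ∑ j ∈ Finset.range m, (xx k j true + xx k j false)

noncomputable def ee {Λ : Type*} [Fintype Λ] : MvPolynomial Λ (ZMod 2) := ∑ a, X a

lemma ee_eq [Fintype K] : (ee : Rg K m) = ∑ k, ek m k := by
  unfold ee ek
  rw [Fintype.sum_prod_type]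
  refine Finset.sum_congr rfl fun k _ => ?_
  rw [Fintype.sum_prod_type, Finset.sum_range]
  refine Finset.sum_congr rfl fun j _ => ?_
  simp [xx]

lemma cc_ee {Λ : Type*} [Fintype Λ] : cc (ee : MvPolynomial Λ (ZMod 2)) = 0 := by
  simp [ee]

lemma DD_ee {Λ : Type*} [Fintype Λ] (a : Λ) : DD a (ee : MvPolynomial Λ (ZMod 2)) = 1 := by
  classical
  simp only [ee, map_sum]
  rw [Finset.sum_eq_single a]
  · exact DD_X_self a
  · intro b _ hb; exact DD_X_ne hb
  · simp

lemma DD_ee_mul {Λ : Type*} [Fintype Λ] (a : Λ) (P : MvPolynomial Λ (ZMod 2)) :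
    DD a (ee * P) = P + ee * DD a P := by
  rw [DD_mul, DD_ee]; ring

lemma DD_rename {Λ Λ' : Type*} (φ : Λ ≃ Λ') (a : Λ) (P : MvPolynomial Λ (ZMod 2)) :
    DD (φ a) (rename φ P) = rename φ (DD a P) := by
  simp [DD, pderiv_rename φ.injective]

lemma cc_rename {Λ Λ' : Type*} (φ : Λ → Λ') (P : MvPolynomial Λ (ZMod 2)) :
    cc (rename φ P) = cc P := by
  simp [cc_apply]

/-- generators of the relations -/
def gens : Set (Rg K m) := {P | ∃ a : Lab K m, P = X a * X a ∨ P = X a * X a.neg}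

noncomputable def II : Ideal (Rg K m) := Ideal.span gens

noncomputable def fn (m : ℕ) (k : K) (p : ℕ) (ε : Bool) : Rg K m := fan (xx k) m p ε

lemma fn_zero (k : K) (ε : Bool) : fn m k 0 ε = 1 := fan_zero _ _ _
lemma fn_gt (k : K) (p : ℕ) (ε : Bool) (h : m < p) : fn m k p ε = 0 := fan_gt _ _ _ _ h

lemma ek_fn (k : K) (p : ℕ) (ε : Bool) :
    Ideal.Quotient.mk (II : Ideal (Rg K m)) (ek m k * fn m k p ε)
      = Ideal.Quotient.mk II (fn m k (p+1) ε + fn m k (p+1) (!ε)) := by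
  have := fan_mul (R := Rg K m ⧸ (II : Ideal (Rg K m)))
    (by have := congrArg (Ideal.Quotient.mk (II : Ideal (Rg K m))) (mv_two (Λ := Lab K m))
        rw [map_zero] at this
        exact this)
    (fun j ε => Ideal.Quotient.mk II (xx k j ε)) ?_ ?_ m p ε
  · rw [map_mul, fn, fan_map, map_add, fn, fn, fan_map, fan_map]
    simpa [ek] using this
  · intro j ε
    rw [← map_mul, Ideal.Quotient.eq_zero_iff_mem]
    unfold xx
    split_ifs
    · exact Ideal.subset_span ⟨_, Or.inl rfl⟩
    · simp
  · intro j ε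
    rw [← map_mul, Ideal.Quotient.eq_zero_iff_mem]
    unfold xx
    split_ifs
    · exact Ideal.subset_span ⟨_, Or.inr rfl⟩
    · simp

lemma xx_rename {K' : Type*} (φ : Lab K m → Lab K' m) (k : K) (k' : K') (σ : Bool → Bool)
    (h : ∀ j ε, φ (k, j, ε) = (k', j, σ ε)) (j : ℕ) (ε : Bool) :
    rename φ (xx k j ε : Rg K m) = xx k' j (σ ε) := by
  unfold xx
  split_ifs
  · simp [h]
  · simp

lemma fn_rename_id {K' : Type*} (φ : Lab K m → Lab K' m) (k : K) (k' : K')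
    (h : ∀ j ε, φ (k, j, ε) = (k', j, ε)) (p : ℕ) (ε : Bool) :
    rename φ (fn m k p ε) = fn m k' p ε := by
  have := fan_map (rename (R := ZMod 2) φ).toRingHom (xx k) m p ε
  simp only [AlgHom.toRingHom_eq_coe, RingHom.coe_coe, xx_rename φ k k' id h, id] at this
  exact this

lemma fn_rename_not {K' : Type*} (φ : Lab K m → Lab K' m) (k : K) (k' : K')
    (h : ∀ j ε, φ (k, j, ε) = (k', j, !ε)) (p : ℕ) (ε : Bool) :
    rename φ (fn m k p ε) = fn m k' p (!ε) := by
  have := fan_map (rename (R := ZMod 2) φ).toRingHom (xx k) m p ε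
  simp only [AlgHom.toRingHom_eq_coe, RingHom.coe_coe, xx_rename φ k k' (fun b => !b) h] at this
  rw [fan_not] at this
  exact this

lemma cc_fn (k : K) (p : ℕ) (ε : Bool) : cc (fn m k p ε) = if p = 0 then 1 else 0 := by
  split_ifs with h
  · subst h; rw [fn_zero]; simp [cc_apply]
  · have hx : ∀ j ε, constantCoeff (xx k j ε : Rg K m) = 0 := by
      intro j ε; unfold xx; split_ifs <;> simp
    rw [cc_apply, fn, fan_map]
    simp only [hx]
    generalize m = n
    induction n generalizing p ε with
    | zero => cases p <;> simp_all [fan]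
    | succ n ih =>
      cases p with
      | zero => simp at h
      | succ p => simp [fan, ih (p+1) ε h]

/-- `fn m k p ε` with `p ≥ 2` (or `p=1`, `ε=false`) is a combination of multiples of negative variables. -/
lemma fn_neg_mem (k : K) (p : ℕ) (ε : Bool) (h : 2 ≤ p ∨ (p = 1 ∧ ε = false)) :
    fn m k p ε ∈ Ideal.span {P : Rg K m | ∃ j, P = X (k, j, false)} := by
  have hx : ∀ j, (xx k j false : Rg K m) ∈ Ideal.span {P : Rg K m | ∃ j, P = X (k, j, false)} := by
    intro j; unfold xx; split_ifs
    · exact Ideal.subset_span ⟨_, rfl⟩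
    · simp
  unfold fn
  suffices ∀ n, fan (xx k) n p ε ∈ Ideal.span {P : Rg K m | ∃ j, P = X (k, j, false)} from this m
  intro n
  induction n generalizing p ε with
  | zero => cases p <;> simp_all [fan]
  | succ n ih =>
    obtain ⟨p, rfl⟩ := Nat.exists_eq_succ_of_ne_zero (by omega : p ≠ 0)
    simp only [fan]
    refine Ideal.add_mem _ (ih _ _ h) ?_
    cases ε with
    | false => exact Ideal.mul_mem_right _ _ (hx n)
    | true =>
      refine Ideal.mul_mem_left _ _ (ih _ _ ?_)
      rcases h with h | h
      · by_cases hp : p = 1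
        · right; simp [hp]
        · left; omega
      · simp at h

end labels
end TRP

namespace TRP
open Finsupp MvPolynomial

section EZ
variable {S Λ : Type*}

def aug {V : Type*} : Ch V →ₗ[ZMod 2] ZMod 2 := Finsupp.lapply []

@[simp] lemma aug_nil {V : Type*} : aug (single ([] : List V) (1 : ZMod 2)) = 1 := by simp [aug]
@[simp] lemma aug_cons {V : Type*} (a : V) (l : List V) : aug (single (a :: l) (1 : ZMod 2)) = 0 := by
  simp [aug]

abbrev Rp (Λ : Type*) := MvPolynomial Λ (ZMod 2)

noncomputable def G (lab : S → S → Λ) : List S → List S → (Rp Λ →ₗ[ZMod 2] ZMod 2)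
  | [], _ => 0
  | _ :: _, [] => 0
  | a :: s, b :: t => (G lab s (b :: t) + G lab (a :: s) t
      + (aug (single s 1) * aug (single t 1)) • cc) ∘ₗ DD (lab a b)
  termination_by s t => s.length + t.length

@[simp] lemma G_nil (lab : S → S → Λ) (t) : G lab [] t = 0 := by rw [G]
@[simp] lemma G_nil' (lab : S → S → Λ) (t) : G lab t [] = 0 := by cases t <;> rw [G]
lemma G_cons (lab : S → S → Λ) (a s b t) : G lab (a :: s) (b :: t) = (G lab s (b :: t) + G lab (a :: s) t
      + (aug (single s 1) * aug (single t 1)) • cc) ∘ₗ DD (lab a b) := by rw [G]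

noncomputable def GG (lab : S → S → Λ) : Ch S →ₗ[ZMod 2] Ch S →ₗ[ZMod 2] (Rp Λ →ₗ[ZMod 2] ZMod 2) :=
  Finsupp.linearCombination (ZMod 2) (fun s => Finsupp.linearCombination (ZMod 2) (fun t => G lab s t))

@[simp] lemma GG_single (lab : S → S → Λ) (s t) : GG lab (single s 1) (single t 1) = G lab s t := by
  simp [GG]

lemma bil_ext {M : Type*} [AddCommMonoid M] [Module (ZMod 2) M] {V W : Type*}
    {f g : Ch V →ₗ[ZMod 2] Ch W →ₗ[ZMod 2] M}
    (h : ∀ s t, f (single s 1) (single t 1) = g (single s 1) (single t 1)) : f = g :=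
  ch_ind fun s => ch_ind fun t => h s t

@[simp] lemma GG_nil (lab : S → S → Λ) (y) : GG lab (single [] 1) y = 0 := by
  have : GG lab (single [] 1) = 0 := ch_ind (fun t => by simp)
  rw [this]; rfl
@[simp] lemma GG_nil' (lab : S → S → Λ) (x) : GG lab x (single [] 1) = 0 := by
  have : (GG lab).flip (single [] 1) = 0 := ch_ind (fun t => by simp)
  exact congrArg (fun f => f x) this

lemma GG_cons (lab : S → S → Λ) (a b : S) (x y : Ch S) (P) :
    GG lab (consL a x) (consL b y) P = GG lab x (consL b y) (DD (lab a b) P)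
      + GG lab (consL a x) y (DD (lab a b) P) + aug x * aug y * cc (DD (lab a b) P) := by
  have : (GG lab).compl₁₂ (consL a) (consL b) =
      ((GG lab).compl₁₂ LinearMap.id (consL b) + (GG lab).compl₁₂ (consL a) LinearMap.id
        + ((LinearMap.mul (ZMod 2) (ZMod 2)).compl₁₂ aug aug).compr₂ (LinearMap.toSpanSingleton _ _ cc)).compr₂
          (LinearMap.lcomp (ZMod 2) _ (DD (lab a b))) := by
    apply bil_ext
    intro s t
    simp only [LinearMap.compl₁₂_apply, consL_single, GG_single, G_cons, LinearMap.compr₂_apply,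
      LinearMap.add_apply, LinearMap.id_apply, LinearMap.mul_apply', LinearMap.toSpanSingleton_apply,
      LinearMap.lcomp_apply']
  have := congrArg (fun f => f x y P) this
  simpa using this

lemma aug_bd_single (s : List S) (a : S) : aug (bdList (a :: s)) = aug (single s 1) := by
  have : ∀ x : Ch S, aug (consL a x) = 0 := by
    intro x
    have : (aug ∘ₗ consL a : Ch S →ₗ[ZMod 2] ZMod 2) = 0 := ch_ind (fun t => by simp)
    exact congrArg (fun f => f x) this
  simp [bdList, this]

lemma G_bd [Fintype Λ] (lab : S → S → Λ) (s t : List S) (P) :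
    G lab s t (ee * P) = GG lab (bdList s) (single t 1) P + GG lab (single s 1) (bdList t) P
      + aug (bdList s) * aug (bdList t) * cc P := by
  match s, t with
  | [], t => simp [bdList]
  | a :: s, [] => simp [bdList]
  | a :: s, b :: t =>
    have h1 := G_bd lab s (b :: t) (DD (lab a b) P)
    have h2 := G_bd lab (a :: s) t (DD (lab a b) P)
    have e1 := GG_cons lab a b (bdList s) (single t 1) P
    have e2 := GG_cons lab a b (single s 1) (bdList t) P
    rw [aug_bd_single] at h1 h2
    rw [G_cons, aug_bd_single, aug_bd_single]
    simp only [bdList, map_add, LinearMap.add_apply, consL_single, GG_single, LinearMap.comp_apply,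
      LinearMap.smul_apply, DD_ee_mul, smul_eq_mul, cc_mul, cc_ee] at h1 h2 e1 e2 ⊢
    rw [e1, e2, h1, h2]
    have := CharTwo.add_self_eq_zero (G lab s t (DD (lab a b) P))
    linear_combination this
  termination_by s.length + t.length

lemma GG_bd [Fintype Λ] (lab : S → S → Λ) (x y : Ch S) (P) :
    GG lab x y (ee * P) = GG lab (bd x) y P + GG lab x (bd y) P
      + aug (bd x) * aug (bd y) * cc P := by
  have : (GG lab).compr₂ (LinearMap.lcomp (ZMod 2) _ (LinearMap.mulLeft (ZMod 2) (ee : Rp Λ))) =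
      ((GG lab).compl₁₂ bd LinearMap.id + (GG lab).compl₁₂ LinearMap.id bd
        + ((LinearMap.mul (ZMod 2) (ZMod 2)).compl₁₂ (aug ∘ₗ bd) (aug ∘ₗ bd)).compr₂
          (LinearMap.toSpanSingleton _ _ cc)) := by
    apply bil_ext
    intro s t
    refine LinearMap.ext fun P => ?_
    simpa using G_bd lab s t P
  have := congrArg (fun f => f x y P) this
  simpa using this

lemma G_rename (lab lab' : S → S → Λ) (σ : S → S) (φ : Λ ≃ Λ)
    (h : ∀ a b, lab' (σ a) b = φ (lab a b)) (s t P) :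
    G lab' (s.map σ) t (rename φ P) = G lab s t P := by
  match s, t with
  | [], t => simp
  | a :: s, [] => simp
  | a :: s, b :: t =>
    have h1 := G_rename lab lab' σ φ h s (b :: t) (DD (lab a b) P)
    have h2 := G_rename lab lab' σ φ h (a :: s) t (DD (lab a b) P)
    have h3 : aug (single (s.map σ) (1 : ZMod 2)) = aug (single s 1) := by
      cases s <;> simp
    simp only [List.map_cons] at h2
    simp only [List.map_cons, G_cons, LinearMap.add_apply, LinearMap.comp_apply,
      LinearMap.smul_apply, h, DD_rename, h1, h2, h3, cc_rename]
  termination_by s.length + t.length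

lemma G_swap (lab lab' : S → S → Λ) (φ : Λ ≃ Λ)
    (h : ∀ a b, lab' b a = φ (lab a b)) (s t P) :
    G lab' t s (rename φ P) = G lab s t P := by
  match s, t with
  | [], t => simp
  | a :: s, [] => simp
  | a :: s, b :: t =>
    have h1 := G_swap lab lab' φ h s (b :: t) (DD (lab a b) P)
    have h2 := G_swap lab lab' φ h (a :: s) t (DD (lab a b) P)
    simp only [G_cons, LinearMap.add_apply, LinearMap.comp_apply,
      LinearMap.smul_apply, h, DD_rename, h1, h2, cc_rename, smul_eq_mul]
    ring
  termination_by s.length + t.length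

lemma GG_rename (lab : S → S → Λ) (σ : S → S) (φ : Λ ≃ Λ)
    (h : ∀ a b, lab (σ a) b = φ (lab a b)) (x y P) :
    GG lab (mapL σ x) y (rename φ P) = GG lab x y P := by
  have : ((GG lab).compl₁₂ (mapL σ) LinearMap.id).compr₂
      (LinearMap.lcomp (ZMod 2) _ (rename (R := ZMod 2) φ).toLinearMap) = GG lab := by
    apply bil_ext
    intro s t
    refine LinearMap.ext fun P => ?_
    simpa using G_rename lab lab σ φ h s t P
  have := congrArg (fun f => f x y P) this
  simpa using this

lemma GG_swap (lab : S → S → Λ) (φ : Λ ≃ Λ)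
    (h : ∀ a b, lab b a = φ (lab a b)) (x y P) :
    GG lab y x (rename φ P) = GG lab x y P := by
  have : ((GG lab).flip).compr₂
      (LinearMap.lcomp (ZMod 2) _ (rename (R := ZMod 2) φ).toLinearMap) = GG lab := by
    apply bil_ext
    intro s t
    refine LinearMap.ext fun P => ?_
    simpa using G_swap lab lab φ h s t P
  have := congrArg (fun f => f x y P) this
  simpa using this

lemma G_X (lab : S → S → Λ) (b : Λ) (s t) (h : ∀ a ∈ s, ∀ c ∈ t, lab a c ≠ b) (Q) :
    G lab s t (X b * Q) = 0 := by
  match s, t with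
  | [], t => simp
  | a :: s, [] => simp
  | a :: s, c :: t =>
    have h1 := G_X lab b s (c :: t) (fun a' ha' => h a' (by simp [ha'])) (DD (lab a c) Q)
    have h2 := G_X lab b (a :: s) t (fun a' ha' c' hc' => h a' ha' c' (by simp [hc'])) (DD (lab a c) Q)
    have h3 : DD (lab a c) (X b * Q) = X b * DD (lab a c) Q := by
      rw [DD_mul, DD_X_ne (h a (by simp) c (by simp)).symm]; simp
    simp [G_cons, h3, h1, h2, cc_mul]
  termination_by s.length + t.length

lemma G_XX (lab : S → S → Λ) (b : Λ) (s t) (Q) :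
    G lab s t (X b * X b * Q) = 0 := by
  match s, t with
  | [], t => simp
  | a :: s, [] => simp
  | a :: s, c :: t =>
    have h1 := G_XX lab b s (c :: t) (DD (lab a c) Q)
    have h2 := G_XX lab b (a :: s) t (DD (lab a c) Q)
    have h3 : DD (lab a c) (X b * X b * Q) = X b * X b * DD (lab a c) Q := by
      rw [DD_mul, DD_mul, mv_add_self]; simp
    simp [G_cons, h3, h1, h2, cc_mul]
  termination_by s.length + t.length

variable [Preorder S] {K : Type*} {m : ℕ}

def srt {S : Type*} [Preorder S] (l : List S) : Prop := l.Pairwise (fun a b => b ≤ a)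

lemma G_XN (lab : S → S → Lab K m) (hc : ∀ s s' t t', s ≤ s' → t ≤ t' → lab s t ≠ (lab s' t').neg)
    (b : Lab K m) (s t) (hs : srt s) (ht : srt t) (Q) :
    G lab s t (X b * X b.neg * Q) = 0 := by
  match s, t with
  | [], t => simp
  | a :: s, [] => simp
  | a :: s, c :: t =>
    have hs' := (List.pairwise_cons.1 hs)
    have ht' := (List.pairwise_cons.1 ht)
    have h1 := fun Q => G_XN lab hc b s (c :: t) hs'.2 ht Q
    have h2 := fun Q => G_XN lab hc b (a :: s) t hs ht'.2 Q
    have k1 : ∀ Q, G lab s (c :: t) (X (lab a c).neg * Q) = 0 := fun Q => by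
      apply G_X
      intro a' ha' c' hc'
      refine hc _ _ _ _ (hs'.1 a' ha') ?_
      rcases List.mem_cons.1 hc' with rfl | h
      · exact le_rfl
      · exact ht'.1 _ h
    have k2 : ∀ Q, G lab (a :: s) t (X (lab a c).neg * Q) = 0 := fun Q => by
      apply G_X
      intro a' ha' c' hc'
      refine hc _ _ _ _ ?_ (ht'.1 c' hc')
      rcases List.mem_cons.1 ha' with rfl | h
      · exact le_rfl
      · exact hs'.1 _ h
    by_cases hb : lab a c = b
    · subst hb
      have h3 : DD (lab a c) (X (lab a c) * X (lab a c).neg * Q)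
          = X (lab a c) * X (lab a c).neg * DD (lab a c) Q + X (lab a c).neg * Q := by
        rw [DD_mul, DD_mul, DD_X_self, DD_X_ne (Lab.neg_ne _)]; ring
      simp [G_cons, h3, h1, h2, k1, k2, cc_mul]
    · by_cases hb' : lab a c = b.neg
      · have hb2 : b = (lab a c).neg := by rw [hb', Lab.neg_neg]
        have h3 : DD (lab a c) (X b * X b.neg * Q)
            = X b * X b.neg * DD (lab a c) Q + X (lab a c).neg * Q := by
          rw [← hb', DD_mul, DD_mul, DD_X_self, DD_X_ne (fun h => hb h.symm), ← hb2]; ring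
        simp [G_cons, h3, h1, h2, k1, k2, cc_mul]
      · have h3 : DD (lab a c) (X b * X b.neg * Q)
            = X b * X b.neg * DD (lab a c) Q := by
          rw [DD_mul, DD_mul, DD_X_ne (fun h => hb h.symm), DD_X_ne (fun h => hb' h.symm)]; ring
        simp [G_cons, h3, h1, h2, cc_mul]
  termination_by s.length + t.length

lemma G_II (lab : S → S → Lab K m) (hc : ∀ s s' t t', s ≤ s' → t ≤ t' → lab s t ≠ (lab s' t').neg)
    (s t) (hs : srt s) (ht : srt t) (P) (hP : P ∈ (II : Ideal (Rg K m))) :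
    G lab s t P = 0 := by
  suffices ∀ Q, G lab s t (P * Q) = 0 by simpa using this 1
  unfold II Ideal.span at hP
  induction hP using Submodule.span_induction with
  | mem x h =>
    obtain ⟨a, rfl | rfl⟩ := h
    · exact G_XX lab a s t
    · exact G_XN lab hc a s t hs ht
  | zero => simp
  | add x y _ _ hx hy => intro Q; simp [add_mul, hx, hy]
  | smul r x _ hx =>
    intro Q
    have : (r • x) * Q = x * (r * Q) := by simp only [smul_eq_mul]; ring
    rw [this, hx]

lemma GG_II (lab : S → S → Lab K m) (hc : ∀ s s' t t', s ≤ s' → t ≤ t' → lab s t ≠ (lab s' t').neg)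
    {x y : Ch S} (hx : x ∈ Sup srt) (hy : y ∈ Sup srt) (P Q)
    (hP : Ideal.Quotient.mk (II : Ideal (Rg K m)) P = Ideal.Quotient.mk II Q) :
    GG lab x y P = GG lab x y Q := by
  rw [Ideal.Quotient.mk_eq_mk_iff_sub_mem] at hP
  rw [← sub_eq_zero, ← map_sub]
  have h1 : ∀ s, srt s → ∀ y ∈ Sup srt, GG lab (single s 1) y (P - Q) = 0 := by
    intro s hs y hy
    exact Sup_eq ((LinearMap.applyₗ (P - Q)).comp (GG lab (single s 1))) 0
      (fun t ht => by simpa using G_II lab hc s t hs ht _ hP) hy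
  exact Sup_eq ((LinearMap.applyₗ (P - Q)).comp ((GG lab).flip y)) 0
      (fun s hs => by simpa using h1 s hs y hy) hx

end EZ
end TRP

namespace TRP
open Finsupp MvPolynomial

section stage2
variable {m : ℕ}

def fl (k0 : Fin 3) : Lab (Fin 3) m ≃ Lab (Fin 3) m where
  toFun a := (a.1, a.2.1, if a.1 = k0 then a.2.2 else !a.2.2)
  invFun a := (a.1, a.2.1, if a.1 = k0 then a.2.2 else !a.2.2)
  left_inv a := by
    obtain ⟨k, j, ε⟩ := a
    by_cases h : k = k0 <;> simp [h]
  right_inv a := by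
    obtain ⟨k, j, ε⟩ := a
    by_cases h : k = k0 <;> simp [h]

def swk : Equiv.Perm (Fin 3) := Equiv.swap 1 2

def sw : Lab (Fin 3) m ≃ Lab (Fin 3) m := Equiv.prodCongr swk (Equiv.refl _)

/-- product of three Fan polynomials -/
noncomputable def LAB (m : ℕ) (r p q : ℕ) (ε a b : Bool) : Rg (Fin 3) m :=
  fn m 0 r ε * fn m 1 p a * fn m 2 q b

lemma LAB_fl2 (r p q : ℕ) (ε a b) :
    rename (fl 2) (LAB m r p q ε a b) = LAB m r p q (!ε) (!a) b := by
  unfold LAB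
  rw [map_mul, map_mul, fn_rename_not (fl 2) 0 0, fn_rename_not (fl 2) 1 1, fn_rename_id (fl 2) 2 2]
  all_goals intros; simp [fl]

lemma LAB_fl1 (r p q : ℕ) (ε a b) :
    rename (fl 1) (LAB m r p q ε a b) = LAB m r p q (!ε) a (!b) := by
  unfold LAB
  rw [map_mul, map_mul, fn_rename_not (fl 1) 0 0, fn_rename_id (fl 1) 1 1, fn_rename_not (fl 1) 2 2]
  all_goals intros; simp [fl]

lemma LAB_sw (r p q : ℕ) (ε a b) :
    rename sw (LAB m r p q ε a b) = LAB m r q p ε b a := by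
  unfold LAB
  rw [map_mul, map_mul, fn_rename_id sw 0 0, fn_rename_id sw 1 2, fn_rename_id sw 2 1]
  · ring
  all_goals intros; simp [sw, swk]; try decide

lemma LAB_e (r p q : ℕ) (ε a b) :
    Ideal.Quotient.mk (II : Ideal (Rg (Fin 3) m)) (LAB m (r+1) p q ε a b + LAB m (r+1) p q (!ε) a b) =
    Ideal.Quotient.mk II (ee * LAB m r p q ε a b
      + (LAB m r (p+1) q ε a b + LAB m r (p+1) q ε (!a) b)
      + (LAB m r p (q+1) ε a b + LAB m r p (q+1) ε a (!b))) := by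
  have h0 := ek_fn (m := m) (0 : Fin 3) r ε
  have h1 := ek_fn (m := m) (1 : Fin 3) p a
  have h2 := ek_fn (m := m) (2 : Fin 3) q b
  have two : (2 : Rg (Fin 3) m ⧸ (II : Ideal (Rg (Fin 3) m))) = 0 := by
    have := congrArg (Ideal.Quotient.mk (II : Ideal (Rg (Fin 3) m))) (mv_two (Λ := Lab (Fin 3) m))
    rw [map_zero] at this
    exact this
  rw [ee_eq, Fin.sum_univ_three]
  unfold LAB
  simp only [map_mul, map_add] at h0 h1 h2 ⊢
  generalize Ideal.Quotient.mk (II : Ideal (Rg (Fin 3) m)) = φ at *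
  linear_combination (-φ (fn m 1 p a) * φ (fn m 2 q b)) * h0 + (-φ (fn m 0 r ε) * φ (fn m 2 q b)) * h1
    + (-φ (fn m 0 r ε) * φ (fn m 1 p a)) * h2 
    - φ (fn m 0 r ε) * ((φ (fn m 1 (p+1) a) + φ (fn m 1 (p+1) (!a))) * φ (fn m 2 q b)
      + φ (fn m 1 p a) * (φ (fn m 2 (q+1) b) + φ (fn m 2 (q+1) (!b)))) * two

variable {S : Type*} [Preorder S] (ν : S → S) (lab : S → S → Lab (Fin 3) m)

noncomputable def zz (z : ℕ → Ch S) (i : ℤ) : Ch S := if 0 ≤ i then z i.toNat else 0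

lemma zz_mem {z : ℕ → Ch S} {P} (hz : ∀ i, z i ∈ Sup P) (i : ℤ) : zz z i ∈ Sup P := by
  unfold zz; split_ifs
  · exact hz _
  · exact Submodule.zero_mem _

lemma bd_zz {ν} {z : ℕ → Ch S} {N : ℕ} (h0 : bd (z 0) = single [] 1)
    (hs : ∀ i < N, bd (z (i+1)) = z i + mapL ν (z i)) (i : ℤ) (hi : i ≤ N) :
    bd (zz z i) = zz z (i-1) + mapL ν (zz z (i-1)) + (if i = 0 then single [] 1 else 0) := by
  unfold zz
  by_cases h : 0 ≤ i
  · lift i to ℕ using h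
    cases i with
    | zero => simp [h0]
    | succ i =>
      have : (((i+1 : ℕ) : ℤ) - 1) = i := by push_cast; ring
      rw [this]
      have h2 : ((i + 1 : ℕ) : ℤ) ≠ 0 := by positivity
      simp only [h2, if_false, Int.toNat_natCast, Nat.cast_nonneg, if_true, add_zero]
      exact hs i (by omega)
  · have h1 : ¬ (0 ≤ i - 1) := by omega
    have h2 : ¬ (i = 0) := by omega
    rw [if_neg h, if_neg h1, if_neg h2]; simp

lemma aug_mapL (x : Ch S) : aug (mapL ν x) = aug x := by
  have : (aug ∘ₗ mapL ν : Ch S →ₗ[ZMod 2] ZMod 2) = aug := ch_ind (fun t => by cases t <;> simp)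
  exact congrArg (fun f => f x) this

lemma aug_bd_zz {ν} {z : ℕ → Ch S} {N : ℕ} (h0 : bd (z 0) = single [] 1)
    (hs : ∀ i < N, bd (z (i+1)) = z i + mapL ν (z i)) (i : ℤ) (hi : i ≤ N) :
    aug (bd (zz z i)) = if i = 0 then 1 else 0 := by
  rw [bd_zz h0 hs i hi, map_add, map_add, aug_mapL, CharTwo.add_self_eq_zero, zero_add]
  split_ifs <;> simp

/-- reindexing of sums -/
lemma sum_shift (m : ℕ) (f : ℕ → ZMod 2) (h0 : f 0 = 0) (hm : f (m+1) = 0) :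
    ∑ p ∈ Finset.range (m+1), f (p+1) = ∑ p ∈ Finset.range (m+1), f p := by
  rw [Finset.sum_range_succ, hm, add_zero, Finset.sum_range_succ' f, h0, add_zero]

lemma LAB_top1 (r q : ℕ) (ε a b) : LAB m r (m+1) q ε a b = 0 := by
  simp [LAB, fn_gt]
lemma LAB_top2 (r p : ℕ) (ε a b) : LAB m r p (m+1) ε a b = 0 := by
  simp [LAB, fn_gt]
lemma LAB_top0 (p q : ℕ) (ε a b) : LAB m (m+1) p q ε a b = 0 := by
  simp [LAB, fn_gt]
lemma LAB_bot1 (r q : ℕ) (ε a b) : LAB m r 0 q ε (!a) b = LAB m r 0 q ε a b := by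
  simp [LAB, fn_zero]
lemma LAB_bot2 (r p : ℕ) (ε a b) : LAB m r p 0 ε a (!b) = LAB m r p 0 ε a b := by
  simp [LAB, fn_zero]
lemma LAB_bot0 (p q : ℕ) (ε a b) : LAB m 0 p q (!ε) a b = LAB m 0 p q ε a b := by
  simp [LAB, fn_zero]
lemma cc_LAB (r p q : ℕ) (ε a b) : cc (LAB m r p q ε a b) = if r = 0 ∧ p = 0 ∧ q = 0 then 1 else 0 := by
  simp only [LAB, cc_mul, cc_fn]
  split_ifs <;> simp_all

variable {ν lab}

lemma half1 (h1 : ∀ s t, lab (ν s) t = fl 2 (lab s t)) {z : ℕ → Ch S} {N : ℕ} (h0 : bd (z 0) = single [] 1)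
    (hs : ∀ i < N, bd (z (i+1)) = z i + mapL ν (z i)) (i : ℤ) (hi : i + m ≤ N) (y : Ch S)
    (r q : ℕ) (ε a b) :
    ∑ p ∈ Finset.range (m+1), GG lab (bd (zz z (i + p))) y (LAB m r p q ε a b)
    + ∑ p ∈ Finset.range (m+1), GG lab (zz z (i + p)) y
        (LAB m r (p+1) q ε a b + LAB m r (p+1) q ε (!a) b)
    = ∑ p ∈ Finset.range (m+1), GG lab (zz z (i - 1 + p)) y
        (LAB m r p q ε (!a) b + LAB m r p q (!ε) (!a) b) := by
  have e1 : ∀ p ∈ Finset.range (m+1), GG lab (bd (zz z (i + p))) y (LAB m r p q ε a b)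
      = GG lab (zz z (i - 1 + p)) y (LAB m r p q ε a b + LAB m r p q (!ε) (!a) b) := by
    intro p hp
    have hp' := Finset.mem_range.1 hp
    rw [bd_zz h0 hs _ (by omega)]
    have : GG lab (if i + p = 0 then single [] 1 else 0) y = 0 := by split_ifs <;> simp
    rw [map_add, LinearMap.add_apply, this, add_zero, map_add]
    have e : i + p - 1 = i - 1 + p := by ring
    have := GG_rename lab ν (fl 2) h1 (zz z (i - 1 + p)) y (LAB m r p q (!ε) (!a) b)
    rw [LAB_fl2, Bool.not_not, Bool.not_not] at this
    rw [e, map_add, LinearMap.add_apply, LinearMap.add_apply, this]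
  have e2 := sum_shift m (fun p => GG lab (zz z (i - 1 + p)) y
        (LAB m r p q ε a b + LAB m r p q ε (!a) b)) (by simp only [LAB_bot1, mv_add_self, map_zero])
        (by simp only [LAB_top1, add_zero, map_zero])
  have e3 : ∀ p : ℕ, i - 1 + ((p + 1 : ℕ) : ℤ) = i + p := by intro p; push_cast; ring
  simp only [e3] at e2
  rw [Finset.sum_congr rfl e1, e2, ← Finset.sum_add_distrib]
  refine Finset.sum_congr rfl fun p _ => ?_
  rw [← map_add]
  congr 1
  linear_combination (LAB m r p q ε a b) * mv_two (Λ := Lab (Fin 3) m)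

lemma half2 (h1 : ∀ s t, lab (ν s) t = fl 2 (lab s t)) (hT : ∀ s t, lab t s = sw (lab s t))
    {z : ℕ → Ch S} {N : ℕ} (h0 : bd (z 0) = single [] 1)
    (hs : ∀ i < N, bd (z (i+1)) = z i + mapL ν (z i)) (i : ℤ) (hi : i + m ≤ N) (y : Ch S)
    (r p : ℕ) (ε a b) :
    ∑ q ∈ Finset.range (m+1), GG lab y (bd (zz z (i + q))) (LAB m r p q ε a b)
    + ∑ q ∈ Finset.range (m+1), GG lab y (zz z (i + q))
        (LAB m r p (q+1) ε a b + LAB m r p (q+1) ε a (!b))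
    = ∑ q ∈ Finset.range (m+1), GG lab y (zz z (i - 1 + q))
        (LAB m r p q ε a (!b) + LAB m r p q (!ε) a (!b)) := by
  have := half1 h1 h0 hs i hi y r p ε b a
  have key : ∀ x P, GG lab x y P = GG lab y x (rename sw P) := fun x P => (GG_swap lab sw hT x y P).symm
  simp only [key, map_add, LAB_sw] at this
  simpa only [map_add] using this
end stage2
end TRP

namespace TRP
open Finsupp MvPolynomial

section stage2b
variable {m : ℕ} {S : Type*} [Preorder S] {ν : S → S} {lab : S → S → Lab (Fin 3) m}

noncomputable def tt (lab : S → S → Lab (Fin 3) m) (z : ℕ → Ch S) (r : ℕ) (a b : Bool) (i j : ℤ) : ZMod 2 :=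
  ∑ p ∈ Finset.range (m+1), ∑ q ∈ Finset.range (m+1), GG lab (zz z (i+p)) (zz z (j+q))
    (LAB m r p q true a b + LAB m r p q false a b)

lemma tt_zero (z : ℕ → Ch S) (a b i j) : tt lab z 0 a b i j = 0 := by
  unfold tt
  refine Finset.sum_eq_zero fun p _ => Finset.sum_eq_zero fun q _ => ?_
  have := LAB_bot0 (m := m) p q true a b
  rw [Bool.not_true] at this
  rw [this, mv_add_self, map_zero]

lemma tt_succ (h1 : ∀ s t, lab (ν s) t = fl 2 (lab s t)) (hT : ∀ s t, lab t s = sw (lab s t))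
    (hc : ∀ s s' t t', s ≤ s' → t ≤ t' → lab s t ≠ (lab s' t').neg)
    {z : ℕ → Ch S} {N : ℕ} (hz : ∀ i, z i ∈ Sup srt) (h0 : bd (z 0) = single [] 1)
    (hs : ∀ i < N, bd (z (i+1)) = z i + mapL ν (z i)) (r : ℕ) (a b : Bool) (i j : ℤ)
    (hi : i + m ≤ N) (hj : j + m ≤ N) :
    tt lab z (r+1) a b i j = tt lab z r (!a) b (i-1) j + tt lab z r a (!b) i (j-1)
      + if r = 0 ∧ i = 0 ∧ j = 0 then 1 else 0 := by
  have step : ∀ p ∈ Finset.range (m+1), ∀ q ∈ Finset.range (m+1),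
      GG lab (zz z (i+p)) (zz z (j+q)) (LAB m (r+1) p q true a b + LAB m (r+1) p q false a b)
      = (GG lab (bd (zz z (i+p))) (zz z (j+q)) (LAB m r p q true a b)
        + GG lab (zz z (i+p)) (zz z (j+q)) (LAB m r (p+1) q true a b + LAB m r (p+1) q true (!a) b))
      + (GG lab (zz z (i+p)) (bd (zz z (j+q))) (LAB m r p q true a b)
        + GG lab (zz z (i+p)) (zz z (j+q)) (LAB m r p (q+1) true a b + LAB m r p (q+1) true a (!b)))
      + (if p = 0 then if q = 0 then (if r = 0 ∧ i = 0 ∧ j = 0 then 1 else 0) else 0 else 0) := by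
    intro p hp q hq
    have hp' := Finset.mem_range.1 hp
    have hq' := Finset.mem_range.1 hq
    have e := GG_II lab hc (zz_mem hz (i+p)) (zz_mem hz (j+q)) _ _ (LAB_e (m := m) r p q true a b)
    rw [Bool.not_true] at e
    rw [e, map_add, map_add, GG_bd, aug_bd_zz h0 hs _ (by omega), aug_bd_zz h0 hs _ (by omega), cc_LAB]
    have : ((if i + (p:ℤ) = 0 then (1 : ZMod 2) else 0) * if j + (q:ℤ) = 0 then (1 : ZMod 2) else 0) *
        (if r = 0 ∧ p = 0 ∧ q = 0 then 1 else 0) =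
        (if p = 0 then if q = 0 then (if r = 0 ∧ i = 0 ∧ j = 0 then 1 else 0) else 0 else 0) := by
      by_cases hp0 : p = 0
      · by_cases hq0 : q = 0
        · subst hp0; subst hq0
          by_cases hr : r = 0 <;> by_cases hi0 : i = 0 <;> by_cases hj0 : j = 0 <;> simp [hr, hi0, hj0]
        · simp [hp0, hq0]
      · simp [hp0]
    rw [this]
    ring
  unfold tt
  rw [Finset.sum_congr rfl (fun p hp => Finset.sum_congr rfl (step p hp))]
  simp only [Finset.sum_add_distrib]
  rw [← Finset.sum_add_distrib, ← Finset.sum_add_distrib (f := fun p : ℕ => ∑ q ∈ Finset.range (m+1),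
    GG lab (zz z (i+p)) (bd (zz z (j+q))) (LAB m r p q true a b))]
  congr 1
  · congr 1
    · rw [Finset.sum_add_distrib, Finset.sum_comm, Finset.sum_comm (f := fun p q : ℕ =>
        GG lab (zz z (i+p)) (zz z (j+q)) (LAB m r (p+1) q true a b + LAB m r (p+1) q true (!a) b)),
        ← Finset.sum_add_distrib, Finset.sum_comm]
      exact Finset.sum_congr rfl fun q hq => half1 h1 h0 hs i hi _ r q true a b
    · exact Finset.sum_congr rfl fun q hq => half2 h1 hT h0 hs j hj _ r q true a b
  · simp [Finset.sum_ite_eq']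

def ch (r : ℕ) (i : ℤ) : ZMod 2 := if 0 ≤ i then (r.choose i.toNat : ZMod 2) else 0

lemma ch_succ (r : ℕ) (i : ℤ) : ch (r+1) i = ch r (i-1) + ch r i := by
  unfold ch
  by_cases h : 0 ≤ i
  · lift i to ℕ using h
    cases i with
    | zero => simp
    | succ i =>
      have : (((i+1 : ℕ) : ℤ) - 1) = i := by push_cast; ring
      rw [this]
      rw [if_pos (by positivity), if_pos (by positivity), if_pos (by positivity)]
      simp [Nat.choose_succ_succ]
  · rw [if_neg h, if_neg h, if_neg (by omega)]; simp

lemma tt_eq (h1 : ∀ s t, lab (ν s) t = fl 2 (lab s t)) (hT : ∀ s t, lab t s = sw (lab s t))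
    (hc : ∀ s s' t t', s ≤ s' → t ≤ t' → lab s t ≠ (lab s' t').neg)
    {z : ℕ → Ch S} {N : ℕ} (hz : ∀ i, z i ∈ Sup srt) (h0 : bd (z 0) = single [] 1)
    (hs : ∀ i < N, bd (z (i+1)) = z i + mapL ν (z i)) (r : ℕ) (a b : Bool) (i j : ℤ)
    (hi : i + m ≤ N) (hj : j + m ≤ N) (hr : i + j = r) :
    tt lab z (r+1) a b i j = ch r i := by
  induction r generalizing a b i j with
  | zero =>
    rw [tt_succ h1 hT hc hz h0 hs _ _ _ _ _ hi hj, tt_zero, tt_zero]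
    unfold ch
    by_cases h : i = 0
    · have : j = 0 := by simp at hr; omega
      simp [h, this]
    · rcases lt_or_gt_of_ne h with h' | h'
      · simp [h]; omega
      · obtain ⟨n, hn⟩ : ∃ n, i.toNat = n + 1 := ⟨i.toNat - 1, by omega⟩
        simp [h, hn]
  | succ r ih =>
    rw [tt_succ h1 hT hc hz h0 hs _ _ _ _ _ hi hj, ih _ _ _ _ (by omega) hj (by push_cast at hr; omega),
      ih _ _ _ _ hi (by omega) (by push_cast at hr; omega), ch_succ]
    simp

lemma choose_odd (s i : ℕ) (hi : i < 2 ^ s) : (((2 ^ s - 1).choose i : ℕ) : ZMod 2) = 1 := by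
  induction i with
  | zero => simp
  | succ i ih =>
    have h := ih (by omega)
    have h2 : 2 ∣ (2 ^ s).choose (i+1) :=
      Nat.Prime.dvd_choose_pow Nat.prime_two (by omega) (by omega)
    obtain ⟨n, hn⟩ : ∃ n, 2 ^ s = n + 1 := ⟨2 ^ s - 1, by have := Nat.one_le_two_pow (n := s); omega⟩
    rw [hn, Nat.choose_succ_succ] at h2
    rw [hn] at h ⊢
    simp only [Nat.add_sub_cancel] at h ⊢
    have h3 := (ZMod.natCast_eq_zero_iff _ 2).2 h2
    push_cast at h3
    rw [h] at h3
    have h4 := CharTwo.add_self_eq_zero (1 : ZMod 2)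
    linear_combination h3 - h4

/-- quadratic forms that vanish -/
lemma quad_zero {M : Type*} [AddCommGroup M] [Module (ZMod 2) M] (T : M →ₗ[ZMod 2] M →ₗ[ZMod 2] ZMod 2)
    (gs : Set M) (hg : ∀ g ∈ gs, T g g = 0)
    (ha : ∀ x ∈ Submodule.span (ZMod 2) gs, ∀ y ∈ Submodule.span (ZMod 2) gs, T x y + T y x = 0)
    (x : M) (hx : x ∈ Submodule.span (ZMod 2) gs) : T x x = 0 := by
  induction hx using Submodule.span_induction with
  | mem x h => exact hg x h
  | zero => simp
  | add x y hx hy ihx ihy =>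
    have := ha x hx y hy
    simp only [map_add, LinearMap.add_apply, ihx, ihy]
    linear_combination this
  | smul c x _ ih => simp [ih]

noncomputable def TT (lab : S → S → Lab (Fin 3) m) (a : Bool) :
    (Fin (m+1) → Ch S) →ₗ[ZMod 2] (Fin (m+1) → Ch S) →ₗ[ZMod 2] ZMod 2 :=
  ∑ p : Fin (m+1), ∑ q : Fin (m+1),
    (((GG lab).compl₁₂ (bd ∘ₗ LinearMap.proj p) (LinearMap.proj q)).compr₂
      (LinearMap.applyₗ (LAB m m p q true a a)) +
    ((GG lab).compl₁₂ (LinearMap.proj p) (LinearMap.proj q)).compr₂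
      (LinearMap.applyₗ (LAB m m (p+1) q true a a + LAB m m (p+1) q true (!a) a)))

lemma TT_apply (a : Bool) (Z Z' : Fin (m+1) → Ch S) : TT lab a Z Z' =
    ∑ p : Fin (m+1), ∑ q : Fin (m+1), (GG lab (bd (Z p)) (Z' q) (LAB m m p q true a a)
      + GG lab (Z p) (Z' q) (LAB m m (p+1) q true a a + LAB m m (p+1) q true (!a) a)) := by
  simp [TT, LinearMap.sum_apply]

lemma TT_symm (hm : m ≠ 0) (hT : ∀ s t, lab t s = sw (lab s t))
    (hc : ∀ s s' t t', s ≤ s' → t ≤ t' → lab s t ≠ (lab s' t').neg) (a : Bool)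
    (Z Z' : Fin (m+1) → Ch S) (hZ : ∀ p, Z p ∈ Sup srt) (hZ' : ∀ p, Z' p ∈ Sup srt) :
    TT lab a Z Z' + TT lab a Z' Z = 0 := by
  have key : ∀ x y P, GG lab x y P = GG lab y x (rename sw P) := fun x y P => (GG_swap lab sw hT x y P).symm
  have e : TT lab a Z' Z = ∑ p : Fin (m+1), ∑ q : Fin (m+1), (GG lab (Z p) (bd (Z' q)) (LAB m m p q true a a)
      + GG lab (Z p) (Z' q) (LAB m m p (q+1) true a a + LAB m m p (q+1) true a (!a))) := by
    rw [TT_apply, Finset.sum_comm]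
    refine Finset.sum_congr rfl fun p _ => Finset.sum_congr rfl fun q _ => ?_
    rw [key, LAB_sw, key (Z' q), map_add, LAB_sw, LAB_sw]
  rw [e, TT_apply, ← Finset.sum_add_distrib]
  refine Finset.sum_eq_zero fun p _ => ?_
  rw [← Finset.sum_add_distrib]
  refine Finset.sum_eq_zero fun q _ => ?_
  have e := GG_II lab hc (hZ p) (hZ' q) _ _ (LAB_e (m := m) m p q true a a)
  rw [LAB_top0, LAB_top0, add_zero, map_zero, map_add, map_add, GG_bd, cc_LAB, if_neg (by simp [hm])] at e
  linear_combination -e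

lemma TT_gen (hm : 2 ≤ m) (hT : ∀ s t, lab t s = sw (lab s t))
    (hd : ∀ s t, s ≤ t → ∃ j, lab s t = (0, j, true)) (a : Bool) (p : Fin (m+1)) (l : List S) (hl : srt l) :
    TT lab a (Pi.single p (single l 1)) (Pi.single p (single l 1)) = 0 := by
  have kill : ∀ l', l'.Sublist l → ∀ P Q, P ∈ Ideal.span {P : Rg (Fin 3) m | ∃ j, P = X (0, j, false)} →
      G lab l' l (P * Q) = 0 := by
    intro l' hl' P Q hP
    induction hP using Submodule.span_induction generalizing Q with
    | mem x h =>
      obtain ⟨j, rfl⟩ := h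
      apply G_X
      intro u hu v hv
      have hcomp : ∀ u ∈ l, ∀ v ∈ l, u ≤ v ∨ v ≤ u := by
        intro u hu v hv
        have h2 : l.Pairwise (fun u v => u ≤ v ∨ v ≤ u) := hl.imp (fun h => Or.inr h)
        by_cases huv : u = v
        · subst huv; exact Or.inl le_rfl
        · haveI : Std.Symm (fun u v : S => u ≤ v ∨ v ≤ u) := ⟨fun _ _ h => h.symm⟩
          exact h2.forall hu hv huv
      rcases hcomp u (hl'.subset hu) v hv with h | h
      · obtain ⟨j', hj'⟩ := hd _ _ h
        rw [hj']; simp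
      · obtain ⟨j', hj'⟩ := hd _ _ h
        rw [hT v u, hj']; simp [sw]
    | zero => simp
    | add x y _ _ hx hy => simp [add_mul, hx, hy]
    | smul r x _ hx =>
      have : (r • x) * Q = x * (r * Q) := by simp only [smul_eq_mul]; ring
      rw [this, hx]
  have kill2 : ∀ l', l'.Sublist l → ∀ p q b c, G lab l' l (LAB m m p q true b c) = 0 := by
    intro l' hl' p q b c
    rw [LAB, mul_assoc]
    exact kill l' hl' _ _ (fn_neg_mem 0 m true (Or.inl hm))
  have kill3 : ∀ p q b c, GG lab (bdList l) (single l 1) (LAB m m p q true b c) = 0 := by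
    intro p q b c
    exact Sup_eq (P := fun l' => l'.Sublist l) ((LinearMap.applyₗ (LAB m m p q true b c)).comp
      ((GG lab).flip (single l 1))) 0 (fun l' hl' => by simpa using kill2 l' hl' p q b c)
      (bdList_mem l (fun l' h _ => h))
  rw [TT_apply]
  refine Finset.sum_eq_zero fun i _ => Finset.sum_eq_zero fun j _ => ?_
  by_cases hi : i = p
  · by_cases hj : j = p
    · subst hi; subst hj
      simp [kill3, kill2]
    · simp [hj]
  · simp [hi]

theorem stage2 (s k : ℕ) (hm : m = 2 ^ s) (hk : m = 2 * k) (hk0 : 1 ≤ k)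
    (h1 : ∀ s t, lab (ν s) t = fl 2 (lab s t)) (hT : ∀ s t, lab t s = sw (lab s t))
    (hc : ∀ s s' t t', s ≤ s' → t ≤ t' → lab s t ≠ (lab s' t').neg)
    (hd : ∀ s t, s ≤ t → ∃ j, lab s t = (0, j, true))
    {z : ℕ → Ch S} {N : ℕ} (hN : m + k ≤ N) (hz : ∀ i, z i ∈ Sup srt) (h0 : bd (z 0) = single [] 1)
    (hs : ∀ i < N, bd (z (i+1)) = z i + mapL ν (z i)) : False := by
  have e1 := tt_eq h1 hT hc hz h0 hs (m-1) (!true) true (k-1) k (by omega) (by omega) (by omega)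
  rw [show m - 1 + 1 = m by omega] at e1
  have e2 : ch (m-1) (k-1) = 1 := by
    unfold ch
    rw [if_pos (by omega), hm]
    exact choose_odd s _ (by omega)
  set Z : Fin (m+1) → Ch S := fun p => zz z (k + (p : ℕ)) with hZdef
  let gs : Set (Fin (m+1) → Ch S) := {g | ∃ (p : Fin (m+1)) (l : List S), srt l ∧ g = Pi.single p (single l (1 : ZMod 2))}
  have hgs : ∀ x ∈ Submodule.span (ZMod 2) gs, ∀ p, x p ∈ Sup srt := by
    intro x hx p
    have : Submodule.span (ZMod 2) gs ≤ (Sup srt).comap (LinearMap.proj p) := by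
      apply Submodule.span_le.2
      rintro _ ⟨q, l, hl, rfl⟩
      by_cases h : p = q
      · subst h; simpa using single_mem_Sup 1 hl
      · simp [h]
    exact this hx
  have e3 : TT lab true Z Z = 0 := by
    refine quad_zero (TT lab true) gs ?_ ?_ Z ?_
    · rintro _ ⟨p, l, hl, rfl⟩
      exact TT_gen (by omega) hT hd true p l hl
    · intro x hx y hy
      exact TT_symm (by omega) hT hc true x y (hgs x hx) (hgs y hy)
    · rw [← Finset.univ_sum_single Z]
      refine Submodule.sum_mem _ fun p _ => ?_
      have : Sup srt ≤ (Submodule.span (ZMod 2) gs).comap (LinearMap.single (ZMod 2) (fun _ : Fin (m+1) => Ch S) p) :=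
        Sup_le _ (fun l hl => Submodule.subset_span ⟨p, l, hl, rfl⟩)
      exact this (zz_mem hz _)
  have e4 : TT lab true Z Z = tt lab z m (!true) true (k-1) k := by
    rw [TT_apply, tt, Finset.sum_comm, Finset.sum_comm (s := Finset.range (m+1)), Finset.sum_range]
    refine Finset.sum_congr rfl fun q _ => ?_
    have := half1 h1 h0 hs k (by omega) (zz z (k + (q : ℕ))) m q true true true
    rw [Bool.not_true] at this ⊢
    rw [← this, ← Finset.sum_add_distrib, Finset.sum_range]
  rw [e4, e1, e2] at e3
  exact one_ne_zero e3

end stage2b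
end TRP

namespace TRP
open Finsupp MvPolynomial

section cut
variable {S Λ : Type*}

noncomputable def C : List (S ⊕ Λ) → (Rp Λ →ₗ[ZMod 2] Ch S)
  | [] => LinearMap.toSpanSingleton (ZMod 2) _ (single [] 1) ∘ₗ cc
  | Sum.inl s :: l => consL s ∘ₗ C l
  | Sum.inr a :: l => C l ∘ₗ DD a

noncomputable def CC : Ch (S ⊕ Λ) →ₗ[ZMod 2] (Rp Λ →ₗ[ZMod 2] Ch S) :=
  Finsupp.linearCombination (ZMod 2) C

@[simp] lemma CC_single (l : List (S ⊕ Λ)) : CC (single l 1) = C l := by simp [CC]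

lemma CC_inl (s : S) (x : Ch (S ⊕ Λ)) (P) : CC (consL (Sum.inl s) x) P = consL s (CC x P) := by
  have : CC ∘ₗ consL (Sum.inl s : S ⊕ Λ) = (LinearMap.llcomp (ZMod 2) _ _ _ (consL s)) ∘ₗ CC := by
    apply ch_ind
    intro l
    simp [C]
    rfl
  exact congrArg (fun f => f x P) this

lemma CC_inr (a : Λ) (x : Ch (S ⊕ Λ)) (P) : CC (consL (Sum.inr a) x) P = CC x (DD a P) := by
  have : CC ∘ₗ consL (Sum.inr a : S ⊕ Λ) = (LinearMap.lcomp (ZMod 2) _ (DD a)) ∘ₗ CC := by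
    apply ch_ind
    intro l
    simp [C]
    rfl
  exact congrArg (fun f => f x P) this

lemma C_bd [Fintype Λ] (l : List (S ⊕ Λ)) (P) :
    bd (C l P) = CC (bdList l) P + C l (ee * P) := by
  induction l generalizing P with
  | nil =>
    simp only [C, bdList, LinearMap.comp_apply, cc_mul, cc_ee, zero_mul, map_zero, LinearMap.zero_apply,
      LinearMap.toSpanSingleton_apply, map_smul, bd_single, smul_zero, add_zero]
  | cons w l ih =>
    rcases w with s | a
    · simp only [C, bdList, map_add, LinearMap.add_apply, LinearMap.comp_apply, bd_consL, CC_single, CC_inl, ih]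
      abel
    · simp only [C, bdList, map_add, LinearMap.add_apply, LinearMap.comp_apply, CC_single, CC_inr, ih, DD_ee_mul]
      have := ch_add_self (C l P)
      rw [show C l P + CC (bdList l) (DD a P) + (C l P + C l (ee * DD a P)) = (C l P + C l P)
        + (CC (bdList l) (DD a P) + C l (ee * DD a P)) by abel, this, zero_add]

lemma CC_bd [Fintype Λ] (x : Ch (S ⊕ Λ)) (P) :
    bd (CC x P) = CC (bd x) P + CC x (ee * P) := by
  have : (bd ∘ₗ LinearMap.applyₗ P) ∘ₗ (CC : Ch (S ⊕ Λ) →ₗ[ZMod 2] _) =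
      LinearMap.applyₗ P ∘ₗ CC ∘ₗ bd + LinearMap.applyₗ (ee * P) ∘ₗ CC := by
    apply ch_ind
    intro l
    simpa using C_bd l P
  simpa using congrArg (fun f => f x) this

lemma C_map (ν : S → S) (φ : Λ ≃ Λ) (l : List (S ⊕ Λ)) (P) :
    C (l.map (Sum.map ν φ)) (rename φ P) = mapL ν (C l P) := by
  induction l generalizing P with
  | nil => simp [C, cc_rename]
  | cons w l ih =>
    rcases w with s | a
    · simp [C, ih, mapL_consL]
    · simp [C, DD_rename, ih]

lemma CC_map (ν : S → S) (φ : Λ ≃ Λ) (x : Ch (S ⊕ Λ)) (P) :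
    CC (mapL (Sum.map ν φ) x) (rename φ P) = mapL ν (CC x P) := by
  have : LinearMap.applyₗ (rename φ P) ∘ₗ CC ∘ₗ mapL (Sum.map ν φ) =
      mapL ν ∘ₗ LinearMap.applyₗ P ∘ₗ (CC : Ch (S ⊕ Λ) →ₗ[ZMod 2] _) := by
    apply ch_ind
    intro l
    simpa using C_map ν φ l P
  simpa using congrArg (fun f => f x) this

lemma C_X (b : Λ) (l : List (S ⊕ Λ)) (h : Sum.inr b ∉ l) (Q) : C l (X b * Q) = 0 := by
  induction l generalizing Q with
  | nil => simp [C, cc_mul]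
  | cons w l ih =>
    have ih' := ih (fun h' => h (by simp [h']))
    rcases w with s | a
    · simp [C, ih']
    · have : b ≠ a := fun e => h (by simp [e])
      simp [C, DD_mul, DD_X_ne this, ih']

lemma C_XX (b : Λ) (l : List (S ⊕ Λ)) (Q) : C l (X b * X b * Q) = 0 := by
  induction l generalizing Q with
  | nil => simp [C, cc_mul]
  | cons w l ih =>
    rcases w with s | a
    · simp [C, ih]
    · have h3 : DD a (X b * X b * Q) = X b * X b * DD a Q := by
        rw [DD_mul, DD_mul, mv_add_self]; simp
      simp [C, h3, ih]

lemma C_len (l : List (S ⊕ Λ)) (P : Rp Λ) (p : ℕ) (hP : P.IsHomogeneous p) :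
    C l P ∈ Sup (fun l' => l'.length + p = l.length) := by
  induction l generalizing P p with
  | nil =>
    by_cases hp : p = 0
    · subst hp
      exact Submodule.smul_mem _ _ (single_mem_Sup _ (by simp))
    · have : cc P = 0 := by
        refine hP.coeff_eq_zero ?_
        simpa using fun h => hp h.symm
      simp [C, this]
  | cons w l ih =>
    rcases w with s | a
    · have := ih P p hP
      refine Sup_map (consL s) (fun l' hl' => ?_) this
      rw [consL_single]
      exact single_mem_Sup _ (by simp; omega)
    · cases p with
      | zero =>
        have : DD a P = 0 := by
          rw [(totalDegree_eq_zero_iff_eq_C.1 (Nat.le_zero.1 hP.totalDegree_le) : P = _)]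
          simp [DD]
        simp [C, this]
      | succ p =>
        have := ih (DD a P) p (by simpa [DD] using hP.pderiv (i := a))
        exact Sup_mono (fun l' hl' => by simp; omega) this

end cut

lemma fan_hom {Λ : Type*} (x : ℕ → Bool → Rp Λ) (hx : ∀ j ε, (x j ε).IsHomogeneous 1) (n p : ℕ) (ε) :
    (fan x n p ε).IsHomogeneous p := by
  induction n generalizing p ε with
  | zero => cases p <;> simp [fan, isHomogeneous_one, isHomogeneous_zero]
  | succ n ih =>
    cases p with
    | zero => simp [fan, isHomogeneous_one]
    | succ p =>
      simp only [fan]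
      refine (ih _ _).add ?_
      have := (hx n ε).mul (ih p (!ε))
      rwa [add_comm 1 p] at this

lemma fn_hom {K : Type*} {M : ℕ} (k : K) (p : ℕ) (ε) : (fn M k p ε).IsHomogeneous p := by
  apply fan_hom
  intro j ε
  unfold xx
  split_ifs
  · exact isHomogeneous_X _ _
  · exact isHomogeneous_zero _ _ _

section cut2
variable {S : Type*} [Preorder S] {M : ℕ}

def okR : S ⊕ Lab Unit M → S ⊕ Lab Unit M → Prop
  | Sum.inl s, Sum.inl t => t ≤ s
  | Sum.inr a, Sum.inr b => b ≠ a.neg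
  | _, _ => True

def ok (l : List (S ⊕ Lab Unit M)) : Prop := l.Pairwise okR

lemma C_srt (l : List (S ⊕ Lab Unit M)) (hl : ok l) (P) :
    C l P ∈ Sup (fun l' => srt l' ∧ ∀ x ∈ l', Sum.inl x ∈ l) := by
  induction l generalizing P with
  | nil => exact Submodule.smul_mem _ _ (single_mem_Sup _ (by simp [srt]))
  | cons w l ih =>
    have hl' := List.pairwise_cons.1 hl
    rcases w with s | a
    · refine Sup_map (consL s) (fun l' h => ?_) (ih hl'.2 P)
      rw [consL_single]
      refine single_mem_Sup _ ⟨List.pairwise_cons.2 ⟨fun x hx => ?_, h.1⟩, ?_⟩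
      · exact hl'.1 _ (h.2 x hx)
      · intro x hx
        rcases List.mem_cons.1 hx with rfl | hx
        · simp
        · simp [h.2 x hx]
    · exact Sup_mono (fun l' h => ⟨h.1, fun x hx => by simp [h.2 x hx]⟩) (ih hl'.2 (DD a P))

lemma C_XN (b : Lab Unit M) (l : List (S ⊕ Lab Unit M)) (hl : ok l) (Q) : C l (X b * X b.neg * Q) = 0 := by
  induction l generalizing Q with
  | nil => simp [C, cc_mul]
  | cons w l ih =>
    have hl' := List.pairwise_cons.1 hl
    have ih' := ih hl'.2
    rcases w with s | a
    · simp [C, ih']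
    · have k1 : ∀ Q, C l (X a.neg * Q) = 0 := fun Q => by
        apply C_X
        intro h
        exact hl'.1 _ h rfl
      by_cases hb : a = b
      · subst hb
        have h3 : DD a (X a * X a.neg * Q) = X a * X a.neg * DD a Q + X a.neg * Q := by
          rw [DD_mul, DD_mul, DD_X_self, DD_X_ne (Lab.neg_ne _)]; ring
        simp [C, h3, ih', k1]
      · by_cases hb' : a = b.neg
        · have hb2 : b = a.neg := by rw [hb', Lab.neg_neg]
          have h3 : DD a (X b * X b.neg * Q) = X b * X b.neg * DD a Q + X a.neg * Q := by
            rw [← hb', DD_mul, DD_mul, DD_X_self, DD_X_ne (fun h => hb h.symm), ← hb2]; ring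
          simp [C, h3, ih', k1]
        · have h3 : DD a (X b * X b.neg * Q) = X b * X b.neg * DD a Q := by
            rw [DD_mul, DD_mul, DD_X_ne (fun h => hb h.symm), DD_X_ne (fun h => hb' h.symm)]; ring
          simp [C, h3, ih']

lemma C_II (l : List (S ⊕ Lab Unit M)) (hl : ok l) (P) (hP : P ∈ (II : Ideal (Rg Unit M))) :
    C l P = 0 := by
  suffices ∀ Q, C l (P * Q) = 0 by simpa using this 1
  unfold II Ideal.span at hP
  induction hP using Submodule.span_induction with
  | mem x h =>
    obtain ⟨a, rfl | rfl⟩ := h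
    · exact C_XX a l
    · exact C_XN a l hl
  | zero => simp
  | add x y _ _ hx hy => intro Q; simp [add_mul, hx, hy]
  | smul r x _ hx =>
    intro Q
    have : (r • x) * Q = x * (r * Q) := by simp only [smul_eq_mul]; ring
    rw [this, hx]

lemma CC_II {x : Ch (S ⊕ Lab Unit M)} (hx : x ∈ Sup ok) (P Q)
    (hP : Ideal.Quotient.mk (II : Ideal (Rg Unit M)) P = Ideal.Quotient.mk II Q) :
    CC x P = CC x Q := by
  rw [Ideal.Quotient.mk_eq_mk_iff_sub_mem] at hP
  rw [← sub_eq_zero, ← map_sub]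
  exact Sup_eq ((LinearMap.applyₗ (P - Q)).comp CC) 0
      (fun s hs => by simpa using C_II s hs _ hP) hx

def negE : Lab Unit M ≃ Lab Unit M := ⟨Lab.neg, Lab.neg, Lab.neg_neg, Lab.neg_neg⟩

lemma bd_mapL_pow (ν : S → S) (k : ℕ) (x : Ch S) : bd (((mapL ν) ^ k) x) = ((mapL ν) ^ k) (bd x) := by
  induction k generalizing x with
  | zero => simp
  | succ k ih => rw [pow_succ, Module.End.mul_apply, Module.End.mul_apply, ih, bd_mapL]

lemma mapL_pow_nil (ν : S → S) (k : ℕ) : ((mapL ν) ^ k) (single ([] : List S) (1 : ZMod 2)) = single [] 1 := by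
  induction k with
  | zero => simp
  | succ k ih => rw [pow_succ, Module.End.mul_apply, mapL_single, List.map_nil, ih]

noncomputable def zc (ν : S → S) (z : ℕ → Ch (S ⊕ Lab Unit M)) (i : ℤ) : Ch S :=
  ∑ p ∈ Finset.range (M+1), ((mapL ν) ^ (M - p)) (CC (zz z (i + p)) (fn M () p true))

lemma sum_shift' {A : Type*} [AddCommMonoid A] (m : ℕ) (f : ℕ → A) (h0 : f 0 = 0) (hm : f (m+1) = 0) :
    ∑ p ∈ Finset.range (m+1), f (p+1) = ∑ p ∈ Finset.range (m+1), f p := by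
  rw [Finset.sum_range_succ, hm, add_zero, Finset.sum_range_succ' f, h0, add_zero]

lemma bd_zc (ν : S → S) {z : ℕ → Ch (S ⊕ Lab Unit M)} {n : ℕ} (hz : ∀ i, z i ∈ Sup ok)
    (h0 : bd (z 0) = single [] 1)
    (hs : ∀ i < n, bd (z (i+1)) = z i + mapL (Sum.map ν negE) (z i)) (i : ℤ) (hi0 : 0 ≤ i) (hi : i + M ≤ n) :
    bd (zc ν z i) = zc ν z (i-1) + mapL ν (zc ν z (i-1)) + if i = 0 then single [] 1 else 0 := by
  have e1 : ∀ p ∈ Finset.range (M+1), bd (((mapL ν) ^ (M - p)) (CC (zz z (i + p)) (fn M () p true))) =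
     (((mapL ν) ^ (M - p)) (CC (zz z (i - 1 + p)) (fn M () p true)) + 
      ((mapL ν) ^ (M + 1 - p)) (CC (zz z (i - 1 + p)) (fn M () p false)))
      + ((mapL ν) ^ (M - p)) (CC (zz z (i + p)) (fn M () (p+1) true + fn M () (p+1) false))
      + if p = 0 then (if i = 0 then single [] 1 else 0) else 0 := by
    intro p hp
    have hp' := Finset.mem_range.1 hp
    have e := CC_II (zz_mem hz (i+p)) _ _ (ek_fn (m := M) () p true)
    rw [bd_mapL_pow, CC_bd, ee_eq, Fintype.sum_unique]
    change ((mapL ν) ^ (M - p)) (CC (bd (zz z (i + p))) (fn M () p true) +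
      CC (zz z (i + p)) (ek M () * fn M () p true)) = _
    rw [e, bd_zz (ν := Sum.map ν negE) h0 hs _ (by omega)]
    have e' : i + p - 1 = i - 1 + p := by ring
    rw [e']
    have e2 : CC (mapL (Sum.map ν negE) (zz z (i - 1 + p))) (fn M () p true)
        = mapL ν (CC (zz z (i - 1 + p)) (fn M () p false)) := by
      rw [← CC_map ν negE, fn_rename_not negE () ()]
      · rfl
      · intro j ε; rfl
    have e3 : CC (if i + (p:ℤ) = 0 then single [] 1 else 0) (fn M () p true)
        = if p = 0 then (if i = 0 then single ([] : List S) (1 : ZMod 2) else 0) else 0 := by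
      by_cases hp0 : p = 0
      · subst hp0
        by_cases h : i = 0
        · simp [h, C, cc_fn]
        · simp [h]
      · have : i + (p:ℤ) ≠ 0 := by omega
        simp [this, hp0]
    have e4 : ∀ x, ((mapL ν) ^ (M + 1 - p)) x = ((mapL ν) ^ (M - p)) (mapL ν x) := by
      intro x
      rw [show M + 1 - p = (M - p) + 1 by omega, pow_succ, Module.End.mul_apply]
    have e5 : ((mapL ν) ^ (M - p)) (if p = 0 then (if i = 0 then single ([] : List S) (1 : ZMod 2) else 0) else 0)
      = if p = 0 then (if i = 0 then single ([] : List S) (1 : ZMod 2) else 0) else 0 := by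
      split_ifs <;> simp [mapL_pow_nil]
    rw [e4, map_add CC, map_add CC, LinearMap.add_apply, LinearMap.add_apply, e2, e3, map_add ((mapL ν) ^ (M - p)),
      map_add ((mapL ν) ^ (M - p)), map_add ((mapL ν) ^ (M - p)), e5, Bool.not_true]
    abel
  have e2 := sum_shift' M (fun p => ((mapL ν) ^ (M + 1 - p)) (CC (zz z (i - 1 + p))
      (fn M () p true + fn M () p false))) (by simp only [fn_zero, mv_add_self, map_zero])
      (by simp only [fn_gt _ _ _ (Nat.lt_succ_self M), add_zero, map_zero])
  have e3 : ∀ p : ℕ, i - 1 + ((p + 1 : ℕ) : ℤ) = i + p := by intro p; push_cast; ring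
  simp only [e3, Nat.add_sub_add_right] at e2
  unfold zc
  rw [map_sum, Finset.sum_congr rfl e1, Finset.sum_add_distrib, Finset.sum_add_distrib, e2, map_sum,
    ← Finset.sum_add_distrib, ← Finset.sum_add_distrib (g := fun p => mapL ν (((mapL ν) ^ (M - p))
      (CC (zz z (i - 1 + p)) (fn M () p true))))]
  congr 1
  · refine Finset.sum_congr rfl fun p hp => ?_
    have hp' := Finset.mem_range.1 hp
    have e4 : ∀ x, ((mapL ν) ^ (M + 1 - p)) x = mapL ν (((mapL ν) ^ (M - p)) x) := by
      intro x
      rw [show M + 1 - p = (M - p) + 1 by omega, pow_succ', Module.End.mul_apply]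
    simp only [e4, map_add]
    have := ch_add_self (mapL ν (((mapL ν) ^ (M - p)) (CC (zz z (i - 1 + p)) (fn M () p false))))
    rw [← sub_eq_zero, ← this]
    abel
  · simp [Finset.sum_ite_eq']

lemma zc_srt (ν : S → S) (hν : ∀ a b, a ≤ b → ν a ≤ ν b) {z : ℕ → Ch (S ⊕ Lab Unit M)}
    (hz : ∀ i, z i ∈ Sup ok) (i : ℤ) : zc ν z i ∈ Sup srt := by
  have hm : ∀ x ∈ Sup (srt : List S → Prop), mapL ν x ∈ Sup srt := by
    intro x hx
    refine Sup_map _ (fun l hl => ?_) hx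
    rw [mapL_single]
    refine single_mem_Sup _ ?_
    exact List.pairwise_map.2 (hl.imp (fun h => hν _ _ h))
  have hm' : ∀ k, ∀ x ∈ Sup (srt : List S → Prop), ((mapL ν) ^ k) x ∈ Sup srt := by
    intro k
    induction k with
    | zero => simp
    | succ k ih => intro x hx; rw [pow_succ, Module.End.mul_apply]; exact ih _ (hm x hx)
  refine Submodule.sum_mem _ fun p _ => hm' _ _ ?_
  refine Sup_map ((LinearMap.applyₗ (fn M () p true)).comp CC) (fun l hl => ?_) (zz_mem hz (i+p))
  simpa using Sup_mono (fun l' h => h.1) (C_srt l hl (fn M () p true))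

lemma zc_neg (ν : S → S) {z : ℕ → Ch (S ⊕ Lab Unit M)}
    (hz : ∀ i, z i ∈ Sup (fun l => l.length = i + 1)) :
    zc ν z (-1) + mapL ν (zc ν z (-1)) = 0 := by
  have h : zc ν z (-1) ∈ Submodule.span (ZMod 2) {single ([] : List S) (1 : ZMod 2)} := by
    refine Submodule.sum_mem _ fun p _ => ?_
    have h1 : CC (zz z (-1 + p)) (fn M () p true) ∈ Submodule.span (ZMod 2) {single ([] : List S) (1 : ZMod 2)} := by
      have hz' : zz z (-1 + p) ∈ Sup (fun l => l.length = p) := by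
        unfold zz; split_ifs with h
        · have := hz (-1 + (p:ℤ)).toNat
          rwa [show (-1 + (p:ℤ)).toNat + 1 = p by omega] at this
        · exact Submodule.zero_mem _
      have h2 : CC (zz z (-1 + p)) (fn M () p true) ∈ Sup (fun l => l = []) := by
        refine Sup_map ((LinearMap.applyₗ (fn M () p true)).comp CC) (fun l hl => ?_) hz'
        have := C_len l _ p (fn_hom (M := M) () p true)
        simpa using Sup_mono (fun l' h => List.length_eq_zero_iff.1 (by omega)) this
      exact Sup_le _ (fun l hl => by subst hl; exact Submodule.subset_span rfl) h2
    obtain ⟨c, hc⟩ := Submodule.mem_span_singleton.1 h1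
    rw [← hc, map_smul, mapL_pow_nil]
    exact Submodule.smul_mem _ _ (Submodule.subset_span rfl)
  obtain ⟨c, hc⟩ := Submodule.mem_span_singleton.1 h
  rw [← hc, map_smul, mapL_single, List.map_nil]
  exact ch_add_self _

/-- Stage 1: cutting a system down. -/
theorem stage1 (ν : S → S) (hν : ∀ a b, a ≤ b → ν a ≤ ν b) {z : ℕ → Ch (S ⊕ Lab Unit M)} {n N : ℕ}
    (hz : ∀ i, z i ∈ Sup ok) (hz' : ∀ i, z i ∈ Sup (fun l => l.length = i + 1))
    (h0 : bd (z 0) = single [] 1)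
    (hs : ∀ i < n, bd (z (i+1)) = z i + mapL (Sum.map ν negE) (z i)) (hN : N + M ≤ n) :
    ∃ w : ℕ → Ch S, (∀ i, w i ∈ Sup srt) ∧ bd (w 0) = single [] 1 ∧
      ∀ i < N, bd (w (i+1)) = w i + mapL ν (w i) := by
  refine ⟨fun i => zc ν z i, fun i => zc_srt ν hν hz i, ?_, ?_⟩
  · have := bd_zc ν hz h0 hs 0 le_rfl (by omega)
    simpa [zc_neg ν hz'] using this
  · intro i hi
    have := bd_zc ν hz h0 hs ((i+1 : ℕ) : ℤ) (by positivity) (by omega)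
    rw [if_neg (by positivity), add_zero, show ((i+1 : ℕ) : ℤ) - 1 = i by push_cast; ring] at this
    exact this

end cut2
end TRP

namespace TRP
open Finsupp

lemma Sup_and {V : Type*} {P Q : List V → Prop} {x : Ch V} (h1 : x ∈ Sup P) (h2 : x ∈ Sup Q) :
    x ∈ Sup (fun l => P l ∧ Q l) := by
  unfold Sup at *
  rw [Finsupp.mem_supported] at *
  exact fun l hl => ⟨h1 hl, h2 hl⟩

section sd
variable {V : Type*} [AddCommGroup V] [Module ℝ V]

noncomputable def bary (l : List V) : V := (l.length : ℝ)⁻¹ • l.sum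

noncomputable def sdk : ℕ → Ch V →ₗ[ZMod 2] Ch V
  | 0 => LinearMap.id
  | k + 1 => Finsupp.linearCombination (ZMod 2) (fun l => consL (bary l) (sdk k (bdList l)))

lemma sdk_single (k : ℕ) (l : List V) : sdk (k+1) (single l 1) = consL (bary l) (sdk k (bdList l)) := by
  simp [sdk]

lemma bdList_len (l : List V) (k : ℕ) (hl : l.length = k + 1) :
    bdList l ∈ Sup (fun l' => l'.length = k) :=
  bdList_mem l (fun l' _ h => by omega)

lemma bd_sdk (k : ℕ) {x : Ch V} (hx : x ∈ Sup (fun l => l.length = k + 1)) :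
    bd (sdk (k+1) x) = sdk k (bd x) := by
  induction k generalizing x with
  | zero =>
    have key : ∀ l : List V, l.length = 0 + 1 →
        (bd ∘ₗ sdk (0+1)) (single l 1) = (sdk 0 ∘ₗ bd) (single l 1) := by
      intro l hl
      rw [LinearMap.comp_apply, LinearMap.comp_apply, sdk_single, bd_consL, bd_single]
      obtain ⟨a, rfl⟩ := List.length_eq_one_iff.1 hl
      simp [bdList, sdk]
    have h := Sup_eq _ _ key hx
    rwa [LinearMap.comp_apply, LinearMap.comp_apply] at h
  | succ k ih =>
    have key : ∀ l : List V, l.length = k + 1 + 1 →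
        (bd ∘ₗ sdk (k+1+1)) (single l 1) = (sdk (k+1) ∘ₗ bd) (single l 1) := by
      intro l hl
      rw [LinearMap.comp_apply, LinearMap.comp_apply, sdk_single, bd_consL, bd_single]
      rw [ih (bdList_len l (k+1) hl), ← bd_single l, bd_bd, map_zero, map_zero, add_zero]
    have h := Sup_eq _ _ key hx
    rwa [LinearMap.comp_apply, LinearMap.comp_apply] at h

lemma bary_neg (l : List V) : bary (l.map (fun v => -v)) = - bary l := by
  have : (l.map (fun v => -v)).sum = - l.sum := by
    induction l with
    | nil => simp
    | cons a l ih => simp [ih]; abel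
  simp [bary, this]

lemma sdk_neg (k : ℕ) (x : Ch V) : sdk k (mapL (fun v => -v) x) = mapL (fun v => -v) (sdk k x) := by
  induction k generalizing x with
  | zero => simp [sdk]
  | succ k ih =>
    have : sdk (k+1) ∘ₗ mapL (fun v : V => -v) = mapL (fun v => -v) ∘ₗ sdk (k+1) := by
      apply ch_ind
      intro l
      simp only [LinearMap.comp_apply, mapL_single, sdk_single, bary_neg, mapL_consL]
      rw [← bd_single (l.map _), ← mapL_single, bd_mapL, ih, bd_single]
    exact congrArg (fun f => f x) this

lemma list_sum_convex {A : Set V} (hA : Convex ℝ A) (l : List V) (hl : l ≠ []) (h : ∀ v ∈ l, v ∈ A) :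
    bary l ∈ A := by
  have e : bary l = ∑ i : Fin l.length, ((l.length : ℝ)⁻¹) • l[i] := by
    rw [bary, ← Finset.smul_sum]
    congr 1
    conv_lhs => rw [← List.ofFn_getElem (xs := l)]
    rw [List.sum_ofFn]
    rfl
  have hpos : 0 < l.length := List.length_pos_iff.2 hl
  rw [e]
  refine hA.sum_mem (fun _ _ => by positivity) ?_ (fun i _ => h _ (List.getElem_mem _))
  simp
  field_simp

lemma sdk_len (k : ℕ) (l : List V) (hl : l.length = k) : sdk k (single l 1) ∈ Sup (fun l' => l'.length = k) := by
  induction k generalizing l with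
  | zero => exact single_mem_Sup _ hl
  | succ k ih =>
    rw [sdk_single]
    have : sdk k (bdList l) ∈ Sup (fun l' => l'.length = k) :=
      Sup_map (sdk k) (fun l' h => ih l' h) (bdList_len l k hl)
    exact Sup_map (consL _) (fun l' h => by rw [consL_single]; exact single_mem_Sup _ (by simp [h])) this

lemma sdk_conv {A : Set V} (hA : Convex ℝ A) (k : ℕ) (l : List V) (hl : l.length = k)
    (h : ∀ v ∈ l, v ∈ A) : sdk k (single l 1) ∈ Sup (fun l' => ∀ v ∈ l', v ∈ A) := by
  induction k generalizing l with
  | zero => exact single_mem_Sup _ h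
  | succ k ih =>
    rw [sdk_single]
    have : sdk k (bdList l) ∈ Sup (fun l' => ∀ v ∈ l', v ∈ A) :=
      Sup_map (sdk k) (fun l' h' => ih l' h'.1 h'.2) (bdList_mem (P := fun l' => l'.length = k ∧ ∀ v ∈ l', v ∈ A) l
        (fun l' h1 h2 => ⟨by omega, fun v hv => h v (h1.subset hv)⟩))
    refine Sup_map (consL _) (fun l' h' => ?_) this
    rw [consL_single]
    refine single_mem_Sup _ fun v hv => ?_
    rcases List.mem_cons.1 hv with rfl | hv
    · exact list_sum_convex hA l (by rintro rfl; simp at hl) h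
    · exact h' v hv

lemma sdk_pair (Rel : V → V → Prop) (Q : List V → Prop) (hQ : ∀ l l', l'.Sublist l → Q l → Q l')
    (hR : ∀ l, l ≠ [] → Q l → ∃ A : Set V, Convex ℝ A ∧ (∀ v ∈ l, v ∈ A) ∧ ∀ v ∈ A, Rel (bary l) v)
    (k : ℕ) (l : List V) (hl : l.length = k) (h : Q l) : sdk k (single l 1) ∈ Sup (List.Pairwise Rel) := by
  induction k generalizing l with
  | zero =>
    obtain rfl := List.length_eq_zero_iff.1 hl
    exact single_mem_Sup _ List.Pairwise.nil
  | succ k ih =>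
    rw [sdk_single]
    obtain ⟨A, hA, hlA, hRA⟩ := hR l (by rintro rfl; simp at hl) h
    have : sdk k (bdList l) ∈ Sup (fun l' => l'.Pairwise Rel ∧ ∀ v ∈ l', v ∈ A) :=
      Sup_map (sdk k) (fun l' h' => Sup_and (ih l' h'.1 (hQ _ _ h'.2 h))
          (sdk_conv hA k l' h'.1 (fun v hv => hlA v (h'.2.subset hv))))
        (bdList_mem (P := fun l' => l'.length = k ∧ l'.Sublist l) l
          (fun l' h1 h2 => ⟨by omega, h1⟩))
    refine Sup_map (consL _) (fun l' h' => ?_) this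
    rw [consL_single]
    exact single_mem_Sup _ (List.pairwise_cons.2 ⟨fun v hv => hRA v (h'.2 v hv), h'.1⟩)

end sd

section mesh
variable {V : Type*} [NormedAddCommGroup V] [NormedSpace ℝ V]

def mesh (η : ℝ) (l : List V) : Prop := ∀ u ∈ l, ∀ v ∈ l, ‖u - v‖ ≤ η

lemma bary_dist (n : ℕ) (η : ℝ) (hη : 0 ≤ η) (l : List V) (hl : l.length ≤ n + 1) (h : mesh η l)
    (u : V) (hu : u ∈ l) : ‖u - bary l‖ ≤ n / (n + 1) * η := by
  have hsum : ∀ l' : List V, (∀ v ∈ l', ‖u - v‖ ≤ η) → ‖(l'.length : ℝ) • u - l'.sum‖ ≤ l'.length * η := by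
    intro l' h'
    induction l' with
    | nil => simp
    | cons a l' ih =>
      have e : (((a :: l').length : ℕ) : ℝ) • u - (a :: l').sum = (u - a) + ((l'.length : ℝ) • u - l'.sum) := by
        simp only [List.length_cons, List.sum_cons]; push_cast; module
      rw [e]
      refine (norm_add_le _ _).trans ?_
      have := ih (fun v hv => h' v (by simp [hv]))
      have h2 := h' a (by simp)
      simp only [List.length_cons]; push_cast
      linarith
  obtain ⟨l1, l2, rfl⟩ := List.append_of_mem hu
  have h1 := hsum l1 (fun v hv => h u hu v (by simp [hv]))
  have h2 := hsum l2 (fun v hv => h u hu v (by simp [hv]))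
  have hk : (0 : ℝ) < (l1.length : ℝ) + l2.length + 1 := by positivity
  have e : u - bary (l1 ++ u :: l2) = ((l1.length : ℝ) + l2.length + 1)⁻¹ • 
      (((l1.length : ℝ) • u - l1.sum) + ((l2.length : ℝ) • u - l2.sum)) := by
    rw [bary, List.sum_append, List.sum_cons, List.length_append, List.length_cons]
    push_cast
    rw [← add_assoc (l1.length : ℝ)]
    have : u = ((l1.length : ℝ) + l2.length + 1)⁻¹ • (((l1.length : ℝ) + l2.length + 1) • u) := by
      rw [smul_smul, inv_mul_cancel₀ hk.ne', one_smul]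
    conv_lhs => enter [1]; rw [this]
    module
  rw [e, norm_smul, norm_inv, Real.norm_of_nonneg hk.le]
  have h3 := (norm_add_le ((l1.length : ℝ) • u - l1.sum) ((l2.length : ℝ) • u - l2.sum)).trans (add_le_add h1 h2)
  have hn : (l1.length : ℝ) + l2.length ≤ n := by
    simp at hl
    exact_mod_cast (by omega : l1.length + l2.length ≤ n)
  set a : ℝ := (l1.length : ℝ) + l2.length with ha
  have ha0 : 0 ≤ a := by positivity
  calc (a + 1)⁻¹ * _ ≤ (a+1)⁻¹ * (l1.length * η + l2.length * η) := by gcongr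
    _ = a / (a+1) * η := by rw [ha]; ring
    _ ≤ n / (n+1) * η := by
      gcongr ?_ * η
      rw [div_le_div_iff₀ (by positivity) (by positivity)]
      nlinarith

lemma sdk_mesh (n : ℕ) (η : ℝ) (hη : 0 ≤ η) (k : ℕ) (l : List V) (hl : l.length = k) (hk : k ≤ n + 1)
    (h : mesh η l) : sdk k (single l 1) ∈ Sup (mesh (n / (n+1) * η)) := by
  have := sdk_pair (fun u v => ‖u - v‖ ≤ n / (n+1) * η) (fun l => mesh η l ∧ l.length ≤ n + 1)
    (fun l l' hs hQ => ⟨fun u hu v hv => hQ.1 u (hs.subset hu) v (hs.subset hv), hs.length_le.trans hQ.2⟩)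
    (fun l _ hQ => ⟨Metric.closedBall (bary l) (n / (n+1) * η), convex_closedBall _ _, fun v hv => by
        rw [mem_closedBall_iff_norm]
        exact bary_dist n η hη l hQ.2 hQ.1 v hv, fun v hv => by
        rw [norm_sub_rev]; rwa [mem_closedBall_iff_norm] at hv⟩) k l hl ⟨h, by omega⟩
  refine Sup_mono (fun l' h' => ?_) this
  intro u hu v hv
  by_cases e : u = v
  · subst e; rw [sub_self, norm_zero]; positivity
  · haveI : Std.Symm (fun u v : V => ‖u - v‖ ≤ n / (n+1) * η) := ⟨fun a b h => by rwa [norm_sub_rev]⟩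
    exact h'.forall hu hv e

end mesh

section sphere
variable {n : ℕ}

abbrev VV (n : ℕ) := Fin (n+1) → ℝ

def Oct (ε : Fin (n+1) → ℝ) : Set (VV n) := {v | (∀ i, 0 ≤ ε i * v i) ∧ ∑ i, ε i * v i = 1}

lemma Oct_convex (ε : Fin (n+1) → ℝ) : Convex ℝ (Oct ε) := by
  intro x hx y hy a b ha hb hab
  refine ⟨fun i => ?_, ?_⟩
  · have h1 := mul_nonneg ha (hx.1 i)
    have h2 := mul_nonneg hb (hy.1 i)
    simp only [Pi.add_apply, Pi.smul_apply, smul_eq_mul]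
    linarith
  · have : ∀ i, ε i * (a • x + b • y) i = a * (ε i * x i) + b * (ε i * y i) := by
      intro i; simp only [Pi.add_apply, Pi.smul_apply, smul_eq_mul]; ring
    simp only [this, Finset.sum_add_distrib, ← Finset.mul_sum, hx.2, hy.2]
    linarith

def isSg (ε : Fin (n+1) → ℝ) : Prop := ∀ i, ε i = 1 ∨ ε i = -1

def inOct (l : List (VV n)) : Prop := ∃ ε : Fin (n+1) → ℝ, isSg ε ∧ ∀ v ∈ l, v ∈ Oct ε

noncomputable def ev (n k : ℕ) : VV n := fun i => if (i : ℕ) = k then 1 else 0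

noncomputable def yy (n : ℕ) : ℕ → Ch (VV n)
  | 0 => single [] 1
  | k + 1 => consL (ev n k) (yy n k) + consL (-ev n k) (yy n k)

lemma bd_yy (k : ℕ) : bd (yy n k) = 0 := by
  induction k with
  | zero => simp [yy, bdList]
  | succ k ih => simp [yy, bd_consL, ih, ch_add_self]

lemma neg_yy (k : ℕ) : mapL (fun v => -v) (yy n k) = yy n k := by
  induction k with
  | zero => simp [yy]
  | succ k ih => simp [yy, mapL_consL, ih, add_comm]

lemma yy_mem (k : ℕ) (hk : k ≤ n + 1) : yy n k ∈ Sup (fun l => l.length = k ∧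
    ∃ ε : Fin (n+1) → ℝ, isSg ε ∧ ∀ v ∈ l, v ∈ Oct ε ∧ ∀ j : Fin (n+1), k ≤ j → v j = 0) := by
  induction k with
  | zero => exact single_mem_Sup _ ⟨rfl, fun _ => 1, fun _ => Or.inl rfl, by simp⟩
  | succ k ih =>
    have key : ∀ c : ℝ, (c = 1 ∨ c = -1) → consL (c • ev n k) (yy n k) ∈ Sup (fun l => l.length = k + 1 ∧
        ∃ ε : Fin (n+1) → ℝ, isSg ε ∧ ∀ v ∈ l, v ∈ Oct ε ∧ ∀ j : Fin (n+1), k + 1 ≤ j → v j = 0) := by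
      intro c hc
      refine Sup_map (consL _) (fun l hl => ?_) (ih (by omega))
      obtain ⟨hlen, ε, hε, hl⟩ := hl
      rw [consL_single]
      refine single_mem_Sup _ ⟨by simp [hlen], Function.update ε ⟨k, hk⟩ c, ?_, ?_⟩
      · intro i
        by_cases h : i = ⟨k, hk⟩
        · subst h; simpa using hc
        · simpa [h] using hε i
      · intro v hv
        rcases List.mem_cons.1 hv with rfl | hv
        · have e : ∀ i : Fin (n+1), Function.update ε ⟨k, hk⟩ c i * (c • ev n k) i = if i = ⟨k, hk⟩ then 1 else 0 := by
            intro i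
            by_cases h : i = ⟨k, hk⟩
            · subst h; rcases hc with rfl | rfl <;> simp [ev]
            · have : (i : ℕ) ≠ k := fun h' => h (Fin.ext h')
              simp [h, ev, this]
          refine ⟨⟨fun i => ?_, ?_⟩, ?_⟩
          · rw [e]; split_ifs <;> norm_num
          · simp only [e]; simp
          · intro j hj
            have : (j : ℕ) ≠ k := by omega
            simp [ev, this]
        · obtain ⟨h1, h2⟩ := hl v hv
          have e : ∀ i : Fin (n+1), Function.update ε ⟨k, hk⟩ c i * v i = ε i * v i := by
            intro i
            by_cases h : i = ⟨k, hk⟩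
            · subst h; rw [h2 _ le_rfl]; simp
            · simp [h]
          exact ⟨⟨fun i => by rw [e]; exact h1.1 i, by simp only [e]; exact h1.2⟩, fun j hj => h2 j (by omega)⟩
    refine Submodule.add_mem _ ?_ ?_
    · simpa using key 1 (Or.inl rfl)
    · simpa using key (-1) (Or.inr rfl)

def IsSys (n : ℕ) (z : ℕ → Ch (VV n)) : Prop :=
  bd (z 0) = single [] 1 ∧ ∀ i < n, bd (z (i+1)) = z i + mapL (fun v => -v) (z i)

def basic (n i : ℕ) (η : ℝ) (l : List (VV n)) : Prop :=
  (l.length = i + 1 ∧ i ≤ n) ∧ inOct l ∧ mesh η l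

lemma Oct_abs {ε : Fin (n+1) → ℝ} (hε : isSg ε) {v : VV n} (hv : v ∈ Oct ε) (i) : |v i| = ε i * v i := by
  have := hv.1 i
  rcases hε i with h | h <;> rw [h] at this ⊢
  · rw [one_mul] at this ⊢; exact abs_of_nonneg this
  · rw [abs_of_nonpos] <;> linarith

lemma sys0 (n : ℕ) : ∃ z : ℕ → Ch (VV n), IsSys n z ∧ ∀ i, z i ∈ Sup (basic n i 2) := by
  refine ⟨fun i => if i ≤ n then consL (ev n i) (yy n i) else 0, ⟨?_, ?_⟩, ?_⟩
  · simp [yy, bdList]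
  · intro i hi
    beta_reduce
    rw [if_pos (by omega), if_pos (by omega), bd_consL, bd_yy, map_zero, add_zero, mapL_consL, neg_yy]
    rfl
  · intro i
    by_cases hi : i ≤ n
    · simp only [hi, if_true]
      have h' : consL (ev n i) (yy n i) ∈ Sup (fun l => l.length = i + 1 ∧ inOct l) := by
        refine Sup_map (consL _) (fun l hl => ?_) (yy_mem (n := n) i (by omega))
        obtain ⟨hlen, ε, hε, hl⟩ := hl
        rw [consL_single]
        refine single_mem_Sup _ ⟨by simp [hlen], Function.update ε ⟨i, by omega⟩ 1, ?_, ?_⟩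
        · intro j
          by_cases h : j = ⟨i, by omega⟩
          · subst h; simp
          · simpa [h] using hε j
        · intro v hv
          rcases List.mem_cons.1 hv with rfl | hv
          · have e : ∀ j : Fin (n+1), Function.update ε ⟨i, by omega⟩ 1 j * (ev n i) j
                = if j = ⟨i, by omega⟩ then 1 else 0 := by
              intro j
              by_cases h : j = ⟨i, by omega⟩
              · subst h; simp [ev]
              · have : (j : ℕ) ≠ i := fun h' => h (Fin.ext h')
                simp [h, ev, this]
            refine ⟨fun j => ?_, ?_⟩
            · rw [e]; split_ifs <;> norm_num
            · simp only [e]; simp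
          · obtain ⟨h1, h2⟩ := hl v hv
            have e : ∀ j : Fin (n+1), Function.update ε ⟨i, by omega⟩ 1 j * v j = ε j * v j := by
              intro j
              by_cases h : j = ⟨i, by omega⟩
              · subst h; rw [h2 _ le_rfl]; simp
              · simp [h]
            exact ⟨fun j => by rw [e]; exact h1.1 j, by simp only [e]; exact h1.2⟩
      refine Sup_mono (fun l hl => ⟨⟨hl.1, hi⟩, hl.2, ?_⟩) h'
      obtain ⟨ε, hε, hl⟩ := hl.2
      have hn : ∀ v ∈ l, ‖v‖ ≤ 1 := by
        intro v hv
        rw [pi_norm_le_iff_of_nonneg zero_le_one]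
        intro j
        rw [Real.norm_eq_abs, Oct_abs hε (hl v hv), ← (hl v hv).2]
        exact Finset.single_le_sum (fun k _ => (hl v hv).1 k) (Finset.mem_univ j)
      intro u hu v hv
      have := norm_sub_le u v
      linarith [hn u hu, hn v hv]
    · simp only [hi, if_false]; exact Submodule.zero_mem _

def sgLe (b v : VV n) : Prop := ∀ i, v i ≠ 0 → SignType.sign (b i) = SignType.sign (v i)

lemma sdk_sg (k : ℕ) (l : List (VV n)) (hl : l.length = k) (h : inOct l) :
    sdk k (single l 1) ∈ Sup (List.Pairwise sgLe) := by
  refine sdk_pair sgLe inOct ?_ ?_ k l hl h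
  · rintro l l' hs ⟨ε, hε, h⟩
    exact ⟨ε, hε, fun v hv => h v (hs.subset hv)⟩
  · rintro l hne ⟨ε, hε, h⟩
    let Z : Set (VV n) := {v | ∀ i, (∀ w ∈ l, w i = 0) → v i = 0}
    have hZ : Convex ℝ Z := by
      intro x hx y hy a b _ _ _ i hi
      simp [hx i hi, hy i hi]
    have hb : bary l ∈ Oct ε := list_sum_convex (Oct_convex ε) l hne h
    refine ⟨Oct ε ∩ Z, (Oct_convex ε).inter hZ, fun v hv => ⟨h v hv, fun i hi => hi v hv⟩, ?_⟩
    rintro v ⟨hv, hvZ⟩ i hvi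
    -- the barycenter is nonzero at i
    have hbi : bary l i ≠ 0 := by
      intro h0
      apply hvi
      apply hvZ
      have hs : ∀ l' : List (VV n), (∀ w ∈ l', w ∈ Oct ε) → 0 ≤ ε i * l'.sum i ∧
          (ε i * l'.sum i = 0 → ∀ w ∈ l', w i = 0) := by
        intro l' h'
        induction l' with
        | nil => simp
        | cons a l' ih =>
          obtain ⟨i1, i2⟩ := ih (fun w hw => h' w (by simp [hw]))
          have ha := (h' a (by simp)).1 i
          simp only [List.sum_cons, Pi.add_apply, mul_add]
          refine ⟨by linarith, fun h0 w hw => ?_⟩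
          rcases List.mem_cons.1 hw with rfl | hw
          · have : ε i * w i = 0 := by linarith
            rcases mul_eq_zero.1 this with h | h
            · rcases hε i with h' | h' <;> rw [h'] at h <;> norm_num at h
            · exact h
          · exact i2 (by linarith) w hw
      apply (hs l h).2
      have hpos : (0 : ℝ) < l.length := by exact_mod_cast List.length_pos_iff.2 hne
      simp only [bary, Pi.smul_apply, smul_eq_mul] at h0
      rcases mul_eq_zero.1 h0 with h | h
      · exact absurd h (inv_ne_zero hpos.ne')
      · rw [h, mul_zero]
    have e1 := hv.1 i
    have e2 := hb.1 i
    rcases hε i with h' | h' <;> rw [h'] at e1 e2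
    · rw [one_mul] at e1 e2
      rw [sign_pos (lt_of_le_of_ne e1 hvi.symm), sign_pos (lt_of_le_of_ne e2 hbi.symm)]
    · rw [sign_neg (lt_of_le_of_ne (by linarith) hvi), sign_neg (lt_of_le_of_ne (by linarith) hbi)]

lemma sys_step {z : ℕ → Ch (VV n)} {η : ℝ} (hη : 0 ≤ η) (h : IsSys n z) (hz : ∀ i, z i ∈ Sup (basic n i η)) :
    ∃ z' : ℕ → Ch (VV n), IsSys n z' ∧
      ∀ i, z' i ∈ Sup (fun l => basic n i (n / (n+1) * η) l ∧ l.Pairwise sgLe) := by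
  have hlen : ∀ i, z i ∈ Sup (fun l => l.length = i + 1) := fun i => Sup_mono (fun l hl => hl.1.1) (hz i)
  refine ⟨fun i => sdk (i+1) (z i), ⟨?_, ?_⟩, ?_⟩
  · rw [bd_sdk 0 (hlen 0), h.1]; rfl
  · intro i hi
    rw [bd_sdk (i+1) (hlen (i+1)), h.2 i hi, map_add, sdk_neg]
  · intro i
    refine Sup_map (sdk (i+1)) (fun l hl => ?_) (hz i)
    obtain ⟨⟨h1, h2⟩, ⟨ε, hε, h3⟩, h4⟩ := hl
    have a1 := sdk_len (i+1) l h1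
    have a2 := sdk_conv (Oct_convex ε) (i+1) l h1 h3
    have a3 := sdk_mesh n η hη (i+1) l h1 (by omega) h4
    have a4 := sdk_sg (i+1) l h1 ⟨ε, hε, h3⟩
    exact Sup_mono (fun l' h' => ⟨⟨⟨h'.1.1.1, h2⟩, ⟨ε, hε, h'.1.1.2⟩, h'.1.2⟩, h'.2⟩)
      (Sup_and (Sup_and (Sup_and a1 a2) a3) a4)

theorem sphere_system (n : ℕ) (δ : ℝ) (hδ : 0 < δ) : ∃ z : ℕ → Ch (VV n), IsSys n z ∧
      ∀ i, z i ∈ Sup (fun l => basic n i δ l ∧ l.Pairwise sgLe) := by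
  have key : ∀ t : ℕ, ∃ z : ℕ → Ch (VV n), IsSys n z ∧ ∀ i, z i ∈ Sup (basic n i (((n:ℝ)/(n+1))^t * 2)) := by
    intro t
    induction t with
    | zero => simpa using sys0 n
    | succ t ih =>
      obtain ⟨z, h1, h2⟩ := ih
      obtain ⟨z', h3, h4⟩ := sys_step (by positivity) h1 h2
      refine ⟨z', h3, fun i => Sup_mono (fun l hl => ?_) (h4 i)⟩
      rw [pow_succ', mul_assoc]
      exact hl.1
  have hlt : (n:ℝ)/(n+1) < 1 := by rw [div_lt_one (by positivity)]; linarith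
  obtain ⟨t, ht⟩ := exists_pow_lt_of_lt_one (half_pos hδ) hlt
  obtain ⟨z, h1, h2⟩ := key t
  obtain ⟨z', h3, h4⟩ := sys_step (by positivity) h1 h2
  refine ⟨z', h3, fun i => Sup_mono (fun l hl => ⟨⟨hl.1.1, hl.1.2.1, fun u hu v hv => ?_⟩, hl.2⟩) (h4 i)⟩
  refine (hl.1.2.2 u hu v hv).trans ?_
  have : (n:ℝ)/(n+1) * (((n:ℝ)/(n+1))^t * 2) ≤ 1 * (((n:ℝ)/(n+1))^t * 2) := by gcongr
  linarith

end sphere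
end TRP

namespace TRP
open Finsupp

section radon
variable {n d : ℕ}

def posS (s : Fin (n+1) → SignType) : Finset (Fin (n+1)) := Finset.univ.filter (fun i => s i = 1)
def negS (s : Fin (n+1) → SignType) : Finset (Fin (n+1)) := Finset.univ.filter (fun i => s i = -1)

lemma mem_posS {s : Fin (n+1) → SignType} {i} : i ∈ posS s ↔ s i = 1 := by simp [posS]
lemma mem_negS {s : Fin (n+1) → SignType} {i} : i ∈ negS s ↔ s i = -1 := by simp [negS]

lemma posS_neg (s : Fin (n+1) → SignType) : posS (-s) = negS s := by
  ext i; simp only [mem_posS, mem_negS, Pi.neg_apply]; generalize s i = a; revert a; decide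
lemma negS_neg (s : Fin (n+1) → SignType) : negS (-s) = posS s := by
  ext i; simp only [mem_posS, mem_negS, Pi.neg_apply]; generalize s i = a; revert a; decide

lemma disj_S (s : Fin (n+1) → SignType) : Disjoint (posS s) (negS s) := by
  rw [Finset.disjoint_left]
  intro i h1 h2
  rw [mem_posS] at h1; rw [mem_negS, h1] at h2
  exact absurd h2 (by decide)

variable (f : (Fin (n + 1) → ℝ) → EuclideanSpace ℝ (Fin d))

def Rad (s : Fin (n+1) → SignType) : Prop := IsRadonPair f (posS s) (negS s)

def sLe (s t : Fin (n+1) → SignType) : Prop := ∀ i, s i ≠ 0 → t i = s i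

variable {f}

lemma Rad_neg {s : Fin (n+1) → SignType} (h : Rad f s) : Rad f (-s) := by
  unfold Rad IsRadonPair at *
  rw [posS_neg, negS_neg, Set.inter_comm]
  exact ⟨h.1.symm, h.2⟩

lemma Rad_neg_iff {s : Fin (n+1) → SignType} : Rad f (-s) ↔ Rad f s :=
  ⟨fun h => by simpa using Rad_neg h, Rad_neg⟩

lemma face_mono {σ τ : Finset (Fin (n+1))} (h : σ ⊆ τ) : simplexFace σ ⊆ simplexFace τ :=
  fun _ hx => ⟨hx.1, fun i hi => hx.2 i (fun h' => hi (h h'))⟩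

lemma posS_mono {s t : Fin (n+1) → SignType} (h : sLe s t) : posS s ⊆ posS t := by
  intro i hi
  rw [mem_posS] at *
  rw [h i (by rw [hi]; decide), hi]
lemma negS_mono {s t : Fin (n+1) → SignType} (h : sLe s t) : negS s ⊆ negS t := by
  intro i hi
  rw [mem_negS] at *
  rw [h i (by rw [hi]; decide), hi]

lemma Rad_mono {s t : Fin (n+1) → SignType} (h : sLe s t) (hs : Rad f s) : Rad f t := by
  refine ⟨disj_S t, hs.2.mono ?_⟩
  exact Set.inter_subset_inter (Set.image_mono (face_mono (posS_mono h)))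
    (Set.image_mono (face_mono (negS_mono h)))

variable (f) in
def RS : Type := {s : Fin (n+1) → SignType // Rad f s}

instance : Preorder (RS f) where
  le s t := sLe s.1 t.1
  le_refl s := fun _ _ => rfl
  le_trans s t u h1 h2 := fun i hi => by
    have := h1 i hi
    rw [h2 i (by rw [this]; exact hi), this]

def RS.ng (s : RS f) : RS f := ⟨-s.1, Rad_neg s.2⟩

lemma RS.ng_mono (a b : RS f) (h : a ≤ b) : a.ng ≤ b.ng := by
  intro i hi
  have hi' : a.1 i ≠ 0 := by
    intro h0; apply hi; show - a.1 i = 0; rw [h0]; rfl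
  show - b.1 i = - a.1 i
  rw [h i hi']

noncomputable def sg (v : VV n) : Fin (n+1) → SignType := fun i => SignType.sign (v i)

lemma sg_neg (v : VV n) : sg (-v) = - sg v := by
  ext i; simp [sg, Left.sign_neg]

lemma open_rad : IsOpen {v : VV n | Rad f (sg v)} := by
  rw [isOpen_iff_mem_nhds]
  intro v hv
  have key : ∀ i, ∀ᶠ w : VV n in nhds v, v i ≠ 0 → SignType.sign (w i) = SignType.sign (v i) := by
    intro i
    have hc : Filter.Tendsto (fun w : VV n => w i) (nhds v) (nhds (v i)) := (continuous_apply i).continuousAt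
    rcases lt_trichotomy (v i) 0 with h | h | h
    · filter_upwards [hc.eventually (gt_mem_nhds h)] with w hw _
      rw [sign_neg h, sign_neg hw]
    · exact Filter.Eventually.of_forall fun w h' => absurd h h'
    · filter_upwards [hc.eventually (lt_mem_nhds h)] with w hw _
      rw [sign_pos h, sign_pos hw]
  filter_upwards [Filter.eventually_all.2 key] with w hw
  refine Rad_mono (fun i hi => hw i ?_) hv
  intro h0; apply hi; simp [sg, h0]

def sph (n : ℕ) : Set (VV n) := {v | ∑ i, |v i| = 1}

lemma sph_compact : IsCompact (sph n) := by
  refine Metric.isCompact_of_isClosed_isBounded ?_ ?_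
  · exact isClosed_eq (by fun_prop) continuous_const
  · refine (Metric.isBounded_closedBall (x := (0 : VV n)) (r := 1)).subset fun v hv => ?_
    rw [mem_closedBall_zero_iff, pi_norm_le_iff_of_nonneg zero_le_one]
    intro i
    rw [Real.norm_eq_abs]
    have hv' : ∑ i, |v i| = 1 := hv
    rw [← hv']
    exact Finset.single_le_sum (f := fun i => |v i|) (fun k _ => abs_nonneg _) (Finset.mem_univ i)

lemma tietze (hf : ContinuousOn f (stdSimplex ℝ (Fin (n + 1)))) :
    ∃ g : (Fin (n + 1) → ℝ) → EuclideanSpace ℝ (Fin d), Continuous g ∧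
      ∀ x ∈ stdSimplex ℝ (Fin (n+1)), g x = f x := by
  have : TietzeExtension (EuclideanSpace ℝ (Fin d)) := TietzeExtension.of_tvs ℝ
  obtain ⟨g, hg⟩ := ContinuousMap.exists_restrict_eq (isClosed_stdSimplex ℝ (Fin (n+1)))
    ⟨_, hf.domRestrict⟩
  refine ⟨g, g.continuous, fun x hx => ?_⟩
  exact congrArg (fun h => h ⟨x, hx⟩) hg

/-- The odd test map. -/
noncomputable def Tst (g : (Fin (n + 1) → ℝ) → EuclideanSpace ℝ (Fin d)) (v : VV n) : Fin (d+1) → ℝ :=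
  Fin.cons (∑ i, v i) (fun j => (g (fun i => 2 * max (v i) 0)) j - (g (fun i => 2 * max (-v i) 0)) j)

lemma Tst_neg (g : (Fin (n + 1) → ℝ) → EuclideanSpace ℝ (Fin d)) (v : VV n) : Tst g (-v) = - Tst g v := by
  ext j
  refine Fin.cases ?_ (fun j => ?_) j
  · simp [Tst]
  · simp [Tst]

lemma Tst_cont {g : (Fin (n + 1) → ℝ) → EuclideanSpace ℝ (Fin d)} (hg : Continuous g) :
    Continuous (Tst (n := n) g) := by
  refine continuous_pi fun j => ?_
  refine Fin.cases ?_ (fun j => ?_) j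
  · simp only [Tst, Fin.cons_zero]; fun_prop
  · simp only [Tst, Fin.cons_succ]; fun_prop

lemma Tst_zero {g : (Fin (n + 1) → ℝ) → EuclideanSpace ℝ (Fin d)}
    (hg : ∀ x ∈ stdSimplex ℝ (Fin (n+1)), g x = f x) {v : VV n} (hv : v ∈ sph n) (h : Tst g v = 0) :
    Rad f (sg v) := by
  have hv' : ∑ i, |v i| = 1 := hv
  have h0 : ∑ i, v i = 0 := by simpa [Tst] using congrFun h 0
  have e1 : ∑ i, 2 * max (v i) 0 = 1 := by
    have : ∀ i, 2 * max (v i) 0 = v i + |v i| := by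
      intro i
      rcases le_total 0 (v i) with h | h
      · rw [max_eq_left h, abs_of_nonneg h]; ring
      · rw [max_eq_right h, abs_of_nonpos h]; ring
    simp only [this, Finset.sum_add_distrib]; linarith
  have e2 : ∑ i, 2 * max (-v i) 0 = 1 := by
    have : ∀ i, 2 * max (-v i) 0 = |v i| - v i := by
      intro i
      rcases le_total 0 (v i) with h | h
      · rw [max_eq_right (by linarith), abs_of_nonneg h]; ring
      · rw [max_eq_left (by linarith), abs_of_nonpos h]; ring
    simp only [this, Finset.sum_sub_distrib]; linarith
  have m1 : (fun i => 2 * max (v i) 0) ∈ stdSimplex ℝ (Fin (n+1)) := ⟨fun i => by positivity, e1⟩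
  have m2 : (fun i => 2 * max (-v i) 0) ∈ stdSimplex ℝ (Fin (n+1)) := ⟨fun i => by positivity, e2⟩
  refine ⟨disj_S _, f (fun i => 2 * max (v i) 0), ⟨_, ⟨m1, ?_⟩, rfl⟩, _, ⟨m2, ?_⟩, ?_⟩
  · intro i hi
    have : v i ≤ 0 := by
      by_contra h; push Not at h
      exact hi (mem_posS.2 (sign_pos h))
    simp [this]
  · intro i hi
    have : 0 ≤ v i := by
      by_contra h; push Not at h
      exact hi (mem_negS.2 (sign_neg h))
    simp [this]
  · rw [← hg _ m1, ← hg _ m2]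
    ext j
    have := congrFun h j.succ
    simp only [Tst, Fin.cons_succ, Pi.zero_apply] at this
    linarith

noncomputable def lb (δ : ℝ) (x : Fin (d+1) → ℝ) : Lab Unit (d+1) :=
  ((), Classical.epsilon (fun j => δ ≤ |x j|),
    decide (0 < x (Classical.epsilon (fun j => δ ≤ |x j|))))

lemma lb_spec {δ : ℝ} (hδ : 0 < δ) {x : Fin (d+1) → ℝ} (h : δ ≤ ‖x‖) : δ ≤ |x (lb δ x).2.1| := by
  have : ∃ j, δ ≤ |x j| := by
    by_contra hc; push Not at hc
    have := (pi_norm_lt_iff (x := x) hδ).2 hc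
    linarith
  exact Classical.epsilon_spec this

lemma lb_neg {δ : ℝ} (hδ : 0 < δ) {x : Fin (d+1) → ℝ} (h : δ ≤ ‖x‖) : lb δ (-x) = (lb δ x).neg := by
  have h1 := lb_spec hδ h
  have e : (fun j => δ ≤ |(-x) j|) = fun j => δ ≤ |x j| := by ext j; simp
  simp only [lb, Lab.neg] at h1 ⊢
  simp only [e]
  set j := Classical.epsilon (fun j => δ ≤ |x j|)
  have hne : x j ≠ 0 := by intro h0; rw [h0, abs_zero] at h1; linarith
  refine Prod.ext rfl (Prod.ext rfl ?_)
  rcases lt_or_gt_of_ne hne with h | h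
  · simp [h, h.le]
  · simp [h, h.le]

lemma lb_close {δ : ℝ} (hδ : 0 < δ) {x y : Fin (d+1) → ℝ} (hx : δ ≤ ‖x‖) (hy : δ ≤ ‖y‖) (hxy : ‖x - y‖ < δ) :
    lb δ y ≠ (lb δ x).neg := by
  intro h
  have h1 := lb_spec hδ hx
  have h2 := lb_spec hδ hy
  have hj : (lb δ y).2.1 = (lb δ x).2.1 := by rw [h]; rfl
  have hs : (lb δ y).2.2 = !(lb δ x).2.2 := by rw [h]; rfl
  rw [hj] at h2
  have e1 : (lb δ x).2.2 = decide (0 < x (lb δ x).2.1) := rfl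
  have e2 : (lb δ y).2.2 = decide (0 < y (lb δ y).2.1) := rfl
  rw [e1, e2, hj] at hs
  have h3 := (norm_le_pi_norm (x - y) (lb δ x).2.1).trans_lt hxy
  rw [Pi.sub_apply, Real.norm_eq_abs] at h3
  generalize (lb δ x).2.1 = j at *
  by_cases hxj : 0 < x j
  · have hyj : ¬ 0 < y j := by simpa [hxj] using hs
    push Not at hyj
    rw [abs_of_pos hxj] at h1
    have := le_abs_self (x j - y j)
    linarith
  · have hyj : 0 < y j := by simpa [hxj] using hs
    push Not at hxj
    rw [abs_of_pos hyj] at h2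
    have := neg_abs_le (x j - y j)
    linarith

open Classical in
noncomputable def cls (f : (Fin (n + 1) → ℝ) → EuclideanSpace ℝ (Fin d))
    (g : (Fin (n + 1) → ℝ) → EuclideanSpace ℝ (Fin d)) (δ : ℝ) (v : VV n) : RS f ⊕ Lab Unit (d+1) :=
  if h : Rad f (sg v) then Sum.inl ⟨sg v, h⟩ else Sum.inr (lb δ (Tst g v))

theorem radon_system (hf : ContinuousOn f (stdSimplex ℝ (Fin (n + 1)))) (N : ℕ) (hN : N + (d + 1) ≤ n) :
    ∃ w : ℕ → Ch (RS f), (∀ i, w i ∈ Sup srt) ∧ bd (w 0) = single [] 1 ∧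
      ∀ i < N, bd (w (i+1)) = w i + mapL RS.ng (w i) := by
  obtain ⟨g, hgc, hg⟩ := tietze hf
  have hGc : Continuous (Tst (n := n) g) := Tst_cont hgc
  have hK : IsCompact (sph n ∩ {v : VV n | Rad f (sg v)}ᶜ) := sph_compact.inter_right open_rad.isClosed_compl
  obtain ⟨δ, hδ, hδK⟩ := hK.exists_forall_le' (f := fun v => ‖Tst g v‖) (hGc.norm.continuousOn) (a := 0)
    (fun v hv => norm_pos_iff.2 fun h0 => hv.2 (Tst_zero hg hv.1 h0))
  obtain ⟨η, hη, hηG⟩ := Metric.uniformContinuousOn_iff.1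
    (sph_compact.uniformContinuousOn_of_continuous hGc.continuousOn) δ hδ
  obtain ⟨z, hz, hzb⟩ := sphere_system n (η/2) (half_pos hη)
  have hsph : ∀ l : List (VV n), inOct l → ∀ v ∈ l, v ∈ sph n := by
    rintro l ⟨ε, hε, h⟩ v hv
    show ∑ i, |v i| = 1
    simp only [Oct_abs hε (h v hv)]
    exact (h v hv).2
  have hodd : ∀ v ∈ sph n, cls f g δ (-v) = Sum.map RS.ng negE (cls f g δ v) := by
    intro v hv
    by_cases h : Rad f (sg v)
    · have h' : Rad f (sg (-v)) := by rw [sg_neg]; exact Rad_neg h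
      simp only [cls, h, h', dif_pos, Sum.map_inl]
      congr 1
      exact Subtype.ext (sg_neg v)
    · have h' : ¬ Rad f (sg (-v)) := by rw [sg_neg, Rad_neg_iff]; exact h
      simp only [cls, h, h', dif_neg, not_false_eq_true, Sum.map_inr]
      rw [Tst_neg, lb_neg hδ (hδK v ⟨hv, h⟩)]
      rfl
  refine stage1 (M := d+1) RS.ng RS.ng_mono (z := fun i => mapL (cls f g δ) (z i)) (n := n) ?_ ?_ ?_ ?_ hN
  · intro i
    refine Sup_map _ (fun l hl => ?_) (hzb i)
    rw [mapL_single]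
    refine single_mem_Sup _ ?_
    unfold ok
    rw [List.pairwise_map]
    refine hl.2.imp_of_mem ?_
    intro a b ha hb hab
    have has := hsph l hl.1.2.1 a ha
    have hbs := hsph l hl.1.2.1 b hb
    by_cases h1 : Rad f (sg a) <;> by_cases h2 : Rad f (sg b) <;>
      simp only [cls, h1, h2, dif_pos, dif_neg, not_false_eq_true, okR]
    · intro i hi
      refine hab i ?_
      intro h0; apply hi; simp [sg, h0]
    · refine lb_close hδ (hδK a ⟨has, h1⟩) (hδK b ⟨hbs, h2⟩) ?_
      rw [← dist_eq_norm]
      refine hηG a has b hbs ?_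
      rw [dist_eq_norm]
      have := hl.1.2.2 a ha b hb
      linarith
  · intro i
    refine Sup_map _ (fun l hl => ?_) (hzb i)
    rw [mapL_single]
    exact single_mem_Sup _ (by simpa using hl.1.1.1)
  · show bd (mapL (cls f g δ) (z 0)) = _
    rw [bd_mapL, hz.1]; simp
  · intro i hi
    show bd (mapL (cls f g δ) (z (i+1))) = _
    rw [bd_mapL, hz.2 i hi, map_add]
    congr 1
    have key := Sup_eq (mapL (cls f g δ) ∘ₗ mapL (fun v => -v)) (mapL (Sum.map RS.ng negE) ∘ₗ mapL (cls f g δ))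
      (P := fun l => basic n i (η/2) l ∧ l.Pairwise sgLe) (fun l hl => ?_) (hzb i)
    · exact key
    · simp only [LinearMap.comp_apply, mapL_single, List.map_map]
      congr 1
      exact List.map_congr_left fun v hv => hodd v (hsph l hl.1.2.1 v hv)

end radon
end TRP

namespace TRP

section lab3
variable {m : ℕ} [Nonempty (Fin m)]

abbrev HH (m : ℕ) := Fin m → Bool → Bool → Bool

def Vt (h : HH m) (c : Fin m) : Bool := (h c true true || h c false false) && (h c true false || h c false true)
def Tt (h : HH m) (c : Fin m) : Bool := (h c true true || h c false false) || (h c true false || h c false true)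
def cA (h : HH m) (c : Fin m) (x : Bool) : Bool := h c x true && h c x false
def cB (h : HH m) (c : Fin m) (y : Bool) : Bool := h c true y && h c false y

def pick (h : HH m) (p : Bool) (c : Fin m) : Lab (Fin 3) m :=
  bif p then (bif (cA h c true || cA h c false) then (1, c, cA h c true) else (2, c, cB h c true))
  else (bif (cB h c true || cB h c false) then (2, c, cB h c true) else (1, c, cA h c true))

open Classical in
noncomputable def lab3 (h : HH m) (p : Bool) : Lab (Fin 3) m :=
  if ∃ c, Vt h c = true then pick h p (Classical.epsilon (fun c => Vt h c = true))
  else (0, Classical.epsilon (fun c => Tt h c = true),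
    (h (Classical.epsilon (fun c => Tt h c = true)) true true ||
      h (Classical.epsilon (fun c => Tt h c = true)) false false))

def good (h : HH m) : Prop := (∀ c, ¬ (h c true true = true ∧ h c true false = true ∧ h c false true = true
  ∧ h c false false = true)) ∧ ∃ c, Tt h c = true

lemma lab3_fl (h : HH m) (p : Bool) (hg : good h) :
    lab3 (fun c a b => h c (!a) b) p = fl 2 (lab3 h p) := by
  have eV : Vt (fun c a b => h c (!a) b) = Vt h := by
    funext c; simp only [Vt, Bool.not_true, Bool.not_false]
    cases h c true true <;> cases h c true false <;> cases h c false true <;> cases h c false false <;> rfl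
  have eT : Tt (fun c a b => h c (!a) b) = Tt h := by
    funext c; simp only [Tt, Bool.not_true, Bool.not_false]
    cases h c true true <;> cases h c true false <;> cases h c false true <;> cases h c false false <;> rfl
  unfold lab3
  rw [eV, eT]
  by_cases hV : ∃ c, Vt h c = true
  · rw [if_pos hV, if_pos hV]
    have h1 := Classical.epsilon_spec hV
    generalize (Classical.epsilon fun c => Vt h c = true) = c at *
    have h2 := hg.1 c
    revert h1 h2
    simp only [pick, Vt, cA, cB, Bool.not_true, Bool.not_false]
    generalize h c true true = x1
    generalize h c true false = x2
    generalize h c false true = x3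
    generalize h c false false = x4
    intro h1 h2
    cases p <;> cases x1 <;> cases x2 <;> cases x3 <;> cases x4 <;> simp [fl] at h1 h2 ⊢
  · rw [if_neg hV, if_neg hV]
    have h1 := Classical.epsilon_spec hg.2
    generalize (Classical.epsilon fun c => Tt h c = true) = c at *
    have h2 : ¬ Vt h c = true := fun h => hV ⟨c, h⟩
    revert h1 h2
    simp only [Tt, Vt, Bool.not_true, Bool.not_false]
    generalize h c true true = x1
    generalize h c true false = x2
    generalize h c false true = x3
    generalize h c false false = x4
    intro h1 h2
    cases x1 <;> cases x2 <;> cases x3 <;> cases x4 <;> simp [fl] at h1 h2 ⊢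

lemma lab3_sw (h : HH m) (p q : Bool) (hg : good h) (hpq : (∃ c, Vt h c = true) → q = !p) :
    lab3 (fun c a b => h c b a) q = sw (lab3 h p) := by
  have eV : Vt (fun c a b => h c b a) = Vt h := by
    funext c; simp only [Vt]
    cases h c true true <;> cases h c true false <;> cases h c false true <;> cases h c false false <;> rfl
  have eT : Tt (fun c a b => h c b a) = Tt h := by
    funext c; simp only [Tt]
    cases h c true true <;> cases h c true false <;> cases h c false true <;> cases h c false false <;> rfl
  have s0 : swk 0 = 0 := by decide
  have s1 : swk 1 = 2 := by decide
  have s2 : swk 2 = 1 := by decide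
  unfold lab3
  rw [eV, eT]
  by_cases hV : ∃ c, Vt h c = true
  · rw [if_pos hV, if_pos hV]
    obtain rfl := hpq hV
    generalize (Classical.epsilon fun c => Vt h c = true) = c at *
    have h2 := hg.1 c
    revert h2
    simp only [pick, cA, cB]
    generalize h c true true = x1
    generalize h c true false = x2
    generalize h c false true = x3
    generalize h c false false = x4
    intro h2
    cases p <;> cases x1 <;> cases x2 <;> cases x3 <;> cases x4 <;> simp [sw, s1, s2] at h2 ⊢
  · rw [if_neg hV, if_neg hV]
    simp [sw, s0]

def spec (h : HH m) (a : Lab (Fin 3) m) : Prop :=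
  (a.1 = 0 ∧ (∀ c, ¬ Vt h c = true) ∧ Tt h a.2.1 = true ∧ a.2.2 = (h a.2.1 true true || h a.2.1 false false)) ∨
  (a.1 = 1 ∧ cA h a.2.1 a.2.2 = true) ∨ (a.1 = 2 ∧ cB h a.2.1 a.2.2 = true)

lemma lab3_spec (h : HH m) (p : Bool) (hg : good h) : spec h (lab3 h p) := by
  unfold lab3
  by_cases hV : ∃ c, Vt h c = true
  · rw [if_pos hV]
    have h1 := Classical.epsilon_spec hV
    generalize (Classical.epsilon fun c => Vt h c = true) = c at *
    have h2 := hg.1 c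
    right
    revert h1 h2
    have e : ∀ x : Bool, (cA h c x = bif x then (h c true true && h c true false) else
      (h c false true && h c false false)) ∧ (cB h c x = bif x then (h c true true && h c false true) else
      (h c true false && h c false false)) := by intro x; cases x <;> simp [cA, cB]
    have e2 : (pick h p c).2.1 = c := by 
      unfold pick
      cases p <;> cases (cB h c true || cB h c false) <;> cases (cA h c true || cA h c false) <;> rfl
    rw [e2, (e _).1, (e _).2]
    simp only [pick, Vt, cA, cB]
    generalize h c true true = x1
    generalize h c true false = x2
    generalize h c false true = x3
    generalize h c false false = x4
    intro h1 h2
    cases p <;> cases x1 <;> cases x2 <;> cases x3 <;> cases x4 <;> simp at h1 h2 ⊢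
  · rw [if_neg hV]
    have h1 := Classical.epsilon_spec hg.2
    exact Or.inl ⟨rfl, fun c hc => hV ⟨c, hc⟩, h1, rfl⟩

lemma spec_compl {h h' : HH m} (hle : ∀ c a b, h c a b = true → h' c a b = true) (hg : good h')
    {a : Lab (Fin 3) m} (h1 : spec h a.neg) (h2 : spec h' a) : False := by
  obtain ⟨k, c, ε⟩ := a
  have l1 := hle c true true
  have l2 := hle c true false
  have l3 := hle c false true
  have l4 := hle c false false
  have h3 := hg.1 c
  have hV : (∀ c, ¬ Vt h' c = true) → ¬ Vt h' c = true := fun h => h c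
  unfold spec at h1 h2
  simp only [Lab.neg, Vt, Tt] at h1 h2 hV
  rcases h1 with ⟨rfl, h1, h1', h1b⟩ | ⟨rfl, h1⟩ | ⟨rfl, h1⟩
  · rcases h2 with ⟨_, h2, h2', h2b⟩ | ⟨h, _⟩ | ⟨h, _⟩
    · have := h2 c
      revert l1 l2 l3 l4 h1' h1b h2' h2b this
      clear h1 h2 h3 hV hg hle
      generalize h c true true = x1
      generalize h c true false = x2
      generalize h c false true = x3
      generalize h c false false = x4
      generalize h' c true true = y1
      generalize h' c true false = y2
      generalize h' c false true = y3
      generalize h' c false false = y4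
      clear h h'
      intros
      grind
    · exact absurd h (by decide)
    · exact absurd h (by decide)
  · rcases h2 with ⟨h, _⟩ | ⟨_, h2⟩ | ⟨h, _⟩
    · exact absurd h (by decide)
    · cases ε <;> simp_all [cA]
    · exact absurd h (by decide)
  · rcases h2 with ⟨h, _⟩ | ⟨h, _⟩ | ⟨_, h2⟩
    · exact absurd h (by decide)
    · exact absurd h (by decide)
    · cases ε <;> simp_all [cB]

end lab3

section final
variable {n d m : ℕ}

def side (s : Fin (n+1) → SignType) : Bool → Finset (Fin (n+1))
  | true => posS s
  | false => negS s

lemma side_neg (s : Fin (n+1) → SignType) (a : Bool) : side (-s) a = side s (!a) := by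
  cases a
  · exact negS_neg s
  · exact posS_neg s

lemma side_mono {s t : Fin (n+1) → SignType} (h : sLe s t) (a : Bool) : side s a ⊆ side t a := by
  cases a
  · exact negS_mono h
  · exact posS_mono h

lemma side_disj (s : Fin (n+1) → SignType) {a b : Bool} (h : a ≠ b) : Disjoint (side s a) (side s b) := by
  cases a <;> cases b <;> simp at h
  · exact (disj_S s).symm
  · exact disj_S s

open Classical in
noncomputable def hB (F : Finset (Finset (Fin (n + 1)))) (col : Finset (Fin (n+1)) → Fin m)
    (s t : Fin (n+1) → SignType) : HH m :=
  fun c a b => decide (∃ A ∈ F, col A = c ∧ A ⊆ side s a ∩ side t b)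

lemma hB_iff {F : Finset (Finset (Fin (n + 1)))} {col : Finset (Fin (n+1)) → Fin m}
    {s t : Fin (n+1) → SignType} {c a b} :
    hB F col s t c a b = true ↔ ∃ A ∈ F, col A = c ∧ A ⊆ side s a ∩ side t b := by simp [hB]

lemma hB_neg (F : Finset (Finset (Fin (n + 1)))) (col : Finset (Fin (n+1)) → Fin m)
    (s t : Fin (n+1) → SignType) : hB F col (-s) t = fun c a b => hB F col s t c (!a) b := by
  funext c a b
  simp only [hB, side_neg]

lemma hB_sw (F : Finset (Finset (Fin (n + 1)))) (col : Finset (Fin (n+1)) → Fin m)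
    (s t : Fin (n+1) → SignType) : hB F col t s = fun c a b => hB F col s t c b a := by
  funext c a b
  simp only [hB, Finset.inter_comm]

lemma hB_mono {F : Finset (Finset (Fin (n + 1)))} {col : Finset (Fin (n+1)) → Fin m}
    {s s' t t' : Fin (n+1) → SignType} (hs : sLe s s') (ht : sLe t t') (c a b)
    (h : hB F col s t c a b = true) : hB F col s' t' c a b = true := by
  rw [hB_iff] at *
  obtain ⟨A, h1, h2, h3⟩ := h
  exact ⟨A, h1, h2, h3.trans (Finset.inter_subset_inter (side_mono hs a) (side_mono ht b))⟩

lemma hB_diag {F : Finset (Finset (Fin (n + 1)))} (hne : ∀ A ∈ F, A.Nonempty)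
    {col : Finset (Fin (n+1)) → Fin m}
    {s t : Fin (n+1) → SignType} (hs : sLe s t) {c a b} (hab : a ≠ b) : hB F col s t c a b = false := by
  rw [Bool.eq_false_iff]
  intro h
  obtain ⟨A, h1, h2, h3⟩ := hB_iff.1 h
  obtain ⟨x, hx⟩ := hne A h1
  have hx' := Finset.mem_inter.1 (h3 hx)
  exact Finset.disjoint_left.1 (side_disj t hab) (side_mono hs a hx'.1) hx'.2

lemma hB_four {F : Finset (Finset (Fin (n + 1)))} (hne : ∀ A ∈ F, A.Nonempty)
    {col : Finset (Fin (n+1)) → Fin m}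
    (hcol : ∀ G ⊆ F, (∀ A ∈ G, ∀ B ∈ G, A ≠ B → Disjoint A B) →
      (∀ A ∈ G, ∀ B ∈ G, col A = col B) → G.card < 4)
    (s t : Fin (n+1) → SignType) (c : Fin m) (h : ∀ a b, hB F col s t c a b = true) : False := by
  have h' : ∀ ab : Bool × Bool, ∃ A ∈ F, col A = c ∧ A ⊆ side s ab.1 ∩ side t ab.2 := fun ab => hB_iff.1 (h ab.1 ab.2)
  choose A hA hc hsub using h'
  have hd : ∀ x y, x ≠ y → Disjoint (A x) (A y) := by
    intro x y hxy
    rw [Finset.disjoint_left]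
    intro i h1 h2
    have h1 := Finset.mem_inter.1 (hsub x h1)
    have h2 := Finset.mem_inter.1 (hsub y h2)
    by_cases e : x.1 = y.1
    · have e2 : x.2 ≠ y.2 := fun h => hxy (Prod.ext e h)
      exact Finset.disjoint_left.1 (side_disj t e2) h1.2 h2.2
    · exact Finset.disjoint_left.1 (side_disj s e) h1.1 h2.1
  have hinj : Function.Injective A := by
    intro x y hxy
    by_contra hne'
    have := hd x y hne'
    rw [hxy, disjoint_self] at this
    exact (hne _ (hA y)).ne_empty this
  have := hcol (Finset.univ.image A) (by intro B hB; obtain ⟨x, _, rfl⟩ := Finset.mem_image.1 hB; exact hA x)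
    (by
      intro B hB C hC hBC
      obtain ⟨x, _, rfl⟩ := Finset.mem_image.1 hB
      obtain ⟨y, _, rfl⟩ := Finset.mem_image.1 hC
      exact hd x y (fun h => hBC (by rw [h])))
    (by
      intro B hB C hC
      obtain ⟨x, _, rfl⟩ := Finset.mem_image.1 hB
      obtain ⟨y, _, rfl⟩ := Finset.mem_image.1 hC
      rw [hc, hc])
  rw [Finset.card_image_of_injective _ hinj] at this
  simp at this

noncomputable def enc (s : Fin (n+1) → SignType) : ℕ := (Fintype.equivFin (Fin (n+1) → SignType) s : ℕ)

lemma enc_inj {s t : Fin (n+1) → SignType} (h : enc s = enc t) : s = t :=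
  (Fintype.equivFin _).injective (Fin.ext h)

noncomputable def key (s : Fin (n+1) → SignType) : ℕ := min (enc s) (enc (-s))

lemma key_neg (s : Fin (n+1) → SignType) : key (-s) = key s := by
  unfold key; rw [neg_neg, min_comm]

lemma key_eq {s t : Fin (n+1) → SignType} (h : key s = key t) : s = t ∨ -s = t := by
  unfold key at h
  rcases min_choice (enc s) (enc (-s)) with h1 | h1 <;> rcases min_choice (enc t) (enc (-t)) with h2 | h2 <;>
    rw [h1, h2] at h
  · exact Or.inl (enc_inj h)
  · right; rw [enc_inj h, neg_neg]
  · exact Or.inr (enc_inj h)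
  · left; exact neg_injective (enc_inj h)

noncomputable def pref (s t : Fin (n+1) → SignType) : Bool := decide (key s < key t)

end final
end TRP

theorem two_radon_pairs_pow_two (s m d n : ℕ) (hs : 1 ≤ s)
    (hm : m = 2 ^ s) (hd : 1 ≤ d) (hn : d + 3 * 2 ^ (s - 1) + 1 ≤ n)
    (F : Finset (Finset (Fin (n + 1)))) (hne : ∀ A ∈ F, A.Nonempty)
    (hχ : KneserChromaticLe F 4 m)
    (f : (Fin (n + 1) → ℝ) → EuclideanSpace ℝ (Fin d))
    (hf : ContinuousOn f (stdSimplex ℝ (Fin (n + 1)))) :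
    ∃ σp σm τp τm : Finset (Fin (n + 1)),
      IsRadonPair f σp σm ∧ IsRadonPair f τp τm ∧
      (∀ A ∈ F, ¬A ⊆ σp ∩ τp) ∧ (∀ A ∈ F, ¬A ⊆ σp ∩ τm) ∧
      (∀ A ∈ F, ¬A ⊆ σm ∩ τp) ∧ (∀ A ∈ F, ¬A ⊆ σm ∩ τm) := by
  open TRP in
  by_contra hcon
  obtain ⟨col, hcol⟩ := hχ
  have hk : m = 2 * 2 ^ (s - 1) := by
    rw [hm, ← pow_succ']; congr 1; omega
  have hk0 : 1 ≤ 2 ^ (s - 1) := Nat.one_le_two_pow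
  have : Nonempty (Fin m) := ⟨⟨0, by omega⟩⟩
  obtain ⟨w, hw1, hw2, hw3⟩ := radon_system hf (m + 2 ^ (s-1)) (by omega)
  have hgood : ∀ x y : RS f, good (hB F col x.1 y.1) := by
    intro x y
    refine ⟨fun c h => hB_four hne hcol x.1 y.1 c ?_, ?_⟩
    · rintro (_ | _) (_ | _)
      · exact h.2.2.2
      · exact h.2.2.1
      · exact h.2.1
      · exact h.1
    · by_contra hT
      push Not at hT
      have key : ∀ a b, ∀ A ∈ F, ¬ A ⊆ side x.1 a ∩ side y.1 b := by
        intro a b A hA hsub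
        have h1 : hB F col x.1 y.1 (col A) a b = true := hB_iff.2 ⟨A, hA, rfl, hsub⟩
        apply hT (col A)
        unfold Tt
        cases a <;> cases b <;> simp [h1]
      exact hcon ⟨_, _, _, _, x.2, y.2, key true true, key true false, key false true, key false false⟩
  refine stage2 (S := RS f) (ν := RS.ng) (lab := fun x y => lab3 (hB F col x.1 y.1) (pref x.1 y.1))
    s (2 ^ (s-1)) hm hk hk0 ?_ ?_ ?_ ?_ le_rfl hw1 hw2 hw3
  · intro x y
    have e : pref x.ng.1 y.1 = pref x.1 y.1 := by
      show pref (-x.1) y.1 = _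
      unfold pref; rw [key_neg]
    show lab3 (hB F col (-x.1) y.1) (pref x.ng.1 y.1) = _
    rw [e, hB_neg, lab3_fl _ _ (hgood x y)]
  · intro x y
    show lab3 (hB F col y.1 x.1) (pref y.1 x.1) = _
    rw [hB_sw F col x.1 y.1]
    refine lab3_sw _ _ _ (hgood x y) ?_
    rintro ⟨c, hc⟩
    have hkne : key x.1 ≠ key y.1 := by
      intro hk
      rcases key_eq hk with h | h
      · have h1 : hB F col x.1 y.1 c true false = false := hB_diag hne (by rw [h]; exact fun _ _ => rfl) (by decide)
        have h2 : hB F col x.1 y.1 c false true = false := hB_diag hne (by rw [h]; exact fun _ _ => rfl) (by decide)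
        simp [Vt, h1, h2] at hc
      · have h1 : hB F col (-x.1) y.1 c true false = false := hB_diag hne (by rw [h]; exact fun _ _ => rfl) (by decide)
        have h2 : hB F col (-x.1) y.1 c false true = false := hB_diag hne (by rw [h]; exact fun _ _ => rfl) (by decide)
        simp only [hB_neg, Bool.not_true, Bool.not_false] at h1 h2
        simp [Vt, h1, h2] at hc
    unfold pref
    rcases lt_or_gt_of_ne hkne with h | h
    · simp [h, h.le]
    · simp [h, h.le]
  · intro x x' y y' hx hy h
    have s1 := lab3_spec _ (pref x.1 y.1) (hgood x y)
    have s2 := lab3_spec _ (pref x'.1 y'.1) (hgood x' y')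
    beta_reduce at h
    rw [h] at s1
    exact spec_compl (hB_mono hx hy) (hgood x' y') s1 s2
  · intro x y hxy
    have h1 : ∀ c, hB F col x.1 y.1 c true false = false := fun c => hB_diag hne hxy (by decide)
    have h2 : ∀ c, hB F col x.1 y.1 c false true = false := fun c => hB_diag hne hxy (by decide)
    have hV : ¬ ∃ c, Vt (hB F col x.1 y.1) c = true := by
      rintro ⟨c, hc⟩
      simp [Vt, h1, h2] at hc
    have hT := Classical.epsilon_spec (hgood x y).2
    refine ⟨Classical.epsilon (fun c => Tt (hB F col x.1 y.1) c = true), ?_⟩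
    show lab3 _ _ = _
    unfold lab3
    rw [if_neg hV]
    refine Prod.ext rfl (Prod.ext rfl ?_)
    generalize (Classical.epsilon (fun c => Tt (hB F col x.1 y.1) c = true)) = c at *
    simpa [Tt, h1, h2] using hT
end

section
/- Let c ≥ 1, d ≥ 1, k ≥ 1, and m ≥ 1 be integers. Suppose that for every n ≥ d + c + 2 the following holds: for any continuous map f : Δ_{n−1} → ℝ^d and any family F of nonempty subsets of [n] with χ(KG^{2^k}(F)) ≤ 2m, there exist k minimal Radon pairs (σ_1⁺, σ_1⁻), …, (σ_k⁺, σ_k⁻) for f such that for every choice of signs ε ∈ {+,−}^k the intersection σ_1^{ε_1} ∩ ⋯ ∩ σ_k^{ε_k} contains no set from F. Then for every n ≥ d + c + 2 the following holds: for any continuous map f : Δ_{n−1} → ℝ^d and any family F of nonempty subsets of [n] with χ(KG^{2^{k+1}}(F)) ≤ m, there exist k+1 minimal Radon pairs (σ_1⁺, σ_1⁻), …, (σ_{k+1}⁺, σ_{k+1}⁻) for f such that for every choice of signs ε ∈ {+,−}^{k+1} the intersection σ_1^{ε_1} ∩ ⋯ ∩ σ_{k+1}^{ε_{k+1}} contains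 no set from F. -/
/-- A minimal Radon pair: a Radon pair such that the image of neither face meets the image
of any proper subface of the other. -/
def IsMinimalRadonPair {n d : ℕ} (f : (Fin n → ℝ) → EuclideanSpace ℝ (Fin d))
    (σp σm : Finset (Fin n)) : Prop :=
  IsRadonPair f σp σm ∧
    (∀ τ : Finset (Fin n), τ ⊂ σm → f '' simplexFace σp ∩ f '' simplexFace τ = ∅) ∧
    (∀ τ : Finset (Fin n), τ ⊂ σp → f '' simplexFace τ ∩ f '' simplexFace σm = ∅)

set_option linter.unusedSectionVars false

namespace BU
variable {E : Type*}

/-- coboundary (augmented, mod 2) on functions of lists -/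
def dd : (List E → ZMod 2) → List E → ZMod 2
  | _, [] => 0
  | φ, v :: l => φ l + dd (fun l' => φ (v :: l')) l

theorem dd_congr (l : List E) : ∀ (φ ψ : List E → ZMod 2),
    (∀ l', l'.length + 1 = l.length → φ l' = ψ l') → dd φ l = dd ψ l := by
  induction l with
  | nil => intros; rfl
  | cons v l ih =>
    intro φ ψ h
    simp only [dd]
    rw [h l (by simp), ih _ (fun l' => ψ (v :: l'))]
    intro l' hl'
    exact h _ (by simp [hl'])

theorem dd_add (l : List E) : ∀ (φ ψ : List E → ZMod 2),
    dd (fun l => φ l + ψ l) l = dd φ l + dd ψ l := by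
  induction l with
  | nil => intros; simp [dd]
  | cons v l ih => intro φ ψ; simp only [dd, ih]; ring

theorem dd_smul (c : ZMod 2) (l : List E) : ∀ (φ : List E → ZMod 2),
    dd (fun l => c * φ l) l = c * dd φ l := by
  induction l with
  | nil => intros; simp [dd]
  | cons v l ih => intro φ; simp only [dd, ih]; ring

theorem z2 (a : ZMod 2) : a + a = 0 := CharTwo.add_self_eq_zero a

theorem dd_dd (l : List E) : ∀ (φ : List E → ZMod 2), dd (dd φ) l = 0 := by
  induction l with
  | nil => intros; simp [dd]
  | cons v l ih =>
    intro φ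
    simp only [dd, dd_add, ih]
    rw [add_zero, z2]

theorem dd_zero (l : List E) : dd (fun _ => 0) l = 0 := by
  induction l with
  | nil => rfl
  | cons v l ih => simp [dd, ih]

theorem dd_map (g : E → E) (l : List E) : ∀ (φ : List E → ZMod 2),
    dd (fun l => φ (l.map g)) l = dd φ (l.map g) := by
  induction l with
  | nil => intros; simp [dd]
  | cons v l ih =>
    intro φ
    simp only [dd, List.map_cons]
    rw [ih (fun l => φ (g v :: l))]

theorem dd_ne_zero (l : List E) : ∀ (φ : List E → ZMod 2), dd φ l ≠ 0 →
    ∃ l', l'.Sublist l ∧ l'.length + 1 = l.length ∧ φ l' ≠ 0 := by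
  induction l with
  | nil => intro φ h; exact absurd rfl h
  | cons v l ih =>
    intro φ h
    simp only [dd] at h
    by_cases h1 : φ l = 0
    · rw [h1, zero_add] at h
      obtain ⟨l', a, b, c⟩ := ih _ h
      exact ⟨v :: l', a.cons_cons v, by simp [b], c⟩
    · exact ⟨l, List.sublist_cons_self v l, by simp, h1⟩

variable [NormedAddCommGroup E] [NormedSpace ℝ E]

/-- barycenter -/
noncomputable def bary (l : List E) : E := (l.length : ℝ)⁻¹ • l.sum

theorem bary_neg (l : List E) : bary (l.map (fun x => -x)) = - bary l := by
  have h : (l.map (fun x => -x)).sum = - l.sum := by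
    induction l with
    | nil => simp
    | cons v l ih => simp only [List.map_cons, List.sum_cons, ih]; abel
  simp only [bary, List.length_map, h, smul_neg]

/-- dual of barycentric subdivision on lists of length `k` -/
noncomputable def sd : ℕ → (List E → ZMod 2) → List E → ZMod 2
  | 0, φ, l => φ l
  | k + 1, φ, l => dd (sd k (fun l' => φ (bary l :: l'))) l

noncomputable def TT (φ : List E → ZMod 2) (l : List E) : ZMod 2 := sd l.length φ l

theorem sd_add (k : ℕ) : ∀ (φ ψ : List E → ZMod 2) (l : List E),
    sd k (fun l => φ l + ψ l) l = sd k φ l + sd k ψ l := by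
  induction k with
  | zero => intros; rfl
  | succ k ih =>
    intro φ ψ l
    simp only [sd]
    rw [← dd_add]
    congr 1
    funext l'
    exact ih _ _ _

theorem sd_neg (k : ℕ) : ∀ (φ : List E → ZMod 2) (l : List E),
    sd k (fun l => φ (l.map (fun x => -x))) l = sd k φ (l.map (fun x => -x)) := by
  induction k with
  | zero => intros; rfl
  | succ k ih =>
    intro φ l
    simp only [sd]
    rw [bary_neg, ← dd_map]
    congr 1
    funext l'
    rw [← ih]
    rfl

theorem sd_dd (k : ℕ) : ∀ (φ : List E → ZMod 2) (l : List E), l.length = k + 1 →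
    sd (k + 1) (dd φ) l = dd (sd k φ) l := by
  induction k with
  | zero =>
    intro φ l hl
    match l, hl with
    | [v], _ => simp [sd, dd]
  | succ k ih =>
    intro φ l hl
    rw [sd]
    simp only [dd]
    have : sd (k+1) (fun l' => φ l' + dd (fun l'' => φ (bary l :: l'')) l') =
       fun l' => sd (k+1) φ l' + sd (k+1) (dd (fun l'' => φ (bary l :: l''))) l' := by
      funext l'
      exact sd_add _ _ _ _
    rw [this, dd_add]
    rw [dd_congr l (sd (k+1) (dd (fun l'' => φ (bary l :: l'')))) (dd (sd k (fun l'' => φ (bary l :: l''))))]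
    · rw [dd_dd, add_zero]
    · intro l' hl'
      exact ih _ _ (by omega)

theorem TT_dd (φ : List E → ZMod 2) : TT (dd φ) = dd (TT φ) := by
  funext l
  unfold TT
  cases l with
  | nil => simp [sd, dd]
  | cons v l =>
    rw [List.length_cons, sd_dd _ _ _ (by simp)]
    apply dd_congr
    intro l' hl'
    simp at hl'
    rw [hl']

theorem TT_add (φ ψ : List E → ZMod 2) : TT (φ + ψ) = TT φ + TT ψ := by
  funext l; exact sd_add _ _ _ _

theorem TT_neg (φ : List E → ZMod 2) :
    TT (fun l => φ (l.map (fun x => -x))) = fun l => TT φ (l.map (fun x => -x)) := by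
  funext l
  simp only [TT, List.length_map]
  exact sd_neg _ _ _

theorem TT_single (φ : List E → ZMod 2) (e : E) : TT φ [e] = φ [e] := by
  simp [TT, sd, dd, bary]

theorem TTN_dd (N : ℕ) (φ : List E → ZMod 2) : TT^[N] (dd φ) = dd (TT^[N] φ) := by
  induction N generalizing φ with
  | zero => rfl
  | succ N ih => rw [Function.iterate_succ_apply, Function.iterate_succ_apply, TT_dd, ih]

theorem TTN_add (N : ℕ) (φ ψ : List E → ZMod 2) :
    TT^[N] (φ + ψ) = TT^[N] φ + TT^[N] ψ := by
  induction N generalizing φ ψ with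
  | zero => rfl
  | succ N ih => simp only [Function.iterate_succ_apply, TT_add, ih]

theorem TTN_neg (N : ℕ) (φ : List E → ZMod 2) :
    TT^[N] (fun l => φ (l.map (fun x => -x))) = fun l => TT^[N] φ (l.map (fun x => -x)) := by
  induction N generalizing φ with
  | zero => rfl
  | succ N ih => simp only [Function.iterate_succ_apply, TT_neg, ih]

theorem TTN_single (N : ℕ) (φ : List E → ZMod 2) (e : E) : TT^[N] φ [e] = φ [e] := by
  induction N generalizing φ with
  | zero => rfl
  | succ N ih => simp only [Function.iterate_succ_apply, TT_single, ih]

def Small (D : ℝ) (l : List E) : Prop := ∀ x ∈ l, ∀ y ∈ l, dist x y ≤ D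

theorem sum_sub_norm (v : E) (D : ℝ) (l : List E) (h : ∀ x ∈ l, dist x v ≤ D) :
    ‖l.sum - (l.length : ℝ) • v‖ ≤ l.length * D := by
  induction l with
  | nil => simp
  | cons x l ih =>
    have h1 := ih (fun y hy => h y (by simp [hy]))
    have h2 := h x (by simp)
    rw [dist_eq_norm] at h2
    have : (x :: l).sum - ((x :: l).length : ℝ) • v = (x - v) + (l.sum - (l.length : ℝ) • v) := by
      simp [add_smul]; abel
    rw [this]
    refine (norm_add_le _ _).trans ?_
    push_cast [List.length_cons]
    linarith

theorem bary_dist (l : List E) (D : ℝ) (n : ℕ) (hn : l.length ≤ n + 1) (h : Small D l) (v : E)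
    (hv : v ∈ l) : dist (bary l) v ≤ (n / (n + 1) : ℝ) * D := by
  obtain ⟨l1, l2, rfl⟩ := List.append_of_mem hv
  have hD : 0 ≤ D := by simpa using h v hv v hv
  have h0 := sum_sub_norm v D (l1 ++ l2) (fun x hx => h x (by
    simp only [List.mem_append, List.mem_cons] at hx ⊢; tauto) v hv)
  set k := (l1 ++ l2).length with hk
  have hlen : (l1 ++ v :: l2).length = k + 1 := by simp [hk]; omega
  have hk1 : (0 : ℝ) < (k : ℝ) + 1 := by positivity
  have : bary (l1 ++ v :: l2) - v = ((k : ℝ) + 1)⁻¹ • ((l1 ++ l2).sum - (k : ℝ) • v) := by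
    rw [bary, hlen]
    push_cast
    rw [← sub_eq_zero]
    have : v = ((k : ℝ) + 1)⁻¹ • (((k : ℝ) + 1) • v) := by
      rw [smul_smul, inv_mul_cancel₀ hk1.ne', one_smul]
    nth_rewrite 2 [this]
    rw [← smul_sub, ← smul_sub]
    convert smul_zero _
    simp [add_smul]
    abel
  rw [dist_eq_norm, this, norm_smul, norm_inv, Real.norm_of_nonneg hk1.le]
  have hkn : (k : ℝ) ≤ n := by
    have : k ≤ n := by omega
    exact_mod_cast this
  calc ((k : ℝ) + 1)⁻¹ * ‖(l1 ++ l2).sum - (k : ℝ) • v‖ ≤ ((k : ℝ) + 1)⁻¹ * (k * D) := by gcongr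
    _ = (k / (k + 1) : ℝ) * D := by field_simp
    _ ≤ _ := by
      gcongr ?_ * D
      rw [div_le_div_iff₀ hk1 (by positivity)]
      nlinarith

theorem bary_mem (l : List E) (hl : l ≠ []) : bary l ∈ convexHull ℝ {x | x ∈ l} := by
  have key : ∀ (C : Set E), Convex ℝ C → ∀ l : List E, l ≠ [] → (∀ x ∈ l, x ∈ C) → bary l ∈ C := by
    intro C hC l
    induction l with
    | nil => intro h; exact absurd rfl h
    | cons v l ih =>
      intro _ h
      by_cases hl : l = []
      · subst hl; simpa [bary] using h
      have h1 := ih hl (fun x hx => h x (by simp [hx]))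
      have h2 := h v (by simp)
      have hp : (0 : ℝ) < l.length := by
        have := List.length_pos_iff.2 hl
        exact_mod_cast this
      have := hC h2 h1 (a := ((l.length : ℝ) + 1)⁻¹) (b := ((l.length : ℝ) + 1)⁻¹ * l.length)
        (by positivity) (by positivity) (by field_simp; ring)
      convert this using 1
      simp only [bary, List.length_cons, List.sum_cons, smul_add, smul_smul]
      push_cast
      rw [mul_assoc, mul_inv_cancel₀ hp.ne', mul_one]
  exact key _ (convex_convexHull ℝ _) l hl (fun x hx => subset_convexHull ℝ _ hx)

theorem sd_ne_zero (n : ℕ) (D : ℝ) (k : ℕ) : ∀ (φ : List E → ZMod 2) (l : List E), l.length = k →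
    k ≤ n + 1 → Small D l → sd k φ l ≠ 0 →
    ∃ l', l'.length = k ∧ (∀ x ∈ l', x ∈ convexHull ℝ {x | x ∈ l}) ∧
      Small ((n / (n + 1) : ℝ) * D) l' ∧ φ l' ≠ 0 := by
  induction k with
  | zero =>
    intro φ l hl _ _ h
    have : l = [] := List.length_eq_zero_iff.1 hl
    subst this
    exact ⟨[], rfl, by simp, by simp [Small], h⟩
  | succ k ih =>
    intro φ l hl hk hs h
    have hne : l ≠ [] := by rintro rfl; simp at hl
    obtain ⟨l1, h1, h2, h3⟩ := dd_ne_zero l _ h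
    obtain ⟨l2, g1, g2, g3, g4⟩ := ih _ l1 (by omega) (by omega)
      (fun x hx y hy => hs x (h1.subset hx) y (h1.subset hy)) h3
    have hsub : ∀ x ∈ l2, x ∈ convexHull ℝ {x | x ∈ l} := fun x hx =>
      convexHull_mono (fun y hy => h1.subset hy) (g2 x hx)
    have hd : ∀ x ∈ convexHull ℝ {x | x ∈ l}, dist x (bary l) ≤ (n / (n + 1) : ℝ) * D := by
      intro x hx
      have : convexHull ℝ {x | x ∈ l} ⊆ Metric.closedBall (bary l) ((n / (n + 1) : ℝ) * D) := by
        apply convexHull_min _ (convex_closedBall _ _)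
        intro v hv
        rw [Metric.mem_closedBall, dist_comm]
        exact bary_dist l D n (by omega) hs v hv
      exact this hx
    refine ⟨bary l :: l2, by simp [g1], ?_, ?_, g4⟩
    · intro x hx
      rcases List.mem_cons.1 hx with rfl | hx
      · exact bary_mem l hne
      · exact hsub x hx
    · intro x hx y hy
      rcases List.mem_cons.1 hx with rfl | hx <;> rcases List.mem_cons.1 hy with rfl | hy
      · exact hd _ (bary_mem l hne)
      · rw [dist_comm]; exact hd _ (hsub y hy)
      · exact hd _ (hsub x hx)
      · exact g3 x hx y hy

theorem TTN_ne_zero (n : ℕ) (N : ℕ) : ∀ (D : ℝ) (φ : List E → ZMod 2) (l : List E),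
    l.length ≤ n + 1 → Small D l → TT^[N] φ l ≠ 0 →
    ∃ l', l'.length = l.length ∧ (∀ x ∈ l', x ∈ convexHull ℝ {x | x ∈ l}) ∧
      Small ((n / (n + 1) : ℝ) ^ N * D) l' ∧ φ l' ≠ 0 := by
  induction N with
  | zero =>
    intro D φ l hl hs h
    exact ⟨l, rfl, fun x hx => subset_convexHull ℝ _ hx, by simpa using hs, h⟩
  | succ N ih =>
    intro D φ l hl hs h
    rw [Function.iterate_succ_apply'] at h
    obtain ⟨l1, a1, a2, a3, a4⟩ := sd_ne_zero n D _ _ l rfl hl hs h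
    obtain ⟨l2, b1, b2, b3, b4⟩ := ih _ φ l1 (by omega) a3 a4
    refine ⟨l2, by omega, ?_, ?_, b4⟩
    · intro x hx
      exact convexHull_min (fun y hy => a2 y hy) (convex_convexHull ℝ _) (b2 x hx)
    · convert b3 using 1; ring

/-- sum over all sign choices -/
def BB : List E → (List E → ZMod 2) → ZMod 2
  | [], φ => φ []
  | e :: es, φ => BB es (fun l => φ (e :: l)) + BB es (fun l => φ ((-e) :: l))

def HH (e : E) (es : List E) (φ : List E → ZMod 2) : ZMod 2 := BB es (fun l => φ (e :: l))

theorem BB_add (es : List E) : ∀ φ ψ : List E → ZMod 2,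
    BB es (fun l => φ l + ψ l) = BB es φ + BB es ψ := by
  induction es with
  | nil => intros; rfl
  | cons e es ih => intro φ ψ; simp only [BB, ih]; ring

theorem BB_dd (es : List E) : ∀ φ : List E → ZMod 2, BB es (dd φ) = 0 := by
  induction es with
  | nil => intros; rfl
  | cons e es ih =>
    intro φ
    simp only [BB, dd, BB_add]
    rw [ih (fun l => φ (e :: l)), ih (fun l => φ (-e :: l)), add_zero, z2]

theorem BB_neg (es : List E) : ∀ φ : List E → ZMod 2,
    BB es (fun l => φ (l.map (fun x => -x))) = BB es φ := by
  induction es with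
  | nil => intros; rfl
  | cons e es ih =>
    intro φ
    simp only [BB, List.map_cons, neg_neg]
    rw [ih (fun l => φ (e :: l)), ih (fun l => φ (-e :: l)), add_comm]

theorem HH_dd (e e' : E) (es : List E) (φ : List E → ZMod 2) :
    HH e (e' :: es) (dd φ) = HH e' es (fun l => φ l + φ (l.map (fun x => -x))) := by
  unfold HH
  simp only [dd]
  rw [BB_add, BB_dd, add_zero, BB, BB_add]
  congr 1
  simp only [List.map_cons]
  exact (BB_neg es (fun l => φ (-e' :: l))).symm

/-- `l` is a signed version of `es` -/
def Signed (l es : List E) : Prop := List.Forall₂ (fun x e => x = e ∨ x = -e) l es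

theorem BB_ne_zero (es : List E) : ∀ φ : List E → ZMod 2, BB es φ ≠ 0 →
    ∃ l, Signed l es ∧ φ l ≠ 0 := by
  induction es with
  | nil => intro φ h; exact ⟨[], List.Forall₂.nil, h⟩
  | cons e es ih =>
    intro φ h
    simp only [BB] at h
    by_cases h1 : BB es (fun l => φ (e :: l)) = 0
    · rw [h1, zero_add] at h
      obtain ⟨l, a, b⟩ := ih _ h
      exact ⟨-e :: l, List.Forall₂.cons (Or.inr rfl) a, b⟩
    · obtain ⟨l, a, b⟩ := ih _ h1
      exact ⟨e :: l, List.Forall₂.cons (Or.inl rfl) a, b⟩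

theorem HH_ne_zero (e : E) (es : List E) (φ : List E → ZMod 2) (h : HH e es φ ≠ 0) :
    ∃ l, Signed l (e :: es) ∧ φ l ≠ 0 := by
  obtain ⟨l, a, b⟩ := BB_ne_zero es _ h
  exact ⟨e :: l, List.Forall₂.cons (Or.inl rfl) a, b⟩

def lcup (s : E → ZMod 2) (ψ : List E → ZMod 2) : List E → ZMod 2
  | [] => 0
  | u :: l => s u * ψ (u :: l)

def WW : List (E → ZMod 2) → List E → ZMod 2
  | [] => fun l => if l.length = 1 then 1 else 0
  | s :: ss => dd (lcup s (WW ss))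

theorem dd_WW (ss : List (E → ZMod 2)) (l : List E) : dd (WW ss) l = 0 := by
  cases ss with
  | cons s ss => exact dd_dd _ _
  | nil =>
    match l with
    | [] => rfl
    | [v] => simp [dd, WW]
    | [u, v] => simp [dd, WW]; decide
    | u :: v :: w :: l =>
      simp only [WW]
      rw [dd_congr _ _ (fun _ => 0), dd_zero]
      intro l' hl'
      simp at hl' ⊢
      omega

theorem WW_cons (s : E → ZMod 2) (ss : List (E → ZMod 2)) (u v : E) (l : List E) :
    WW (s :: ss) (u :: v :: l) = (s u + s v) * WW ss (v :: l) := by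
  have h := dd_WW ss (u :: v :: l)
  rw [dd] at h
  rw [WW, dd]
  simp only [lcup]
  rw [dd_smul]
  have : dd (fun l' => WW ss (u :: l')) (v :: l) = WW ss (v :: l) := by
    rw [← sub_eq_zero, sub_eq_add_neg, CharTwo.neg_eq, add_comm]; exact h
  rw [this]; ring

theorem WW_single (s : E → ZMod 2) (ss : List (E → ZMod 2)) (u : E) : WW (s :: ss) [u] = 0 := by
  simp [WW, dd, lcup]

theorem WW_change (ss : List (E → ZMod 2)) : ∀ l : List E, l ≠ [] → WW ss l ≠ 0 →
    ∀ s ∈ ss, ∃ u ∈ l, ∃ v ∈ l, s u ≠ s v := by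
  induction ss with
  | nil => simp
  | cons s ss ih =>
    intro l hne hl t ht
    match l, hne with
    | [u], _ => exact absurd (WW_single s ss u) hl
    | u :: v :: l, _ =>
      rw [WW_cons] at hl
      rcases List.mem_cons.1 ht with rfl | ht
      · refine ⟨u, by simp, v, by simp, fun h => hl ?_⟩
        rw [h, z2, zero_mul]
      · obtain ⟨x, hx, y, hy, hxy⟩ := ih (v :: l) (by simp) (right_ne_zero_of_mul hl) t ht
        exact ⟨x, List.mem_cons_of_mem _ hx, y, List.mem_cons_of_mem _ hy, hxy⟩

/-- antisymmetry of `s` on `K` -/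
def Anti (K : Set E) (s : E → ZMod 2) : Prop := ∀ x ∈ K, s (-x) = s x + 1

theorem WW_neg (K : Set E) (ss : List (E → ZMod 2)) (hss : ∀ s ∈ ss, Anti K s) :
    ∀ l : List E, l ≠ [] → (∀ x ∈ l, x ∈ K) → WW ss (l.map (fun x => -x)) = WW ss l := by
  induction ss with
  | nil => intros; simp [WW]
  | cons s ss ih =>
    intro l hne hl
    match l, hne with
    | [u], _ => simp [WW_single]
    | u :: v :: l, _ =>
      have := ih (fun s hs => hss s (by simp [hs])) (v :: l) (by simp)
        (fun x hx => hl x (List.mem_cons_of_mem _ hx))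
      simp only [List.map_cons] at this ⊢
      rw [WW_cons, WW_cons, this, hss s (by simp) u (hl u (by simp)),
        hss s (by simp) v (hl v (by simp))]
      congr 1
      have : (1 : ZMod 2) + 1 = 0 := z2 1
      linear_combination this

theorem main_odd (N : ℕ) (K : Set E) (ss : List (E → ZMod 2)) : ∀ (e : E) (es : List E),
    (∀ s ∈ ss, Anti K s) → es.length = ss.length →
    (∀ l, Signed l (e :: es) → convexHull ℝ {x | x ∈ l} ⊆ K) →
    HH e es (TT^[N] (WW ss)) = 1 := by
  induction ss with
  | nil =>
    intro e es _ hl _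
    have : es = [] := by simpa using hl
    subst this
    simp [HH, BB, TTN_single, WW]
  | cons s ss ih =>
    intro e es hss hl hK
    match es, hl with
    | e' :: es, hl =>
    have hK' : ∀ l, Signed l (e' :: es) → convexHull ℝ {x | x ∈ l} ⊆ K := by
      intro l hl
      refine subset_trans (convexHull_mono ?_) (hK (e :: l) (List.Forall₂.cons (Or.inl rfl) hl))
      intro x hx
      exact List.mem_cons_of_mem _ hx
    have h1 := ih e' es (fun s hs => hss s (by simp [hs])) (by simpa using hl) hK'
    rw [WW, TTN_dd, HH_dd]
    rw [← h1]
    set ψ := lcup s (WW ss) with hψ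
    have e1 : (fun l => TT^[N] ψ l + TT^[N] ψ (l.map (fun x => -x))) =
        TT^[N] (ψ + fun l => ψ (l.map (fun x => -x))) := by
      rw [TTN_add, TTN_neg]; rfl
    rw [e1]
    by_contra hne
    have e2 : HH e' es (TT^[N] ((ψ + fun l => ψ (l.map (fun x => -x))) + WW ss)) ≠ 0 := by
      rw [TTN_add]
      intro h0
      apply hne
      have : HH e' es (TT^[N] (ψ + fun l => ψ (l.map (fun x => -x)))) + HH e' es (TT^[N] (WW ss)) = 0 := by
        rw [← h0]; exact (BB_add _ _ _).symm
      rw [← sub_eq_zero, sub_eq_add_neg, CharTwo.neg_eq]; exact this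
    obtain ⟨l, hls, hl0⟩ := HH_ne_zero _ _ _ e2
    obtain ⟨D, hD⟩ : ∃ D, Small D l := by
      obtain ⟨D, hD⟩ := (l.finite_toSet.isBounded).subset_closedBall (0 : E)
      refine ⟨D + D, fun x hx y hy => ?_⟩
      have := hD hx; have h2 := hD hy
      rw [Metric.mem_closedBall] at this h2
      exact (dist_triangle_right x y 0).trans (by linarith)
    obtain ⟨l', b1, b2, -, b4⟩ := TTN_ne_zero l.length N D _ l (by omega) hD hl0
    have hl'K : ∀ x ∈ l', x ∈ K := fun x hx => hK' l hls (b2 x hx)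
    have hlen : l.length = es.length + 1 := by simpa using hls.length_eq
    have hne' : l' ≠ [] := by rintro rfl; simp at b1; omega
    apply b4
    have hw := WW_neg K ss (fun s hs => hss s (by simp [hs])) l' hne' hl'K
    match l', hne' with
    | u :: l', _ =>
      simp only [Pi.add_apply, hψ, lcup, List.map_cons] at hw ⊢
      rw [hw, hss s (by simp) u (hl'K u (by simp))]
      linear_combination (s u) * z2 (WW ss (u :: l')) + z2 (WW ss (u :: l'))

end BU

namespace BU

/-- the boundary of the cross polytope -/
def KK (n : ℕ) : Set (Fin n → ℝ) := {x | ∑ i, |x i| = 1}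

theorem KK_compact (n : ℕ) : IsCompact (KK n) := by
  apply Metric.isCompact_of_isClosed_isBounded
  · exact isClosed_eq (by fun_prop) continuous_const
  · refine (Metric.isBounded_closedBall (x := (0 : Fin n → ℝ)) (r := 1)).subset ?_
    intro x hx
    rw [mem_closedBall_zero_iff, pi_norm_le_iff_of_nonneg zero_le_one]
    intro i
    rw [Real.norm_eq_abs]
    have hx' : ∑ i, |x i| = 1 := hx
    rw [← hx']
    exact Finset.single_le_sum (f := fun i => |x i|) (fun i _ => abs_nonneg _) (Finset.mem_univ i)

theorem hull_KK (n k : ℕ) (hk : k ≤ n) (l : List (Fin n → ℝ))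
    (hl : Signed l (List.ofFn (fun j : Fin k => Pi.single (Fin.castLE hk j) (1 : ℝ)))) :
    convexHull ℝ {x | x ∈ l} ⊆ KK n := by
  have h1 : ∀ j : Fin k, ∃ ε : ℝ, (ε = 1 ∨ ε = -1) ∧
      ∀ h : (j : ℕ) < l.length, l[(j : ℕ)] = Pi.single (Fin.castLE hk j) ε := by
    intro j
    have hlen : l.length = k := by simpa using hl.length_eq
    have := (List.forall₂_iff_get.1 hl).2 j (by omega) (by simp)
    simp only [List.get_eq_getElem, List.getElem_ofFn, Fin.eta] at this
    rcases this with h | h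
    · exact ⟨1, Or.inl rfl, fun _ => h⟩
    · refine ⟨-1, Or.inr rfl, fun _ => ?_⟩
      rw [h, ← Pi.single_neg]
  choose ε hε1 hε2 using h1
  have hlen : l.length = k := by simpa using hl.length_eq
  let δ : Fin n → ℝ := fun i => if h : (i : ℕ) < k then ε ⟨i, h⟩ else 1
  have hδ : ∀ i, δ i = 1 ∨ δ i = -1 := by
    intro i
    by_cases h : (i : ℕ) < k
    · simp only [δ, h, dif_pos]; exact hε1 _
    · simp [δ, h]
  have hC : Convex ℝ {x : Fin n → ℝ | (∀ i, 0 ≤ δ i * x i) ∧ ∑ i, δ i * x i = 1} := by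
    intro x hx y hy a b ha hb hab
    refine ⟨fun i => ?_, ?_⟩
    · have e : δ i * (a • x + b • y) i = a * (δ i * x i) + b * (δ i * y i) := by
        simp; ring
      rw [e]
      exact add_nonneg (mul_nonneg ha (hx.1 i)) (mul_nonneg hb (hy.1 i))
    · have e : ∀ i, δ i * (a • x + b • y) i = a * (δ i * x i) + b * (δ i * y i) := by
        intro i; simp; ring
      simp only [e, Finset.sum_add_distrib, ← Finset.mul_sum]
      rw [hx.2, hy.2]; simpa using hab
  refine subset_trans (convexHull_min ?_ hC) ?_
  · intro x hx
    obtain ⟨j, hj, rfl⟩ := List.getElem_of_mem hx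
    have := hε2 ⟨j, by omega⟩ hj
    simp only at this
    rw [this]
    have hd : δ (Fin.castLE hk ⟨j, by omega⟩) = ε ⟨j, by omega⟩ := by
      have : j < k := by omega
      simp [δ, this]
    have hsq : ε ⟨j, by omega⟩ * ε ⟨j, by omega⟩ = 1 := by
      rcases hε1 ⟨j, by omega⟩ with h | h <;> rw [h] <;> norm_num
    refine ⟨fun i => ?_, ?_⟩
    · by_cases h : i = Fin.castLE hk ⟨j, by omega⟩
      · rw [h, hd, Pi.single_eq_same, hsq]; exact zero_le_one
      · rw [Pi.single_eq_of_ne h, mul_zero]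
    · rw [Finset.sum_eq_single (Fin.castLE hk ⟨j, by omega⟩)]
      · rw [hd, Pi.single_eq_same, hsq]
      · intro i _ h
        rw [Pi.single_eq_of_ne h, mul_zero]
      · simp
  · intro x hx
    show ∑ i, |x i| = 1
    rw [← hx.2]
    refine Finset.sum_congr rfl fun i _ => ?_
    have h := hx.1 i
    rw [← abs_of_nonneg h, abs_mul]
    rcases hδ i with h | h <;> rw [h] <;> simp

open Classical in
/-- antisymmetric sign of `g` -/
noncomputable def sg {n : ℕ} (g : (Fin n → ℝ) → ℝ) (x : Fin n → ℝ) : ZMod 2 :=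
  if 0 < g x ∨ (g x = 0 ∧ WellOrderingRel x (-x)) then 1 else 0

theorem sg_anti {n : ℕ} (g : (Fin n → ℝ) → ℝ) (hg : ∀ x, g (-x) = - g x) : Anti (KK n) (sg g) := by
  intro x hx
  have hne : x ≠ -x := by
    intro h
    have h0 : ∀ i, x i = 0 := by
      intro i
      have := congrFun h i
      simp at this
      linarith
    have hx' : ∑ i, |x i| = 1 := hx
    simp [h0] at hx'
  have h11 : (1 : ZMod 2) + 1 = 0 := z2 1
  unfold sg
  rw [hg, neg_neg]
  rcases lt_trichotomy (g x) 0 with h | h | h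
  · rw [if_pos (Or.inl (by linarith)), if_neg (by rintro (h' | h') <;> linarith [h'])]; simp
  · rcases trichotomous_of WellOrderingRel x (-x) with h1 | h1 | h1
    · have : ¬ WellOrderingRel (-x) x := fun h2 => asymm_of WellOrderingRel h1 h2
      simp [h, h1, this, h11]
    · exact absurd h1 hne
    · have : ¬ WellOrderingRel x (-x) := fun h2 => asymm_of WellOrderingRel h1 h2
      simp [h, h1, this]
  · rw [if_neg (by rintro (h' | h') <;> linarith [h']), if_pos (Or.inl h), h11]

theorem sg_ne {n : ℕ} (g : (Fin n → ℝ) → ℝ) (x y : Fin n → ℝ) (h : sg g x ≠ sg g y) :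
    ¬ (0 < g x ∧ 0 < g y) ∧ ¬ (g x < 0 ∧ g y < 0) := by
  constructor
  · rintro ⟨h1, h2⟩
    apply h
    simp [sg, h1, h2]
  · rintro ⟨h1, h2⟩
    apply h
    simp [sg, h1.ne, h2.ne, h1.le.not_gt, h2.le.not_gt]

theorem small_exists {n : ℕ} {ι : Type*} [Fintype ι] (hn : Fintype.card ι + 1 ≤ n)
    (g : ι → (Fin n → ℝ) → ℝ) (hg : ∀ i x, g i (-x) = - g i x) (r : ℝ) (hr : 0 < r) :
    ∃ l : List (Fin n → ℝ), l ≠ [] ∧ Small r l ∧ (∀ x ∈ l, x ∈ KK n) ∧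
      ∀ i, ∃ u ∈ l, ∃ v ∈ l, sg (g i) u ≠ sg (g i) v := by
  set ss : List ((Fin n → ℝ) → ZMod 2) := (Finset.univ : Finset ι).toList.map (fun i => sg (g i))
  have hssl : ss.length = Fintype.card ι := by simp [ss]
  have hss : ∀ s ∈ ss, Anti (KK n) s := by
    intro s hs
    simp only [ss, List.mem_map] at hs
    obtain ⟨i, -, rfl⟩ := hs
    exact sg_anti _ (hg i)
  set b : Fin (Fintype.card ι + 1) → (Fin n → ℝ) := fun j => Pi.single (Fin.castLE hn j) (1 : ℝ) with hb
  have hlist : List.ofFn b = b 0 :: List.ofFn (fun j => b j.succ) := List.ofFn_succ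
  have hK : ∀ l, Signed l (b 0 :: List.ofFn (fun j => b j.succ)) →
      convexHull ℝ {x | x ∈ l} ⊆ KK n := by
    intro l hl
    rw [← hlist] at hl
    exact hull_KK n _ hn l hl
  obtain ⟨N, hN⟩ := exists_pow_lt_of_lt_one (y := ((n : ℝ) / (n + 1))) (x := r / 2)
    (by positivity) (by rw [div_lt_one (by positivity)]; linarith)
  have h1 := main_odd N (KK n) ss (b 0) (List.ofFn (fun j => b j.succ)) hss (by simp [hssl]) hK
  obtain ⟨l, hl1, hl2⟩ := HH_ne_zero _ _ _ (by rw [h1]; exact one_ne_zero)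
  have hlen : l.length = Fintype.card ι + 1 := by simpa using hl1.length_eq
  have hKl : ∀ x ∈ KK n, ‖x‖ ≤ 1 := by
    intro x hx
    rw [pi_norm_le_iff_of_nonneg zero_le_one]
    intro i
    rw [Real.norm_eq_abs]
    have hx' : ∑ i, |x i| = 1 := hx
    rw [← hx']
    exact Finset.single_le_sum (f := fun i => |x i|) (fun i _ => abs_nonneg _) (Finset.mem_univ i)
  have hS : Small 2 l := by
    intro x hx y hy
    have h1 := hKl x (hK l hl1 (subset_convexHull ℝ _ hx))
    have h2 := hKl y (hK l hl1 (subset_convexHull ℝ _ hy))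
    rw [dist_eq_norm]
    exact (norm_sub_le _ _).trans (by linarith)
  obtain ⟨l', b1, b2, b3, b4⟩ := TTN_ne_zero n N 2 _ l (by omega) hS hl2
  have hne : l' ≠ [] := by rintro rfl; simp at b1; omega
  refine ⟨l', hne, fun x hx y hy => (b3 x hx y hy).trans (by linarith), fun x hx => hK l hl1 (b2 x hx), ?_⟩
  intro i
  exact WW_change ss l' hne b4 _ (List.mem_map.2 ⟨i, by simp, rfl⟩)

/-- Borsuk-Ulam -/
theorem borsuk_ulam {n : ℕ} {ι : Type*} [Fintype ι] (hn : Fintype.card ι + 1 ≤ n)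
    (g : ι → (Fin n → ℝ) → ℝ) (hg : ∀ i x, g i (-x) = - g i x) :
    ∃ x ∈ KK n, ∀ i, ContinuousAt (g i) x → g i x = 0 := by
  by_contra hcon
  push Not at hcon
  have h1 : ∀ x ∈ KK n, ∃ U : Set (Fin n → ℝ), IsOpen U ∧ x ∈ U ∧
      ∃ i, (∀ y ∈ U, 0 < g i y) ∨ (∀ y ∈ U, g i y < 0) := by
    intro x hx
    obtain ⟨i, hc, h0⟩ := hcon x hx
    rcases lt_or_gt_of_ne h0 with h | h
    · have := hc.eventually (gt_mem_nhds h)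
      obtain ⟨U, h1, h2, h3⟩ := eventually_nhds_iff.1 this
      exact ⟨U, h2, h3, i, Or.inr h1⟩
    · have := hc.eventually (lt_mem_nhds h)
      obtain ⟨U, h1, h2, h3⟩ := eventually_nhds_iff.1 this
      exact ⟨U, h2, h3, i, Or.inl h1⟩
  choose! U hU1 hU2 hU3 using h1
  obtain ⟨r, hr, hr2⟩ := lebesgue_number_lemma_of_metric (s := KK n) (c := fun x : KK n => U x)
    (KK_compact n) (fun x => hU1 x x.2) (fun x hx => Set.mem_iUnion.2 ⟨⟨x, hx⟩, hU2 x hx⟩)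
  obtain ⟨l, hne, hs, hlK, hl⟩ := small_exists hn g hg (r / 2) (by positivity)
  obtain ⟨x, hx⟩ := List.exists_mem_of_ne_nil l hne
  obtain ⟨y, hy⟩ := hr2 x (hlK x hx)
  have hin : ∀ z ∈ l, z ∈ U y := by
    intro z hz
    apply hy
    rw [Metric.mem_ball]
    exact (hs z hz x hx).trans_lt (by linarith)
  obtain ⟨i, hi⟩ := hU3 y y.2
  obtain ⟨u, hu, v, hv, huv⟩ := hl i
  have := sg_ne _ _ _ huv
  rcases hi with hi | hi
  · exact this.1 ⟨hi u (hin u hu), hi v (hin v hv)⟩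
  · exact this.2 ⟨hi u (hin u hu), hi v (hin v hv)⟩

end BU

namespace BU

theorem exists_minimal {n d : ℕ} (f : (Fin n → ℝ) → EuclideanSpace ℝ (Fin d)) (N : ℕ) :
    ∀ σp σm : Finset (Fin n), σp.card + σm.card = N → IsRadonPair f σp σm →
    ∃ τp τm, τp ⊆ σp ∧ τm ⊆ σm ∧ IsMinimalRadonPair f τp τm := by
  induction N using Nat.strong_induction_on with
  | _ N ih =>
  intro σp σm hN hR
  by_cases hmin : IsMinimalRadonPair f σp σm
  · exact ⟨σp, σm, subset_rfl, subset_rfl, hmin⟩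
  have : (∃ τ : Finset (Fin n), τ ⊂ σm ∧ (f '' simplexFace σp ∩ f '' simplexFace τ).Nonempty) ∨
      (∃ τ : Finset (Fin n), τ ⊂ σp ∧ (f '' simplexFace τ ∩ f '' simplexFace σm).Nonempty) := by
    by_contra hcon
    push Not at hcon
    exact hmin ⟨hR, hcon.1, hcon.2⟩
  rcases this with ⟨τ, h1, h2⟩ | ⟨τ, h1, h2⟩
  · have hc := Finset.card_lt_card h1
    obtain ⟨a, b, ha, hb, hab⟩ := ih _ (by omega) σp τ rfl ⟨hR.1.mono_right h1.1, h2⟩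
    exact ⟨a, b, ha, hb.trans h1.1, hab⟩
  · have hc := Finset.card_lt_card h1
    obtain ⟨a, b, ha, hb, hab⟩ := ih _ (by omega) τ σm rfl ⟨hR.1.mono_left h1.1, h2⟩
    exact ⟨a, b, ha.trans h1.1, hb, hab⟩

def pp {n : ℕ} (x : Fin n → ℝ) : Fin n → ℝ := fun i => max (x i) 0

noncomputable def nrm {n : ℕ} (x : Fin n → ℝ) : Fin n → ℝ := (∑ i, pp x i)⁻¹ • pp x

theorem pp_cont {n : ℕ} : Continuous (pp : (Fin n → ℝ) → Fin n → ℝ) := by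
  unfold pp; fun_prop

theorem pp_nonneg {n : ℕ} (x : Fin n → ℝ) (i : Fin n) : 0 ≤ pp x i := le_max_right _ _

theorem nrm_mem {n : ℕ} (x : Fin n → ℝ) (h : 0 < ∑ i, pp x i) : nrm x ∈ stdSimplex ℝ (Fin n) := by
  refine ⟨fun i => ?_, ?_⟩
  · exact mul_nonneg (inv_nonneg.2 h.le) (pp_nonneg x i)
  · simp only [nrm, Pi.smul_apply, smul_eq_mul, ← Finset.mul_sum]
    exact inv_mul_cancel₀ h.ne'

theorem fnrm_cont {n : ℕ} {Y : Type*} [TopologicalSpace Y] (f : (Fin n → ℝ) → Y)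
    (hf : ContinuousOn f (stdSimplex ℝ (Fin n))) (x : Fin n → ℝ) (h : 0 < ∑ i, pp x i) :
    ContinuousAt (fun y => f (nrm y)) x := by
  have hs : Continuous (fun y : Fin n → ℝ => ∑ i, pp y i) :=
    continuous_finsetSum _ fun i _ => (continuous_apply i).comp pp_cont
  have h1 : ContinuousAt (nrm : (Fin n → ℝ) → _) x := by
    unfold nrm
    exact (hs.continuousAt.inv₀ h.ne').smul pp_cont.continuousAt
  have h2 : Filter.Tendsto (nrm : (Fin n → ℝ) → _) (nhds x)
      (nhdsWithin (nrm x) (stdSimplex ℝ (Fin n))) := by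
    rw [tendsto_nhdsWithin_iff]
    refine ⟨h1, ?_⟩
    filter_upwards [hs.continuousAt.eventually (lt_mem_nhds h)] with y hy
    exact nrm_mem y hy
  exact (hf _ (nrm_mem x h)).tendsto.comp h2

theorem sarkaria {n d m : ℕ} (hn : d + m + 2 ≤ n) (f : (Fin n → ℝ) → EuclideanSpace ℝ (Fin d))
    (hf : ContinuousOn f (stdSimplex ℝ (Fin n))) (R : Finset (Finset (Fin n)))
    (hR : ∀ A ∈ R, A.Nonempty) (hK : KneserChromaticLe R 2 m) :
    ∃ σp σm, IsMinimalRadonPair f σp σm ∧ ∀ A ∈ R, ¬ A ⊆ σp ∧ ¬ A ⊆ σm := by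
  obtain ⟨col, hcol⟩ := hK
  have hcol' : ∀ A ∈ R, ∀ B ∈ R, col A = col B → ¬ Disjoint A B := by
    intro A hA B hB hAB hdis
    have hne : A ≠ B := by
      rintro rfl
      obtain ⟨a, ha⟩ := hR A hA
      exact Finset.disjoint_left.1 hdis ha ha
    have := hcol {A, B} (by intro X; simp; rintro (rfl | rfl) <;> assumption)
      (by
        intro X hX Y hY hXY
        simp at hX hY
        rcases hX with rfl | rfl <;> rcases hY with rfl | rfl
        · exact absurd rfl hXY
        · exact hdis
        · exact hdis.symm
        · exact absurd rfl hXY)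
      (by
        intro X hX Y hY
        simp at hX hY
        rcases hX with rfl | rfl <;> rcases hY with rfl | rfl <;> simp [hAB])
    rw [Finset.card_pair hne] at this
    omega
  let φ : Fin m → (Fin n → ℝ) → ℝ := fun i x => ∑ A ∈ R with col A = i, ∏ a ∈ A, pp x a
  have hφc : ∀ i, Continuous (φ i) := fun i =>
    continuous_finsetSum _ fun A _ => continuous_finsetProd _ fun a _ =>
      (continuous_apply a).comp pp_cont
  have hφ0 : ∀ i x, 0 ≤ φ i x := fun i x =>
    Finset.sum_nonneg fun A _ => Finset.prod_nonneg fun a _ => pp_nonneg x a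
  have hpp : ∀ (x : Fin n → ℝ) a, 0 < pp x a ↔ 0 < x a := by
    intro x a; simp [pp]
  have hφ1 : ∀ x, ∀ A ∈ R, (∀ a ∈ A, 0 < x a) → 0 < φ (col A) x := by
    intro x A hA h
    refine Finset.sum_pos' (fun B _ => Finset.prod_nonneg fun a _ => pp_nonneg x a)
      ⟨A, by simp [hA], Finset.prod_pos fun a ha => (hpp x a).2 (h a ha)⟩
  have hφ2 : ∀ i x, 0 < φ i x → ∃ B ∈ R, col B = i ∧ ∀ a ∈ B, 0 < x a := by
    intro i x h
    obtain ⟨B, hB, hB'⟩ := Finset.exists_ne_zero_of_sum_ne_zero h.ne'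
    simp at hB
    refine ⟨B, hB.1, hB.2, fun a ha => ?_⟩
    rw [Finset.prod_ne_zero_iff] at hB'
    exact (hpp x a).1 (lt_of_le_of_ne (pp_nonneg x a) (hB' a ha).symm)
  have key : ∀ x, ∀ A ∈ R, (∀ a ∈ A, 0 < x a) → φ (col A) x - φ (col A) (-x) ≠ 0 := by
    intro x A hA h h0
    have h1 := hφ1 x A hA h
    obtain ⟨B, hB, hc, hB'⟩ := hφ2 (col A) (-x) (by linarith)
    refine hcol' A hA B hB hc.symm (Finset.disjoint_left.2 fun a ha hb => ?_)
    have h2 := h a ha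
    have h3 := hB' a hb
    simp at h3
    linarith
  let g : (Unit ⊕ Fin d) ⊕ Fin m → (Fin n → ℝ) → ℝ := fun t x => match t with
    | Sum.inl (Sum.inl _) => ∑ i, x i
    | Sum.inl (Sum.inr j) => f (nrm x) j - f (nrm (-x)) j
    | Sum.inr i => φ i x - φ i (-x)
  have hg : ∀ i x, g i (-x) = - g i x := by
    rintro ((_ | j) | i) x
    · simp [g]
    · simp [g]
    · simp [g]
  obtain ⟨x, hxK, hx⟩ := borsuk_ulam (by simp; omega) g hg
  have hxK' : ∑ i, |x i| = 1 := hxK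
  have h1 : ∑ i, x i = 0 := hx (Sum.inl (Sum.inl ())) (by
    have : Continuous (fun x : Fin n → ℝ => ∑ i, x i) := by fun_prop
    exact this.continuousAt)
  have hpos : ∀ y : Fin n → ℝ, ∑ i, |y i| = 1 → ∑ i, y i = 0 → 0 < ∑ i, pp y i := by
    intro y a b
    have : ∑ i, pp y i = (∑ i, |y i| + ∑ i, y i) / 2 := by
      rw [← Finset.sum_add_distrib, Finset.sum_div]
      refine Finset.sum_congr rfl fun i _ => ?_
      simp only [pp]
      rcases le_total (y i) 0 with h | h
      · rw [max_eq_right h, abs_of_nonpos h]; ring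
      · rw [max_eq_left h, abs_of_nonneg h]; ring
    rw [this, a, b]; norm_num
  have hp1 := hpos x hxK' h1
  have hp2 := hpos (-x) (by simpa using hxK') (by simpa using h1)
  have h2 : f (nrm x) = f (nrm (-x)) := by
    ext j
    have hc : ContinuousAt (g (Sum.inl (Sum.inr j))) x := by
      have hproj : Continuous (fun y : EuclideanSpace ℝ (Fin d) => y j) := by fun_prop
      have c1 := fnrm_cont f hf x hp1
      have c2 : ContinuousAt (fun y => f (nrm (-y))) x :=
        ContinuousAt.comp (f := fun y : Fin n → ℝ => -y) (g := fun y => f (nrm y))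
          (fnrm_cont f hf (-x) hp2) continuous_neg.continuousAt
      exact (hproj.continuousAt.comp c1).sub (hproj.continuousAt.comp c2)
    have := hx (Sum.inl (Sum.inr j)) hc
    simp only [g] at this
    linarith
  have h3 : ∀ i, φ i x - φ i (-x) = 0 := fun i => hx (Sum.inr i) (by
    have : Continuous (fun x => φ i x - φ i (-x)) := (hφc i).sub ((hφc i).comp continuous_neg)
    exact this.continuousAt)
  have hface : ∀ y : Fin n → ℝ, 0 < ∑ i, pp y i →
      nrm y ∈ simplexFace (Finset.univ.filter fun i => 0 < y i) := by
    intro y hy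
    refine ⟨nrm_mem y hy, fun i hi => ?_⟩
    simp at hi
    simp [nrm, pp, hi]
  obtain ⟨τp, τm, a1, a2, a3⟩ := exists_minimal f _ (Finset.univ.filter fun i => 0 < x i)
    (Finset.univ.filter fun i => 0 < (-x) i) rfl ⟨by
      rw [Finset.disjoint_left]
      intro i hi hj
      simp at hi hj
      linarith, f (nrm x), ⟨_, hface x hp1, rfl⟩, ⟨_, hface (-x) hp2, h2.symm⟩⟩
  refine ⟨τp, τm, a3, fun A hA => ⟨fun h => ?_, fun h => ?_⟩⟩
  · exact key x A hA (fun a ha => (Finset.mem_filter.1 (a1 (h ha))).2) (h3 _)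
  · refine key (-x) A hA (fun a ha => (Finset.mem_filter.1 (a2 (h ha))).2) ?_
    rw [neg_neg]
    have := h3 (col A)
    linarith

theorem exists_col {α : Type*} [DecidableEq α] (V : Finset α) (M q : ℕ) (hM : 1 ≤ M) (hq : 1 ≤ q)
    (hV : V.card ≤ M * q) : ∃ e : α → Fin M, ∀ y, (V.filter (fun v => e v = y)).card ≤ q := by
  obtain ⟨idx, hi1, hi2⟩ : ∃ idx : α → ℕ, Set.InjOn idx V ∧ ∀ v, idx v / q < M := by
    refine ⟨fun v => if h : v ∈ V then V.equivFin ⟨v, h⟩ else 0, ?_, ?_⟩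
    · intro a ha b hb hab
      have ha' : a ∈ V := ha
      have hb' : b ∈ V := hb
      simp only [ha', hb', dif_pos] at hab
      have := V.equivFin.injective (Fin.ext hab)
      simpa using this
    · intro v
      by_cases h : v ∈ V
      · simp only [h, dif_pos]
        rw [Nat.div_lt_iff_lt_mul (by omega)]
        exact lt_of_lt_of_le (V.equivFin ⟨v, h⟩).2 hV
      · simp [h]; omega
  refine ⟨fun v => ⟨idx v / q, hi2 v⟩, fun y => ?_⟩
  have : (V.filter (fun v => (⟨idx v / q, hi2 v⟩ : Fin M) = y)).card ≤
      (Finset.Ico ((y : ℕ) * q) (y * q + q)).card := by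
    apply Finset.card_le_card_of_injOn idx
    · intro v hv
      simp at hv
      have := hv.2
      have h2 : idx v / q = y := by rw [← this]
      have h3 := Nat.div_add_mod (idx v) q
      have h4 := Nat.mod_lt (idx v) (show q > 0 by omega)
      rw [h2, mul_comm] at h3
      simp
      omega
    · intro a ha b hb hab
      simp at ha hb
      exact hi1 ha.1 hb.1 hab
  simpa using this

theorem singles_kneser {n : ℕ} (V : Finset (Fin n)) (M r : ℕ) (hM : 1 ≤ M) (hr : 2 ≤ r)
    (hV : V.card ≤ M * (r - 1)) : KneserChromaticLe (V.image (fun v => {v})) r M := by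
  obtain ⟨e, he⟩ := exists_col V M (r - 1) hM (by omega) hV
  refine ⟨fun A => if h : A.Nonempty then e (A.min' h) else ⟨0, hM⟩, fun G hG _ hc => ?_⟩
  rcases G.eq_empty_or_nonempty with rfl | ⟨A, hA⟩
  · simp; omega
  obtain ⟨a, ha, rfl⟩ := Finset.mem_image.1 (hG hA)
  have : G ⊆ (V.filter (fun v => e v = e a)).image (fun v => {v}) := by
    intro B hB
    obtain ⟨b, hb, rfl⟩ := Finset.mem_image.1 (hG hB)
    have := hc _ hB _ hA
    simp at this
    exact Finset.mem_image.2 ⟨b, by simp [hb, this], rfl⟩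
  have h1 := (Finset.card_le_card this).trans Finset.card_image_le
  have := he (e a)
  omega

/-- Radon pair avoiding a set of vertices -/
theorem radon_avoid {n d : ℕ} (f : (Fin n → ℝ) → EuclideanSpace ℝ (Fin d))
    (hf : ContinuousOn f (stdSimplex ℝ (Fin n))) (T : Finset (Fin n)) (M : ℕ) (hM : 1 ≤ M)
    (hn : d + M + 2 ≤ n) (hT : T.card ≤ M) :
    ∃ σp σm, IsMinimalRadonPair f σp σm ∧ ∀ t ∈ T, t ∉ σp ∧ t ∉ σm := by
  obtain ⟨σp, σm, h1, h2⟩ := sarkaria hn f hf (T.image (fun v => {v}))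
    (by intro A hA; obtain ⟨a, _, rfl⟩ := Finset.mem_image.1 hA; simp)
    (singles_kneser T M 2 hM le_rfl (by omega))
  refine ⟨σp, σm, h1, fun t ht => ?_⟩
  have := h2 {t} (Finset.mem_image_of_mem _ ht)
  simpa using this

noncomputable def mom (n d : ℕ) (x : Fin n → ℝ) : EuclideanSpace ℝ (Fin d) :=
  WithLp.toLp 2 (fun j : Fin d => ∑ i, x i * ((i : ℕ) : ℝ) ^ ((j : ℕ) + 1))

theorem mom_cont (n d : ℕ) : Continuous (mom n d) := by
  unfold mom
  exact (PiLp.continuous_toLp 2 _).comp (by fun_prop)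

theorem mom_radon (n d : ℕ) (σp σm : Finset (Fin n)) (h : IsRadonPair (mom n d) σp σm) :
    d + 2 ≤ (σp ∪ σm).card := by
  obtain ⟨hdis, y, ⟨a, ha, hay⟩, ⟨b, hb, hby⟩⟩ := h
  by_contra hcon
  have hab : mom n d a = mom n d b := hay.trans hby.symm
  have h0 : ∀ j < d + 1, ∑ i, (a i - b i) * ((i : ℕ) : ℝ) ^ j = 0 := by
    intro j hj
    simp only [sub_mul, Finset.sum_sub_distrib]
    rcases j with _ | j
    · simp [ha.1.2, hb.1.2]
    · have := congrArg (fun v : EuclideanSpace ℝ (Fin d) => v ⟨j, by omega⟩) hab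
      simp only [mom] at this
      linarith
  have hP : ∀ P : Polynomial ℝ, P.natDegree < d + 1 →
      ∑ i : Fin n, (a i - b i) * P.eval ((i : ℕ) : ℝ) = 0 := by
    intro P hP
    simp only [Polynomial.eval_eq_sum_range' hP, Finset.mul_sum]
    rw [Finset.sum_comm]
    refine Finset.sum_eq_zero fun j hj => ?_
    have := h0 j (Finset.mem_range.1 hj)
    calc _ = P.coeff j * ∑ i : Fin n, (a i - b i) * ((i : ℕ) : ℝ) ^ j := by
          rw [Finset.mul_sum]; refine Finset.sum_congr rfl fun i _ => by ring
      _ = 0 := by rw [this, mul_zero]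
  obtain ⟨i, -, hi⟩ : ∃ i ∈ Finset.univ, a i ≠ 0 :=
    Finset.exists_ne_zero_of_sum_ne_zero (by rw [ha.1.2]; exact one_ne_zero)
  have hip : i ∈ σp := by
    by_contra h
    exact hi (ha.2 i h)
  have hbi : b i = 0 := hb.2 i (Finset.disjoint_left.1 hdis hip)
  have hiU : i ∈ σp ∪ σm := Finset.mem_union_left _ hip
  let P : Polynomial ℝ := ∏ j ∈ (σp ∪ σm).erase i, (Polynomial.X - Polynomial.C ((j : ℕ) : ℝ))
  have hdeg : P.natDegree < d + 1 := by
    have : P.natDegree = ((σp ∪ σm).erase i).card := by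
      simp only [P]
      rw [Polynomial.natDegree_prod_of_monic _ _ (fun j _ => Polynomial.monic_X_sub_C _)]
      simp only [Polynomial.natDegree_X_sub_C, Finset.sum_const, smul_eq_mul, mul_one]
    rw [this, Finset.card_erase_of_mem hiU]
    have := Finset.card_pos.2 ⟨i, hiU⟩
    omega
  have h1 := hP P hdeg
  rw [Finset.sum_eq_single i] at h1
  · rw [hbi, sub_zero] at h1
    rcases mul_eq_zero.1 h1 with h | h
    · exact hi h
    · simp only [P, Polynomial.eval_prod] at h
      rw [Finset.prod_eq_zero_iff] at h
      obtain ⟨j, hj, hj'⟩ := h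
      simp [sub_eq_zero] at hj'
      exact (Finset.mem_erase.1 hj).1 (Fin.ext hj'.symm)
  · intro j _ hj
    by_cases hjU : j ∈ σp ∪ σm
    · have : P.eval ((j : ℕ) : ℝ) = 0 := by
        simp only [P, Polynomial.eval_prod]
        exact Finset.prod_eq_zero (Finset.mem_erase.2 ⟨hj, hjU⟩) (by simp)
      rw [this, mul_zero]
    · rw [Finset.mem_union, not_or] at hjU
      rw [ha.2 j hjU.1, hb.2 j hjU.2]; simp
  · simp

theorem m_le_c (c d k m : ℕ) (hk : 1 ≤ k) (hm : 1 ≤ m) (hkc : k * c < d + 2)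
    (hyp : ∀ f : (Fin (d + c + 2) → ℝ) → EuclideanSpace ℝ (Fin d),
        ContinuousOn f (stdSimplex ℝ (Fin (d + c + 2))) →
      ∀ F : Finset (Finset (Fin (d + c + 2))), (∀ A ∈ F, A.Nonempty) →
        KneserChromaticLe F (2 ^ k) (2 * m) →
        ∃ σp σm : Fin k → Finset (Fin (d + c + 2)),
          (∀ j, IsMinimalRadonPair f (σp j) (σm j)) ∧
          ∀ ε : Fin k → Bool, ∀ A ∈ F,
            ¬A ⊆ Finset.univ.inf (fun j => if ε j then σp j else σm j)) : m ≤ c := by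
  by_contra hmc
  obtain ⟨S, -, hS⟩ := Finset.exists_subset_card_eq
    (s := (Finset.univ : Finset (Fin (d + c + 2)))) (n := k * c + 1) (by simp; omega)
  have hk2 : k < 2 ^ k := Nat.lt_two_pow_self
  obtain ⟨σp, σm, h1, h2⟩ := hyp (mom _ d) (mom_cont _ d).continuousOn (S.image (fun v => {v}))
    (by intro A hA; obtain ⟨a, _, rfl⟩ := Finset.mem_image.1 hA; simp)
    (singles_kneser S (2 * m) (2 ^ k) (by omega) (by omega) (by
      rw [hS]
      have e1 : (2 * (c + 1)) * k ≤ (2 * m) * (2 ^ k - 1) :=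
        Nat.mul_le_mul (by omega) (by omega)
      nlinarith))
  have hsub : S ⊆ Finset.univ.biUnion (fun j => (σp j ∪ σm j)ᶜ) := by
    intro v hv
    by_contra hcon
    simp at hcon
    refine h2 (fun j => decide (v ∈ σp j)) {v} (Finset.mem_image_of_mem _ hv) ?_
    rw [← Finset.le_iff_subset, Finset.le_inf_iff]
    intro j _
    by_cases hj : v ∈ σp j
    · simp [hj]
    · simp only [hj, decide_false]
      simpa using hcon j hj
  have hcard : (Finset.univ.biUnion (fun j => (σp j ∪ σm j)ᶜ)).card ≤ (Finset.univ : Finset (Fin k)).card * c := by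
    apply Finset.card_biUnion_le_card_mul
    intro j _
    have := mom_radon _ _ _ _ (h1 j).1
    rw [Finset.card_compl, Fintype.card_fin]
    omega
  have := Finset.card_le_card hsub
  rw [Finset.card_univ, Fintype.card_fin] at hcard
  omega

end BU

/-- **Topological reduction for multiple Radon pairs.** If for every `n ≥ d + c + 2`, every
continuous `f : Δ_{n-1} → ℝ^d` together with any family of nonempty subsets of `[n]` with
`χ(KG^(2^k)) ≤ 2m` admits `k` minimal Radon pairs avoiding the family on all
sign-intersections, then for every `n ≥ d + c + 2`, every continuous `f : Δ_{n-1} → ℝ^d`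
together with any family of nonempty subsets of `[n]` with `χ(KG^(2^(k+1))) ≤ m` admits
`k+1` minimal Radon pairs avoiding the family on all sign-intersections. -/
theorem radon_pair_reduction (c d k m : ℕ) (hc : 1 ≤ c) (hd : 1 ≤ d) (hk : 1 ≤ k)
    (hm : 1 ≤ m)
    (hyp : ∀ n : ℕ, d + c + 2 ≤ n →
      ∀ f : (Fin n → ℝ) → EuclideanSpace ℝ (Fin d),
        ContinuousOn f (stdSimplex ℝ (Fin n)) →
      ∀ F : Finset (Finset (Fin n)), (∀ A ∈ F, A.Nonempty) →
        KneserChromaticLe F (2 ^ k) (2 * m) →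
        ∃ σp σm : Fin k → Finset (Fin n),
          (∀ j, IsMinimalRadonPair f (σp j) (σm j)) ∧
          ∀ ε : Fin k → Bool, ∀ A ∈ F,
            ¬A ⊆ Finset.univ.inf (fun j => if ε j then σp j else σm j)) :
    ∀ n : ℕ, d + c + 2 ≤ n →
      ∀ f : (Fin n → ℝ) → EuclideanSpace ℝ (Fin d),
        ContinuousOn f (stdSimplex ℝ (Fin n)) →
      ∀ F : Finset (Finset (Fin n)), (∀ A ∈ F, A.Nonempty) →
        KneserChromaticLe F (2 ^ (k + 1)) m →
        ∃ σp σm : Fin (k + 1) → Finset (Fin n),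
          (∀ j, IsMinimalRadonPair f (σp j) (σm j)) ∧
          ∀ ε : Fin (k + 1) → Bool, ∀ A ∈ F,
            ¬A ⊆ Finset.univ.inf (fun j => if ε j then σp j else σm j) := by
  intro n hn f hf F hF hFK
  by_cases hkc : k * c < d + 2
  · -- main case: here `m ≤ c`
    have hmc : m ≤ c := BU.m_le_c c d k m hk hm hkc (hyp (d + c + 2) le_rfl)
    obtain ⟨col, hcol⟩ := hFK
    -- `S` is rich in color `i` if it contains `2 ^ k` disjoint members of color `i`
    let Rich : Fin m → Finset (Fin n) → Prop := fun i S => ∃ G ⊆ F,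
      (∀ A ∈ G, ∀ B ∈ G, A ≠ B → Disjoint A B) ∧ (∀ A ∈ G, col A = i) ∧ G.card = 2 ^ k ∧
      ∀ A ∈ G, A ⊆ S
    classical
    let R : Finset (Finset (Fin n)) := Finset.univ.filter (fun S => ∃ i, Rich i S)
    have hRK : KneserChromaticLe R 2 m := by
      refine ⟨fun S => if h : ∃ i, Rich i S then h.choose else ⟨0, hm⟩, ?_⟩
      intro G hG hdis hc
      by_contra hcard
      obtain ⟨S, hS, S', hS', hne⟩ := Finset.one_lt_card.1 (show 1 < G.card by omega)
      have r1 : ∃ i, Rich i S := (Finset.mem_filter.1 (hG hS)).2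
      have r2 : ∃ i, Rich i S' := (Finset.mem_filter.1 (hG hS')).2
      have hcc := hc S hS S' hS'
      simp only [r1, r2, dif_pos] at hcc
      obtain ⟨G1, a1, a2, a3, a4, a5⟩ := r1.choose_spec
      obtain ⟨G2, b1, b2, b3, b4, b5⟩ := r2.choose_spec
      have hSS := hdis S hS S' hS' hne
      have hAB : ∀ A ∈ G1, ∀ B ∈ G2, Disjoint A B := fun A hA B hB =>
        Finset.disjoint_of_subset_left (a5 A hA) (Finset.disjoint_of_subset_right (b5 B hB) hSS)
      have hdisG : Disjoint G1 G2 := by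
        rw [Finset.disjoint_left]
        intro A hA hA'
        obtain ⟨x, hx⟩ := hF A (a1 hA)
        exact Finset.disjoint_left.1 (hAB A hA A hA') hx hx
      have hu : ∀ A ∈ G1 ∪ G2, col A = r1.choose := by
        intro A hA
        rcases Finset.mem_union.1 hA with h | h
        · exact a3 A h
        · rw [b3 A h, hcc]
      have := hcol (G1 ∪ G2) (Finset.union_subset a1 b1) (by
        intro A hA B hB hAB'
        rcases Finset.mem_union.1 hA with h | h <;> rcases Finset.mem_union.1 hB with h' | h'
        · exact a2 A h B h' hAB'
        · exact hAB A h B h'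
        · exact (hAB B h' A h).symm
        · exact b2 A h B h' hAB') (fun A hA B hB => by rw [hu A hA, hu B hB])
      rw [Finset.card_union_of_disjoint hdisG, a4, b4, pow_succ] at this
      omega
    obtain ⟨τp, τm, hτ, hτR⟩ := BU.sarkaria (show d + m + 2 ≤ n by omega) f hf R (by
      intro S hS
      obtain ⟨i, G, h1, -, -, h4, h5⟩ := (Finset.mem_filter.1 hS).2
      obtain ⟨A, hA⟩ := Finset.card_pos.1 (show 0 < G.card by rw [h4]; positivity)
      exact (hF A (h1 hA)).mono (h5 A hA)) hRK
    have hp : ¬ ∃ i, Rich i τp := fun h => (hτR τp (by simp [R, h])).1 subset_rfl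
    have hq : ¬ ∃ i, Rich i τm := fun h => (hτR τm (by simp [R, h])).2 subset_rfl
    obtain ⟨σp, σm, h1, h2⟩ := hyp n hn f hf (F.filter (fun A => A ⊆ τp ∨ A ⊆ τm))
      (fun A hA => hF A (Finset.mem_filter.1 hA).1) (by
        refine ⟨fun A => finProdFinEquiv ((if A ⊆ τp then 0 else 1 : Fin 2), col A), ?_⟩
        intro G hG hdis hc
        by_contra hcard
        obtain ⟨G', hG', hG'c⟩ := Finset.exists_subset_card_eq (show 2 ^ k ≤ G.card by omega)
        obtain ⟨A, hA⟩ := Finset.card_pos.1 (show 0 < G'.card by rw [hG'c]; positivity)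
        have hc' : ∀ B ∈ G', (if B ⊆ τp then 0 else 1 : Fin 2) = (if A ⊆ τp then 0 else 1 : Fin 2)
            ∧ col B = col A := by
          intro B hB
          have := finProdFinEquiv.injective (hc B (hG' hB) A (hG' hA))
          exact Prod.mk.inj this
        by_cases hAp : A ⊆ τp
        · refine hp ⟨col A, G', fun B hB => (Finset.mem_filter.1 (hG (hG' hB))).1,
            fun B hB C hC => hdis B (hG' hB) C (hG' hC), fun B hB => (hc' B hB).2, hG'c, ?_⟩
          intro B hB
          by_contra hBp
          have := (hc' B hB).1
          simp [hAp, hBp] at this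
        · refine hq ⟨col A, G', fun B hB => (Finset.mem_filter.1 (hG (hG' hB))).1,
            fun B hB C hC => hdis B (hG' hB) C (hG' hC), fun B hB => (hc' B hB).2, hG'c, ?_⟩
          intro B hB
          have hBp : ¬ B ⊆ τp := by
            intro hBp
            have := (hc' B hB).1
            simp [hAp, hBp] at this
          exact (Finset.mem_filter.1 (hG (hG' hB))).2.resolve_left hBp)
    refine ⟨Fin.cons τp σp, Fin.cons τm σm, fun j => ?_, ?_⟩
    · refine Fin.cases ?_ (fun j => ?_) j
      · simpa using hτ
      · simpa using h1 j
    · intro ε A hA hsub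
      rw [← Finset.le_iff_subset, Finset.le_inf_iff] at hsub
      have h0 := hsub 0 (Finset.mem_univ _)
      simp only [Fin.cons_zero] at h0
      refine h2 (fun j => ε j.succ) A (Finset.mem_filter.2 ⟨hA, ?_⟩) ?_
      · cases hε : ε 0
        · right; simpa [hε] using h0
        · left; simpa [hε] using h0
      · rw [← Finset.le_iff_subset, Finset.le_inf_iff]
        intro j _
        have := hsub j.succ (Finset.mem_univ _)
        simpa using this
  · -- easy case: `k + 1` Radon pairs with no common vertex
    obtain ⟨V, -, hV⟩ := Finset.exists_subset_card_eq
      (s := (Finset.univ : Finset (Fin n))) (n := d + 2) (by simp; omega)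
    obtain ⟨e, he⟩ := BU.exists_col V k c hk hc (by omega)
    obtain ⟨τp, τm, hτ, hτV⟩ := BU.radon_avoid f hf Vᶜ (n - d - 2) (by omega) (by omega)
      (by rw [Finset.card_compl, Fintype.card_fin]; omega)
    have hj : ∀ j : Fin k, ∃ σ : Finset (Fin n) × Finset (Fin n), IsMinimalRadonPair f σ.1 σ.2 ∧
        ∀ t ∈ V.filter (fun v => e v = j), t ∉ σ.1 ∧ t ∉ σ.2 := by
      intro j
      obtain ⟨a, b, h⟩ := BU.radon_avoid f hf (V.filter (fun v => e v = j)) c hc hn (he j)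
      exact ⟨(a, b), h⟩
    choose σ hσ1 hσ2 using hj
    refine ⟨Fin.cons τp (fun j => (σ j).1), Fin.cons τm (fun j => (σ j).2), fun j => ?_, ?_⟩
    · refine Fin.cases ?_ (fun j => ?_) j
      · simpa using hτ
      · simpa using hσ1 j
    · intro ε A hA hsub
      rw [← Finset.le_iff_subset, Finset.le_inf_iff] at hsub
      obtain ⟨x, hx⟩ := hF A hA
      have h0 := hsub 0 (Finset.mem_univ _) hx
      have hxV : x ∈ V := by
        by_contra hxV
        have := hτV x (by simpa using hxV)
        cases hε : ε 0 <;> simp [hε, this] at h0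
      have h1 := hsub (e x).succ (Finset.mem_univ _) hx
      have := hσ2 (e x) x (by simp [hxV])
      cases hε : ε (e x).succ <;> simp [hε, this] at h1
end
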